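/- There exist absolute constants c > 0 and C > 0 such that for every positive integer N the following holds: if A ⊆ {1,…,N} has the property that for all a, b ∈ A the number a − b + 1 is never prime (i.e., the difference of two elements of A is never one less than a prime), then |A| ≤ C·N·exp(−c·(log N)^{1/3}). -/

import Mathlib

section
open Complex Metric Set

lemma logDeriv_bound {f : ℂ → ℂ} (hf : Differentiable ℂ f) {c : ℂ} {R M : ℝ} (hR : 0 < R)
    (hM : 0 < M) (h0 : ∀ z ∈ ball c R, f z ≠ 0)
    (hb : ∀ z ∈ ball c R, ‖f z‖ ≤ Real.exp M * ‖f c‖) {z : ℂ} (hz : ‖z - c‖ ≤ 2 * R / 3) :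
    ‖deriv f z / f z‖ ≤ 60 * M / R := by
  have hd : DifferentiableOn ℂ (fun z => deriv f z / f z) (ball c R) :=
    (hf.contDiff (n := 2)).differentiable_deriv_two.differentiableOn.div hf.differentiableOn h0
  obtain ⟨g, hg⟩ := hd.isExactOn_ball
  have hcm : c ∈ ball c R := mem_ball_self hR
  have key : ∀ z ∈ ball c R, f z = f c * exp (g z - g c) := by
    have h1 : ∀ z ∈ ball c R, HasDerivAt (fun z => f z * exp (-(g z - g c))) 0 z := by
      intro z hz
      have := (hf z).hasDerivAt.mul (((hg z hz).sub_const (g c)).neg.cexp)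
      refine this.congr_deriv ?_
      have h3 := h0 z hz
      simp only [Pi.neg_apply]
      field_simp; ring
    intro z hz
    have h2 := (convex_ball c R).is_const_of_fderivWithin_eq_zero (𝕜 := ℂ)
      (f := fun z => f z * exp (-(g z - g c)))
      (fun z hz => (h1 z hz).differentiableAt.differentiableWithinAt)
      (fun z hz => by
        rw [fderivWithin_of_isOpen isOpen_ball hz]
        simpa using (h1 z hz).hasFDerivAt.fderiv) hz hcm
    simp only [sub_self, neg_zero, exp_zero, mul_one] at h2
    rw [← h2, mul_assoc, ← exp_add]; simp
  have hfc := h0 c hcm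
  set k : ℂ → ℂ := fun w => g (w + c) - g c
  have hmem : ∀ w ∈ ball (0:ℂ) R, w + c ∈ ball c R := fun w hw => by simpa [dist_eq_norm] using hw
  have hk : DifferentiableOn ℂ k (ball 0 R) := by
    intro w hw
    have := (hg (w + c) (hmem w hw)).comp_add_const w c
    exact (this.sub_const _).differentiableAt.differentiableWithinAt
  have hkre : Set.MapsTo k (ball 0 R) {z | z.re ≤ M} := by
    intro w hw
    have h1 := hb _ (hmem w hw)
    rw [key _ (hmem w hw), norm_mul, norm_exp, mul_comm] at h1
    exact Real.exp_le_exp.1 (le_of_mul_le_mul_right h1 (norm_pos_iff.2 hfc))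
  have hkb : ∀ w : ℂ, ‖w‖ ≤ 5 * R / 6 → ‖k w‖ ≤ 10 * M := by
    intro w hw
    have := borelCaratheodory_zero hM hk hkre hR (z := w) (by simp; linarith) (by simp [k])
    refine this.trans ?_
    rw [div_le_iff₀ (by linarith)]
    nlinarith
  have hzb : z ∈ ball c R := by simp [dist_eq_norm]; linarith
  have hder : deriv k (z - c) = deriv f z / f z := by
    have := (hg (z - c + c) (by simpa using hzb)).comp_add_const (z - c) c
    have h2 := (this.sub_const (g c)).deriv
    rw [sub_add_cancel] at h2; exact h2
  rw [← hder]
  have hdc : DiffContOnCl ℂ k (ball (z - c) (R / 6)) := by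
    apply DifferentiableOn.diffContOnCl
    refine hk.mono ?_
    rw [closure_ball _ (by positivity)]
    intro w hw
    simp only [mem_closedBall, dist_eq_norm, mem_ball, sub_zero] at *
    have := norm_add_le (w - (z - c)) (z - c)
    rw [sub_add_cancel] at this; linarith
  have := norm_deriv_le_of_forall_mem_sphere_norm_le (by positivity) hdc (C := 10 * M) (by
    intro w hw
    apply hkb
    simp only [mem_sphere_iff_norm] at hw
    have := norm_add_le (w - (z - c)) (z - c)
    rw [sub_add_cancel] at this; linarith)
  refine this.trans (le_of_eq ?_)
  field_simp; ring

/-- one Blaschke step -/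
lemma blaschke_step {f g : ℂ → ℂ} (hg : Differentiable ℂ g) {ρ : ℂ} (hfg : ∀ z, f z = (z - ρ) * g z)
    {r K : ℝ} (hr : 0 < r) (hρ : ‖ρ‖ ≤ r / 2) (hf0 : f 0 ≠ 0)
    (hb : ∀ z ∈ closedBall (0:ℂ) r, ‖f z‖ ≤ K * ‖f 0‖) :
    ∃ G : ℂ → ℂ, Differentiable ℂ G ∧ (∀ z, G z = g z * ((r ^ 2 - starRingEnd ℂ ρ * z) / r)) ∧ G 0 ≠ 0 ∧
      (∀ z ∈ closedBall (0:ℂ) r, ‖G z‖ ≤ K / 2 * ‖G 0‖) ∧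
      (∀ z ∈ ball (0:ℂ) r, G z = 0 → g z = 0) ∧
      (-(deriv f 0 / f 0)).re = (-(deriv G 0 / G 0)).re + ρ.re * (1 / ‖ρ‖ ^ 2 - 1 / r ^ 2) := by
  have hr' : (r : ℂ) ≠ 0 := by exact_mod_cast hr.ne'
  have hρ0 : ρ ≠ 0 := by rintro rfl; simp [hfg] at hf0
  have hg0 : g 0 ≠ 0 := by intro h; simp [hfg, h] at hf0
  have hρn : 0 < ‖ρ‖ := norm_pos_iff.2 hρ0
  set G : ℂ → ℂ := fun z => g z * ((r ^ 2 - starRingEnd ℂ ρ * z) / r) with hG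
  have hGd : Differentiable ℂ G := by fun_prop
  have hG0 : G 0 = g 0 * r := by simp [hG, pow_two, hr']
  have hK : 0 ≤ K := by
    have := hb 0 (by simp [hr.le])
    by_contra! h
    nlinarith [norm_pos_iff.2 hf0]
  have hsph : ∀ z ∈ sphere (0:ℂ) r, ‖G z‖ ≤ K / 2 * ‖G 0‖ := by
    intro z hz
    have hz' : ‖z‖ = r := by simpa using hz
    have h1 : ‖(r ^ 2 - starRingEnd ℂ ρ * z) / (r:ℂ)‖ = ‖z - ρ‖ := by
      have : ((r:ℂ) ^ 2 - starRingEnd ℂ ρ * z) = z * starRingEnd ℂ (z - ρ) := by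
        rw [map_sub, mul_sub, mul_conj, normSq_eq_norm_sq, hz']; push_cast; ring
      rw [this, norm_div, norm_mul, hz', RCLike.norm_conj, norm_real, Real.norm_of_nonneg hr.le]
      field_simp
    have h2 : ‖G z‖ = ‖f z‖ := by rw [hG, hfg]; simp only [norm_mul, h1]; ring
    rw [h2, hG0]
    refine (hb z (sphere_subset_closedBall hz)).trans ?_
    rw [hfg 0]; simp only [zero_sub, norm_mul, norm_neg, norm_real, Real.norm_of_nonneg hr.le]
    have : 0 ≤ K * ‖g 0‖ := by positivity
    nlinarith
  refine ⟨G, hGd, fun z => rfl, by rw [hG0]; exact mul_ne_zero hg0 hr', ?_, ?_, ?_⟩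
  · intro z hz
    refine norm_le_of_forall_mem_frontier_norm_le (U := ball 0 r) isBounded_ball
      hGd.diffContOnCl ?_ (by rwa [closure_ball _ hr.ne'])
    rwa [frontier_ball _ hr.ne']
  · intro z hz hz0
    rcases mul_eq_zero.1 hz0 with h | h
    · exact h
    · exfalso
      rw [div_eq_zero_iff, sub_eq_zero] at h
      rcases h with h | h
      · have h3 := congrArg norm h
        simp only [norm_pow, norm_real, Real.norm_of_nonneg hr.le, norm_mul, RCLike.norm_conj] at h3
        have : ‖z‖ < r := by simpa using hz
        nlinarith [norm_nonneg z]
      · exact hr' h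
  · have hdf : deriv f 0 = g 0 + (0 - ρ) * deriv g 0 := by
      have h1 := ((hasDerivAt_id (0:ℂ)).sub_const ρ).mul (hg 0).hasDerivAt
      have : f = (fun z => (id z - ρ)) * g := by ext z; simp [hfg]
      rw [this, h1.deriv]; simp
    have hdG : deriv G 0 = deriv g 0 * r + g 0 * (-(starRingEnd ℂ ρ) / r) := by
      have h1 := (hg 0).hasDerivAt.mul ((((hasDerivAt_id (0:ℂ)).const_mul (starRingEnd ℂ ρ)).const_sub
        ((r:ℂ)^2)).div_const (r:ℂ))
      refine (HasDerivAt.deriv (f' := _) h1).trans ?_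
      simp [pow_two, hr']
    rw [hdf, hdG, hG0, hfg 0]
    have e1 : -((g 0 + (0 - ρ) * deriv g 0) / ((0 - ρ) * g 0)) = 1 / ρ - deriv g 0 / g 0 := by
      field_simp; ring
    have e2 : -((deriv g 0 * r + g 0 * (-(starRingEnd ℂ ρ) / r)) / (g 0 * r))
        = (starRingEnd ℂ ρ) / (r^2 : ℝ) - deriv g 0 / g 0 := by
      push_cast; field_simp; ring
    rw [e1, e2]
    simp only [sub_re, one_div, inv_re, div_ofReal_re, conj_re, normSq_eq_norm_sq]
    ring

lemma landau_aux (n : ℕ) : ∀ (f : ℂ → ℂ) (r M : ℝ), Differentiable ℂ f → 0 < r → 0 < M →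
    M ≤ n * Real.log 2 → f 0 ≠ 0 →
    (∀ z ∈ closedBall (0:ℂ) r, ‖f z‖ ≤ Real.exp M * ‖f 0‖) →
    (∀ z ∈ ball (0:ℂ) r, f z = 0 → z.re ≤ 0) →
    (-(deriv f 0 / f 0)).re ≤ 120 * M / r := by
  induction n with
  | zero => intro f r M _ _ h1 h2; norm_num at h2; linarith
  | succ n ih =>
    intro f r M hf hr hM hn hf0 hb hz
    by_cases h : ∃ ρ ∈ ball (0:ℂ) (r/2), f ρ = 0
    · obtain ⟨ρ, hρ, hfρ⟩ := h
      have hfg : ∀ z, f z = (z - ρ) * dslope f ρ z := fun z => by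
        have := sub_smul_dslope f ρ z
        simp only [hfρ, sub_zero, smul_eq_mul] at this; exact this.symm
      have hdg : Differentiable ℂ (dslope f ρ) := by
        rw [← differentiableOn_univ]
        exact (differentiableOn_dslope Filter.univ_mem).2 hf.differentiableOn
      have hρ' : ‖ρ‖ < r / 2 := by simpa using hρ
      obtain ⟨G, hG1, -, hG2, hG3, hG4, hG5⟩ := blaschke_step hdg hfg hr hρ'.le hf0 hb
      have h2 : Real.exp M / 2 = Real.exp (M - Real.log 2) := by
        rw [Real.exp_sub, Real.exp_log two_pos]
      rw [h2] at hG3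
      rw [hG5]
      have hre : ρ.re ≤ 0 := hz ρ (by simp; linarith) hfρ
      have hρn : 0 < ‖ρ‖ := norm_pos_iff.2 (by rintro rfl; exact hf0 hfρ)
      have h3 : ρ.re * (1 / ‖ρ‖ ^ 2 - 1 / r ^ 2) ≤ 0 := by
        apply mul_nonpos_of_nonpos_of_nonneg hre
        rw [sub_nonneg]
        apply one_div_le_one_div_of_le (by positivity)
        gcongr; linarith
      have hlog : 0 < Real.log 2 := Real.log_pos one_lt_two
      have hGz : ∀ z ∈ ball (0:ℂ) r, G z = 0 → z.re ≤ 0 := fun z hz1 hz2 =>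
        hz z hz1 (by rw [hfg, hG4 z hz1 hz2, mul_zero])
      rcases le_or_gt (M - Real.log 2) 0 with hM' | hM'
      · have hM2 : ∀ z ∈ closedBall (0:ℂ) r, ‖G z‖ ≤ Real.exp (M / 2) * ‖G 0‖ := fun z hz => by
          refine (hG3 z hz).trans ?_
          gcongr
          linarith
        -- G is bounded by its value at 0, so of modulus maximal there
        have hconst : deriv G 0 = 0 := by
          have : IsLocalMax (fun z => ‖G z‖) 0 := by
            filter_upwards [closedBall_mem_nhds (0:ℂ) hr] with z hz
            refine (hG3 z hz).trans ?_
            have : Real.exp (M - Real.log 2) ≤ 1 := Real.exp_le_one_iff.2 hM'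
            nlinarith [norm_nonneg (G 0)]
          have := Complex.eventually_eq_of_isLocalMax_norm
            (Filter.Eventually.of_forall fun z => hG1 z) this
          rw [Filter.EventuallyEq.deriv_eq (f := fun _ => G 0) this]; simp
        rw [hconst]; simp only [zero_div, neg_zero, zero_re, zero_add]
        exact h3.trans (by positivity)
      · have := ih G r (M - Real.log 2) hG1 hr hM' (by push_cast at hn; linarith) hG2 hG3 hGz
        refine (add_le_add this h3).trans ?_
        rw [add_zero]; gcongr; linarith
    · push Not at h
      have := logDeriv_bound hf (c := 0) (R := r / 2) (by positivity) hM h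
        (fun z hz => hb z (by simp at hz ⊢; linarith)) (z := 0) (by simp; linarith)
      refine (re_le_norm _).trans ?_
      rw [norm_neg]; refine this.trans (le_of_eq ?_); field_simp; norm_num

lemma landau {f : ℂ → ℂ} {r M : ℝ} (hf : Differentiable ℂ f) (hr : 0 < r) (hM : 0 < M) (hf0 : f 0 ≠ 0)
    (hb : ∀ z ∈ closedBall (0:ℂ) r, ‖f z‖ ≤ Real.exp M * ‖f 0‖)
    (hz : ∀ z ∈ ball (0:ℂ) r, f z = 0 → z.re ≤ 0) :
    (-(deriv f 0 / f 0)).re ≤ 120 * M / r := by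
  obtain ⟨n, hn⟩ := exists_nat_ge (M / Real.log 2)
  rw [div_le_iff₀ (Real.log_pos one_lt_two)] at hn
  exact landau_aux n f r M hf hr hM hn hf0 hb hz

lemma landau_list (l : List ℂ) : ∀ {f g : ℂ → ℂ} {r M : ℝ}, Differentiable ℂ g →
    (∀ z, f z = (l.map (z - ·)).prod * g z) → 0 < r → 0 < M → f 0 ≠ 0 →
    (∀ ρ ∈ l, ‖ρ‖ ≤ r / 2) →
    (∀ z ∈ closedBall (0:ℂ) r, ‖f z‖ ≤ Real.exp M * ‖f 0‖) →
    (∀ z ∈ ball (0:ℂ) r, f z = 0 → z.re ≤ 0) →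
    (-(deriv f 0 / f 0)).re ≤ 120 * M / r + (l.map fun ρ => ρ.re * (1 / ‖ρ‖ ^ 2 - 1 / r ^ 2)).sum := by
  induction l with
  | nil =>
    intro f g r M hg hfg hr hM hf0 _ hb hz
    have : f = g := by ext z; simp [hfg]
    subst this
    simpa using landau hg hr hM hf0 hb hz
  | cons ρ l ih =>
    intro f g r M hg hfg hr hM hf0 hl hb hz
    have hg' : Differentiable ℂ (fun z => (l.map (z - ·)).prod * g z) := by
      refine Differentiable.mul ?_ hg
      clear * -
      induction l with
      | nil => simp
      | cons a l ih => simp only [List.map_cons, List.prod_cons]; fun_prop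
    have hfg' : ∀ z, f z = (z - ρ) * ((l.map (z - ·)).prod * g z) := fun z => by
      rw [hfg]; simp [mul_assoc]
    obtain ⟨G, hG1, hG2, hG3, hG4, hG5, hG6⟩ :=
      blaschke_step hg' hfg' hr (hl ρ (by simp)) hf0 hb
    rw [hG6]
    have := ih (f := G) (g := fun z => g z * ((r ^ 2 - starRingEnd ℂ ρ * z) / r)) (r := r) (M := M)
      (by fun_prop) (fun z => by rw [hG2]; ring) hr hM hG3 (fun a ha => hl a (by simp [ha]))
      (fun z hz => (hG4 z hz).trans (by gcongr; linarith [Real.exp_pos M]))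
      (fun z hz1 hz2 => hz z hz1 (by rw [hfg', hG5 z hz1 hz2, mul_zero]))
    simp only [List.map_cons, List.sum_cons]
    linarith

end

section
open Complex Metric Set Filter Topology MeasureTheory

lemma sum_range_zmod {M : Type*} [AddCommMonoid M] (m : ℕ) [NeZero m] (f : ZMod m → M) :
    ∑ n ∈ Finset.range m, f n = ∑ x : ZMod m, f x := by
  refine Finset.sum_bij (fun n _ => (n : ZMod m)) (fun _ _ => Finset.mem_univ _) ?_ ?_ (fun _ _ => rfl)
  · intro a ha b hb h
    rw [ZMod.natCast_eq_natCast_iff'] at h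
    rwa [Nat.mod_eq_of_lt (Finset.mem_range.1 ha), Nat.mod_eq_of_lt (Finset.mem_range.1 hb)] at h
  · intro x _
    exact ⟨x.val, Finset.mem_range.2 x.val_lt, by simp⟩

lemma periodic_sum_bound {m : ℕ} (hm : 0 < m) {a : ℕ → ℂ} {B : ℝ} (hp : ∀ n, a (n + m) = a n)
    (h0 : ∑ n ∈ Finset.range m, a n = 0) (hB : ∀ n, ‖a n‖ ≤ B) (k : ℕ) :
    ‖∑ n ∈ Finset.range k, a n‖ ≤ B * m := by
  have hB0 : 0 ≤ B := (norm_nonneg _).trans (hB 0)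
  induction k using Nat.strong_induction_on with
  | _ k ih =>
    rcases lt_or_ge k m with h | h
    · refine (norm_sum_le_of_le _ (fun n _ => hB n)).trans ?_
      simp only [Finset.sum_const, Finset.card_range, nsmul_eq_mul]
      rw [mul_comm]; gcongr
    · obtain ⟨j, rfl⟩ := Nat.exists_eq_add_of_le h
      rw [Finset.sum_range_add, h0, zero_add]
      simp_rw [add_comm m, hp]
      exact ih j (by omega)

noncomputable def Lent {m : ℕ} [NeZero m] (χ : DirichletCharacter ℂ m) : ℂ → ℂ :=
  open Classical in if χ = 1 then DirichletCharacter.LFunctionTrivChar₁ m else χ.LFunction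

lemma Lent_differentiable {m : ℕ} [NeZero m] (χ : DirichletCharacter ℂ m) : Differentiable ℂ (Lent χ) := by
  unfold Lent
  split_ifs with h
  · exact DirichletCharacter.differentiable_LFunctionTrivChar₁ m
  · exact DirichletCharacter.differentiable_LFunction h

open Classical in
lemma Lent_eq {m : ℕ} [NeZero m] (χ : DirichletCharacter ℂ m) {s : ℂ} (hs : s ≠ 1) :
    Lent χ s = (if χ = 1 then s - 1 else 1) * χ.LFunction s := by
  unfold Lent
  split_ifs with h
  · subst h; exact Function.update_of_ne hs _ _
  · simp

lemma Lent_bound {m : ℕ} [NeZero m] (χ : DirichletCharacter ℂ m) {s : ℂ} (hs : 1 / 2 ≤ s.re) :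
    ‖Lent χ s‖ ≤ 10 * m * (‖s‖ + 1) ^ 2 := by
  classical
  have hm : 0 < m := Nat.pos_of_ne_zero (NeZero.ne m)
  have hm1 : (1 : ℝ) ≤ m := by exact_mod_cast hm
  set c : ℂ := (∑ n ∈ Finset.range m, χ n) / m with hc
  have hcn : ‖c‖ ≤ 1 := by
    rw [hc, norm_div, norm_natCast, div_le_one (by positivity)]
    refine (norm_sum_le_of_le _ (fun n _ => χ.norm_le_one _)).trans ?_
    simp
  have hc0 : χ ≠ 1 → c = 0 := fun h => by
    rw [hc, sum_range_zmod m (fun x => χ x), MulChar.sum_eq_zero_of_ne_one h, zero_div]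
  have hmc : (m : ℂ) ≠ 0 := by exact_mod_cast hm.ne'
  set S : ℝ → ℂ := fun u => ∑ k ∈ Finset.Icc 1 ⌊u⌋₊, χ k with hS
  have hSb : ∀ u : ℝ, 1 < u → ‖S u - c * u‖ ≤ 4 * m := by
    intro u hu
    have h1 := periodic_sum_bound hm (a := fun n => χ n - c) (B := 2) (by intro n; simp)
      (by simp [Finset.sum_sub_distrib, hc]; field_simp; simp)
      (fun n => (norm_sub_le _ _).trans (by linarith [χ.norm_le_one n])) (⌊u⌋₊ + 1)
    have h2 : S u - c * u = ∑ n ∈ Finset.range (⌊u⌋₊ + 1), (χ n - c) - χ (0:ℕ)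
        + c * ((⌊u⌋₊ + 1 - u : ℝ) : ℂ) := by
      simp only [hS]
      rw [Finset.sum_sub_distrib, Finset.sum_const, Finset.range_eq_Ico,
        Finset.sum_eq_sum_Ico_succ_bot (by omega)]
      simp only [Nat.card_Ico, nsmul_eq_mul]
      rw [show Finset.Ico (0+1) (⌊u⌋₊ + 1) = Finset.Icc 1 ⌊u⌋₊ by ext; simp]
      push_cast; ring
    rw [h2]
    have h3 : ‖c * ((⌊u⌋₊ + 1 - u : ℝ) : ℂ)‖ ≤ 1 := by
      rw [norm_mul, norm_real, Real.norm_eq_abs]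
      have := Nat.lt_floor_add_one u
      have := Nat.floor_le (zero_le_one.trans hu.le)
      rw [abs_of_nonneg (by linarith)]
      exact mul_le_one₀ hcn (by linarith) (by linarith)
    have := χ.norm_le_one ((0:ℕ) : ZMod m)
    refine (norm_add_le _ _).trans ((add_le_add (norm_sub_le _ _) le_rfl).trans ?_)
    linarith
  set E : ℝ → ℂ := (Ioi (1:ℝ)).indicator (fun u => S u - c * u) with hE
  have hmeas : Measurable E := by
    refine Measurable.indicator ?_ measurableSet_Ioi
    have : Measurable (fun n : ℕ => ∑ k ∈ Finset.Icc 1 n, χ k) := measurable_from_nat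
    exact (this.comp Nat.measurable_floor).sub (by fun_prop)
  have hEb : ∀ u, ‖E u‖ ≤ 4 * m := fun u => by
    by_cases h : u ∈ Ioi (1:ℝ)
    · rw [hE, indicator_of_mem h]; exact hSb u h
    · rw [hE, indicator_of_notMem h]; simp
  have hEl : LocallyIntegrableOn E (Ioi 0) := by
    refine LocallyIntegrable.locallyIntegrableOn ?_ _
    exact (locallyIntegrable_const (4 * m : ℝ)).mono hmeas.aestronglyMeasurable
      (Eventually.of_forall fun u => (hEb u).trans (Real.le_norm_self _))
  have hdiff : ∀ s : ℂ, 0 < s.re → DifferentiableAt ℂ (fun s => mellin E (-s)) s := by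
    intro s hs
    have := mellin_differentiableAt_of_isBigO_rpow (a := 0) (b := -s.re - 1) (s := -s) hEl
      (Asymptotics.IsBigO.of_bound (4 * m) (Eventually.of_forall fun u => by simpa using hEb u))
      (by simpa using hs) (by
        refine Asymptotics.IsBigO.of_bound 1 ?_
        filter_upwards [Ioo_mem_nhdsGT (zero_lt_one' ℝ)] with u hu
        rw [hE, indicator_of_notMem (by simpa using hu.2.le)]; simp) (by simp)
    exact this.comp s (by fun_prop)
  have hmel : ∀ s : ℂ, mellin E (-s) = ∫ u in Ioi (1:ℝ), (S u - c * u) * (u:ℂ) ^ (-(s + 1)) := by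
    intro s
    rw [mellin, ← integral_indicator measurableSet_Ioi, ← integral_indicator measurableSet_Ioi]
    congr 1; ext u
    by_cases h : u ∈ Ioi (1:ℝ)
    · rw [indicator_of_mem h, indicator_of_mem (Ioi_subset_Ioi zero_le_one h), hE, indicator_of_mem h,
        smul_eq_mul, mul_comm, neg_add']
    · rw [indicator_of_notMem h]
      rw [indicator_apply_eq_zero]; intro _; simp [hE, indicator_of_notMem h]
  have hnb : ∀ s : ℂ, ∀ u ∈ Ioi (1:ℝ), ‖(S u - c * u) * (u:ℂ) ^ (-(s + 1))‖ ≤ 4 * m * u ^ (-(s.re + 1)) := by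
    intro s u hu
    have hu0 : 0 < u := zero_lt_one.trans hu
    rw [norm_mul, norm_cpow_eq_rpow_re_of_pos hu0]
    simp only [neg_re, add_re, one_re]
    gcongr; exact hSb u hu
  set J : ℂ → ℂ := fun s => if χ = 1 then c * s + (s - 1) * s * mellin E (-s) else s * mellin E (-s) with hJ
  have hEq : ∀ s : ℂ, 1 < s.re → Lent χ s = J s := by
    intro s hs
    have hs1 : s ≠ 1 := by rintro rfl; simp at hs
    have hL : χ.LFunction s = s * mellin E (-s) + c * s / (s - 1) := by
      rw [DirichletCharacter.LFunction_eq_LSeries χ hs, LSeries_eq_mul_integral' (r := 1) _ zero_le_one hs]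
      · have hi1 : IntegrableOn (fun u : ℝ => (S u - c * u) * (u:ℂ) ^ (-(s + 1))) (Ioi 1) := by
          refine Integrable.mono' (g := fun u : ℝ => 4 * m * u ^ (-(s.re + 1))) ?_ ?_ ?_
          · exact (integrableOn_Ioi_rpow_of_lt (by linarith) one_pos).const_mul _
          · refine Measurable.aestronglyMeasurable ?_
            have : Measurable (fun n : ℕ => ∑ k ∈ Finset.Icc 1 n, χ k) := measurable_from_nat
            exact ((this.comp Nat.measurable_floor).sub (by fun_prop)).mul (by fun_prop)
          · exact (ae_restrict_iff' measurableSet_Ioi).2 (Eventually.of_forall (hnb s))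
        have hi2 : IntegrableOn (fun u : ℝ => c * (u:ℂ) ^ (-s)) (Ioi 1) :=
          (integrableOn_Ioi_cpow_of_lt (by simpa using hs) one_pos).const_mul c
        have : ∫ u in Ioi (1:ℝ), S u * (u:ℂ) ^ (-(s + 1)) =
            ∫ u in Ioi (1:ℝ), ((S u - c * u) * (u:ℂ) ^ (-(s + 1)) + c * (u:ℂ) ^ (-s)) := by
          refine setIntegral_congr_fun measurableSet_Ioi fun u hu => ?_
          have hu0 : (u:ℂ) ≠ 0 := by exact_mod_cast (zero_lt_one.trans hu).ne'
          have : (u:ℂ) ^ (-s) = u * (u:ℂ) ^ (-(s+1)) := by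
            rw [neg_add', cpow_sub _ _ hu0, cpow_one]; field_simp
          simp only [this]; ring
        rw [this, integral_add hi1 hi2, ← hmel, integral_const_mul,
          integral_Ioi_cpow_of_lt (by simpa using hs) one_pos]
        have : s - 1 ≠ 0 := sub_ne_zero.2 hs1
        have h2 : -s + 1 ≠ 0 := by rw [neg_add_eq_sub]; exact sub_ne_zero.2 hs1.symm
        simp only [ofReal_one, one_cpow]
        rw [mul_add]; congr 1
        field_simp; ring
      · refine Asymptotics.IsBigO.of_bound 1 (Eventually.of_forall fun n => ?_)
        rw [Real.rpow_one, one_mul, Real.norm_of_nonneg (by positivity)]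
        refine (Finset.sum_le_sum (g := fun _ => (1:ℝ)) fun k _ => χ.norm_le_one _).trans ?_
        simp
    rw [Lent_eq χ hs1, hL, hJ]
    simp only
    split_ifs with h
    · have : s - 1 ≠ 0 := sub_ne_zero.2 hs1
      field_simp; ring
    · simp [hc0 h]
  have hEq2 : EqOn (Lent χ) J {s | 0 < s.re} := by
    have ho : IsOpen {s : ℂ | 0 < s.re} := isOpen_lt continuous_const continuous_re
    have hJd : DifferentiableOn ℂ J {s | 0 < s.re} := by
      intro s hs
      have := hdiff s hs
      refine DifferentiableAt.differentiableWithinAt ?_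
      simp only [hJ]
      split_ifs <;> fun_prop
    refine ((Lent_differentiable χ).differentiableOn.analyticOnNhd ho).eqOn_of_preconnected_of_eventuallyEq
      (hJd.analyticOnNhd ho) (convex_halfSpace_re_gt 0).isPreconnected (z₀ := 2) (by simp) ?_
    filter_upwards [(isOpen_lt continuous_const continuous_re).mem_nhds
      (show (1:ℝ) < (2:ℂ).re by simp)] with z hz using hEq z hz
  rw [hEq2 (show 0 < s.re by linarith)]
  have hmb : ‖mellin E (-s)‖ ≤ 8 * m := by
    rw [hmel]
    refine (norm_integral_le_of_norm_le (g := fun u : ℝ => 4 * m * u ^ (-(3/2:ℝ)))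
      ((integrableOn_Ioi_rpow_of_lt (by norm_num) one_pos).const_mul _)
      ((ae_restrict_iff' measurableSet_Ioi).2 (Eventually.of_forall fun u hu => (hnb s u hu).trans ?_))).trans ?_
    · have : (1:ℝ) ≤ u := le_of_lt hu
      gcongr
      · linarith
    · rw [integral_const_mul, integral_Ioi_rpow_of_lt (by norm_num) one_pos]; norm_num; linarith
  have hsn := norm_nonneg s
  have h1 : ‖s * mellin E (-s)‖ ≤ ‖s‖ * (8 * m) := by rw [norm_mul]; gcongr
  simp only [hJ]
  split_ifs
  · have h2 : ‖(s - 1) * s * mellin E (-s)‖ ≤ (‖s‖ + 1) * (‖s‖ * (8 * m)) := by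
      rw [mul_assoc, norm_mul]; gcongr; exact (norm_sub_le _ _).trans (by simp)
    have h3 : ‖c * s‖ ≤ m * ‖s‖ := by rw [norm_mul]; gcongr; linarith
    refine (norm_add_le _ _).trans ((add_le_add h3 h2).trans ?_)
    nlinarith [mul_nonneg hsn hsn, mul_nonneg (mul_nonneg hsn hsn) (zero_le_one.trans hm1), mul_nonneg hsn (zero_le_one.trans hm1)]
  · refine h1.trans ?_
    nlinarith [mul_nonneg hsn hsn, mul_nonneg (mul_nonneg hsn hsn) (zero_le_one.trans hm1), mul_nonneg hsn (zero_le_one.trans hm1)]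

end

section
open Complex Metric Set Filter Topology MeasureTheory

lemma LSeries_norm_le_zeta {f : ℕ → ℂ} (hf : ∀ n, ‖f n‖ ≤ 1) {s : ℂ} (hs : 1 < s.re) (hs2 : s.re ≤ 2) :
    ‖LSeries f s‖ ≤ 90 / (s.re - 1) := by
  have h1 : 1 < ((s.re : ℝ) : ℂ).re := by simpa
  have hsum : LSeriesSummable 1 (s.re : ℂ) := LSeriesSummable_one_iff.2 h1
  have h2 : ‖LSeries f s‖ ≤ ∑' n, ‖LSeries.term 1 (s.re : ℂ) n‖ := by
    refine tsum_of_norm_bounded hsum.norm.hasSum fun n => ?_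
    refine (LSeries.norm_term_le s (g := 1) (by simpa using hf n)).trans (le_of_eq ?_)
    simp [LSeries.norm_term_eq]
  have h3 : ∑' n, ‖LSeries.term 1 (s.re : ℂ) n‖ ≤ ‖riemannZeta (s.re : ℂ)‖ := by
    rw [← LSeries_one_eq_riemannZeta h1]
    have : LSeries 1 (s.re : ℂ) = ((∑' n, ‖LSeries.term 1 (s.re : ℂ) n‖ : ℝ) : ℂ) := by
      rw [ofReal_tsum]
      refine tsum_congr fun n => ?_
      rw [LSeries.norm_term_eq, LSeries.term_def]
      split_ifs with h <;> simp [ofReal_cpow (Nat.cast_nonneg n)]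
    rw [this, norm_real]; exact Real.le_norm_self _
  have h4 := Lent_bound (m := 1) 1 (s := (s.re : ℂ)) (by simp; linarith)
  have hne : (s.re : ℂ) ≠ 1 := by intro h; rw [h] at h1; simp at h1
  rw [Lent_eq _ hne, if_pos rfl, DirichletCharacter.LFunction_modOne_eq, norm_mul,
    ← ofReal_one, ← ofReal_sub, norm_real, norm_real, Real.norm_of_nonneg (by linarith),
    Real.norm_of_nonneg (by linarith)] at h4
  rw [le_div_iff₀ (by linarith)]
  have h5 := h2.trans h3
  have : 10 * ((1:ℕ):ℝ) * (s.re + 1) ^ 2 ≤ 90 := by push_cast; nlinarith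
  nlinarith

lemma L_lower {m : ℕ} [NeZero m] (χ : DirichletCharacter ℂ m) {s : ℂ} (hs : 1 < s.re) (hs2 : s.re ≤ 2) :
    (s.re - 1) / 90 ≤ ‖χ.LFunction s‖ := by
  have h1 := DirichletCharacter.LSeries.mul_mu_eq_one χ hs
  rw [← DirichletCharacter.LFunction_eq_LSeries χ hs] at h1
  have h2 := LSeries_norm_le_zeta (f := fun n => χ n * (ArithmeticFunction.moebius n : ℂ)) (fun n => by
    rw [norm_mul]
    refine mul_le_one₀ (χ.norm_le_one _) (norm_nonneg _) ?_
    rw [norm_intCast]; exact_mod_cast ArithmeticFunction.abs_moebius_le_one) hs hs2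
  have h3 := congrArg norm h1
  rw [norm_mul, norm_one] at h3
  have h4 : ‖χ.LFunction s‖ * (90 / (s.re - 1)) ≥ 1 := by
    exact h3.symm.le.trans (mul_le_mul_of_nonneg_left h2 (norm_nonneg _))
  have : 0 < s.re - 1 := by linarith
  rw [div_le_iff₀ (by norm_num)]
  rw [ge_iff_le, mul_div_assoc', le_div_iff₀ this] at h4
  linarith

lemma Lent_lower {m : ℕ} [NeZero m] (χ : DirichletCharacter ℂ m) {s : ℂ} (hs : 1 < s.re) (hs2 : s.re ≤ 2) :
    (s.re - 1) ^ 2 / 90 ≤ ‖Lent χ s‖ := by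
  classical
  have hs1 : s ≠ 1 := by rintro rfl; simp at hs
  rw [Lent_eq χ hs1, norm_mul]
  have h1 := L_lower χ hs hs2
  have h2 : s.re - 1 ≤ ‖(if χ = 1 then s - 1 else 1)‖ := by
    split_ifs
    · exact (re_le_norm (s - 1)).trans' (by simp)
    · simp; linarith
  calc _ = (s.re - 1) * ((s.re - 1) / 90) := by ring
    _ ≤ _ := by gcongr

lemma Lent_ne_zero {m : ℕ} [NeZero m] (χ : DirichletCharacter ℂ m) {s : ℂ} (hs : 1 ≤ s.re) : Lent χ s ≠ 0 := by
  classical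
  by_cases h : s = 1
  · subst h
    unfold Lent
    split_ifs with h
    · exact DirichletCharacter.LFunctionTrivChar₁_apply_one_ne_zero m
    · exact DirichletCharacter.LFunction_apply_one_ne_zero h
  · rw [Lent_eq χ h]
    refine mul_ne_zero ?_ (DirichletCharacter.LFunction_ne_zero_of_one_le_re χ (.inr h) hs)
    split_ifs
    · exact sub_ne_zero.2 h
    · simp

/-- minus the logarithmic derivative -/
noncomputable def nlogL {m : ℕ} [NeZero m] (χ : DirichletCharacter ℂ m) (s : ℂ) : ℂ :=
  -(deriv χ.LFunction s / χ.LFunction s)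

open Classical in
lemma nlogL_eq {m : ℕ} [NeZero m] (χ : DirichletCharacter ℂ m) {s : ℂ} (hs : s ≠ 1) (h0 : Lent χ s ≠ 0) :
    nlogL χ s = -(deriv (Lent χ) s / Lent χ s) + if χ = 1 then 1 / (s - 1) else 0 := by
  have h1 := Lent_eq χ hs
  unfold nlogL
  by_cases h : χ = 1
  · subst h
    have hd := DirichletCharacter.deriv_LFunctionTrivChar₁_apply_of_ne_one m hs
    simp only [Lent, if_true] at *
    have hs' := sub_ne_zero.2 hs
    have hL : (1 : DirichletCharacter ℂ m).LFunction s ≠ 0 := by rintro h; simp [h1, h] at h0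
    rw [hd, h1]
    simp only [DirichletCharacter.LFunctionTrivChar]
    field_simp; ring
  · simp only [Lent, if_neg h, add_zero]

lemma nlogL_eq_LSeries {m : ℕ} [NeZero m] (χ : DirichletCharacter ℂ m) {s : ℂ} (hs : 1 < s.re) :
    nlogL χ s = LSeries (fun n => χ n * (ArithmeticFunction.vonMangoldt n : ℂ)) s := by
  have := DirichletCharacter.LSeries_twist_vonMangoldt_eq χ hs
  rw [nlogL, DirichletCharacter.deriv_LFunction_eq_deriv_LSeries χ hs,
    DirichletCharacter.LFunction_eq_LSeries χ hs, ← neg_div, ← this]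
  rfl

open Classical in
lemma landau_L {m : ℕ} [NeZero m] (χ : DirichletCharacter ℂ m) (l : List ℂ) {g : ℂ → ℂ} (hg : Differentiable ℂ g)
    (hfg : ∀ s, Lent χ s = (l.map (s - ·)).prod * g s) {η t : ℝ} (hη : 0 < η) (hη2 : η ≤ 1 / 4)
    (hl : ∀ ρ ∈ l, ‖ρ - (1 + η + t * I)‖ ≤ 1 / 4) :
    (nlogL χ (1 + η + t * I)).re ≤ (if χ = 1 then η / (η ^ 2 + t ^ 2) else 0)
      + 240 * Real.log (900 * m * (|t| + 4) ^ 2 / η ^ 2) + l.length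
      - (l.map fun ρ => (1 / (1 + η + t * I - ρ)).re).sum := by
  set s₀ : ℂ := 1 + η + t * I with hs₀
  have hre : s₀.re = 1 + η := by simp [hs₀]
  have him : s₀.im = t := by simp [hs₀]
  have hs1 : s₀ ≠ 1 := by intro h; rw [h] at hre; simp at hre; linarith
  have hL0 : Lent χ s₀ ≠ 0 := Lent_ne_zero χ (by linarith)
  have hm1 : (1 : ℝ) ≤ m := by exact_mod_cast Nat.pos_of_ne_zero (NeZero.ne m)
  set M := Real.log (900 * m * (|t| + 4) ^ 2 / η ^ 2) with hM
  have hbig : 1 < 900 * m * (|t| + 4) ^ 2 / η ^ 2 := by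
    rw [one_lt_div (by positivity)]
    have := abs_nonneg t
    nlinarith
  have hsn : ‖s₀‖ ≤ 5 / 4 + |t| := by
    refine (norm_add_le _ _).trans ?_
    rw [norm_mul, norm_I, norm_real, mul_one, ← ofReal_one, ← ofReal_add, norm_real,
      Real.norm_of_nonneg (by linarith)]
    simp; linarith
  have key := landau_list (l.map (· - s₀)) (f := fun z => Lent χ (s₀ + z)) (g := fun z => g (s₀ + z))
    (r := 1 / 2) (M := M) (by fun_prop) (fun z => by
      simp only [hfg, List.map_map]; congr 3; ext ρ; simp; ring) (by norm_num) (Real.log_pos hbig)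
    (by simpa using hL0) (fun ρ hρ => by
      obtain ⟨a, ha, rfl⟩ := List.mem_map.1 hρ
      refine (hl a ha).trans (by norm_num))
    (fun z hz => by
      have hz' : ‖z‖ ≤ 1 / 2 := by simpa using hz
      have h1 := (abs_re_le_norm z).trans hz'
      rw [abs_le] at h1
      refine (Lent_bound χ (by rw [add_re, hre]; linarith)).trans ?_
      have h2 := Lent_lower χ (s := s₀) (by linarith) (by linarith)
      rw [hM, Real.exp_log (by linarith), add_zero]
      have h3 : ‖s₀ + z‖ + 1 ≤ |t| + 4 := by linarith [norm_add_le s₀ z]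
      calc 10 * m * (‖s₀ + z‖ + 1) ^ 2 ≤ 10 * m * (|t| + 4) ^ 2 := by gcongr
        _ = 900 * m * (|t| + 4) ^ 2 / η ^ 2 * ((s₀.re - 1) ^ 2 / 90) := by
            rw [hre]; field_simp; ring
        _ ≤ _ := by gcongr)
    (fun z _ hz => by
      by_contra! h
      exact Lent_ne_zero χ (s := s₀ + z) (by rw [add_re, hre]; linarith) hz)
  rw [nlogL_eq χ hs1 hL0, add_re]
  have hd : deriv (fun z => Lent χ (s₀ + z)) 0 = deriv (Lent χ) s₀ := by
    rw [deriv_comp_const_add, add_zero]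
  simp only [add_zero, hd, List.map_map] at key
  have h5 : (if χ = 1 then 1 / (s₀ - 1) else 0).re = if χ = 1 then η / (η ^ 2 + t ^ 2) else 0 := by
    split_ifs
    · simp [inv_re, normSq_apply, hre, him]; ring
    · rfl
  have h6 : (l.map ((fun ρ : ℂ => ρ.re * (1 / ‖ρ‖ ^ 2 - 1 / (1 / 2 : ℝ) ^ 2)) ∘ fun x => x - s₀)).sum
      ≤ l.length - (l.map fun ρ => (1 / (s₀ - ρ)).re).sum := by
    clear key hfg
    induction l with
    | nil => simp
    | cons a l ih =>
      have := ih (fun ρ hρ => hl ρ (by simp [hρ]))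
      simp only [List.map_cons, List.sum_cons, List.length_cons, Function.comp_apply]
      have h7 : (1 / (s₀ - a)).re = - ((a - s₀).re * (1 / ‖a - s₀‖ ^ 2)) := by
        rw [one_div, inv_re, normSq_eq_norm_sq, ← norm_neg (s₀ - a), neg_sub]
        simp only [sub_re]; ring
      have h8 := (abs_re_le_norm (a - s₀)).trans (hl a (by simp))
      rw [abs_le] at h8
      rw [h7]
      push_cast
      simp only [Function.comp_def] at this ⊢
      linarith
  rw [h5]
  have : 120 * M / (1 / 2) = 240 * M := by ring
  linarith

end

section
open Complex Metric Set Filter Topology MeasureTheory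

lemma pos_combo {m : ℕ} [NeZero m] {k : ℕ} (c t : Fin k → ℝ) (χ : Fin k → DirichletCharacter ℂ m) {η : ℝ}
    (hη : 0 < η) (h : ∀ n : ℕ, n ≠ 0 → 0 ≤ ∑ i, c i * (χ i n * (n : ℂ) ^ (-(t i * I))).re) :
    0 ≤ ∑ i, c i * (nlogL (χ i) (1 + η + t i * I)).re := by
  have hs : ∀ i, 1 < (1 + η + t i * I : ℂ).re := fun i => by simp [hη]
  have h1 : ∀ i, HasSum (fun n => c i * (LSeries.term (fun n => χ i n * (ArithmeticFunction.vonMangoldt n : ℂ))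
      (1 + η + t i * I) n).re) (c i * (nlogL (χ i) (1 + η + t i * I)).re) := by
    intro i
    rw [nlogL_eq_LSeries _ (hs i)]
    exact (hasSum_re (DirichletCharacter.LSeriesSummable_twist_vonMangoldt (χ i) (hs i)).hasSum).mul_left _
  have h2 := hasSum_sum (s := Finset.univ) fun i _ => h1 i
  refine h2.nonneg fun n => ?_
  rcases eq_or_ne n 0 with rfl | hn
  · simp
  have hn' : (n : ℂ) ≠ 0 := by exact_mod_cast hn
  have : ∀ i, c i * (LSeries.term (fun n => χ i n * (ArithmeticFunction.vonMangoldt n : ℂ))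
      (1 + η + t i * I) n).re = (ArithmeticFunction.vonMangoldt n * (n : ℝ) ^ (-(1 + η)))
        * (c i * (χ i n * (n : ℂ) ^ (-(t i * I))).re) := by
    intro i
    rw [LSeries.term_of_ne_zero hn, div_eq_mul_inv, ← cpow_neg, neg_add, cpow_add _ _ hn']
    have : (n : ℂ) ^ (-(1 + η) : ℂ) = (((n : ℝ) ^ (-(1 + η)) : ℝ) : ℂ) := by
      rw [ofReal_cpow (Nat.cast_nonneg n)]; simp
    rw [this, show χ i n * (ArithmeticFunction.vonMangoldt n : ℂ) * ((((n : ℝ) ^ (-(1 + η)) : ℝ) : ℂ) *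
      (n : ℂ) ^ (-(t i * I))) = ((ArithmeticFunction.vonMangoldt n * (n : ℝ) ^ (-(1 + η)) : ℝ) : ℂ) *
      (χ i n * (n : ℂ) ^ (-(t i * I))) by push_cast; ring, re_ofReal_mul]
    ring
  simp_rw [this, ← Finset.mul_sum]
  exact mul_nonneg (mul_nonneg ArithmeticFunction.vonMangoldt_nonneg (by positivity)) (h n hn)

lemma real_val {m : ℕ} {χ : DirichletCharacter ℂ m} (h : χ ^ 2 = 1) (x : ZMod m) (hx : IsUnit x) :
    χ x = 1 ∨ χ x = -1 := by
  have : χ x ^ 2 = 1 := by rw [← MulChar.pow_apply' χ two_ne_zero, h, MulChar.one_apply hx]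
  exact mul_self_eq_one_iff.1 (by rw [← pow_two]; exact this)

lemma Lent_conj {m : ℕ} [NeZero m] {χ : DirichletCharacter ℂ m} (h : χ ^ 2 = 1) (s : ℂ) :
    Lent χ (starRingEnd ℂ s) = starRingEnd ℂ (Lent χ s) := by
  classical
  have hd : Differentiable ℂ (fun s => starRingEnd ℂ (Lent χ (starRingEnd ℂ s))) := fun s =>
    by simpa [Function.comp_def] using ((Lent_differentiable χ) (starRingEnd ℂ s)).conj_conj
  have h1 : ∀ s : ℂ, 1 < s.re → starRingEnd ℂ (Lent χ (starRingEnd ℂ s)) = Lent χ s := by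
    intro s hs
    have hs1 : s ≠ 1 := by rintro rfl; simp at hs
    have hs2 : starRingEnd ℂ s ≠ 1 := by intro h; rw [← conj_conj s, h] at hs; simp at hs
    rw [Lent_eq χ hs1, Lent_eq χ hs2, map_mul]
    congr 1
    · split_ifs <;> simp
    · rw [DirichletCharacter.LFunction_eq_LSeries χ hs, DirichletCharacter.LFunction_eq_LSeries χ (by simpa),
        LSeries, LSeries, conj_tsum]
      refine tsum_congr fun n => ?_
      rcases eq_or_ne n 0 with rfl | hn
      · simp
      rw [LSeries.term_of_ne_zero hn, LSeries.term_of_ne_zero hn, map_div₀]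
      congr 1
      · by_cases hu : IsUnit (n : ZMod m)
        · rcases real_val h _ hu with h | h <;> simp [h]
        · simp [MulChar.map_nonunit _ hu]
      · rw [← conj_cpow _ _ (by rw [natCast_arg]; exact Real.pi_pos.ne), conj_natCast]
  have h2 := (hd.differentiableOn.analyticOnNhd isOpen_univ).eqOn_of_preconnected_of_eventuallyEq
    ((Lent_differentiable χ).differentiableOn.analyticOnNhd isOpen_univ) isPreconnected_univ (z₀ := 2)
    (mem_univ _) (by
      filter_upwards [(isOpen_lt continuous_const continuous_re).mem_nhds
        (show (1:ℝ) < (2:ℂ).re by simp)] with z hz using h1 z hz)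
  have h3 := h2 (mem_univ s)
  simp only at h3
  rw [← h3, conj_conj]

lemma param_large : ∀ᶠ Q : ℝ in atTop, 1 ≤ Real.log Q ∧ 900 * (75000 * Real.log Q) ^ 2 ≤ Q ^ 2 := by
  have h1 : ∀ᶠ Q : ℝ in atTop, 1 ≤ Real.log Q := Real.tendsto_log_atTop.eventually_ge_atTop 1
  have h2 := Real.isLittleO_log_id_atTop.bound (c := 1 / 2250000) (by norm_num)
  filter_upwards [h1, h2, eventually_gt_atTop 0] with Q h1 h2 h3
  refine ⟨h1, ?_⟩
  rw [Real.norm_of_nonneg (by linarith), id, Real.norm_of_nonneg h3.le] at h2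
  calc 900 * (75000 * Real.log Q) ^ 2 = (2250000 * Real.log Q) ^ 2 := by ring
    _ ≤ Q ^ 2 := by gcongr; linarith

open Classical in
lemma landau_L' {Q : ℝ} (hQ : 1 ≤ Real.log Q ∧ 900 * (75000 * Real.log Q) ^ 2 ≤ Q ^ 2) {m : ℕ} [NeZero m]
    (χ : DirichletCharacter ℂ m) (l : List ℂ) {g : ℂ → ℂ} (hg : Differentiable ℂ g) (hlen : l.length ≤ 2)
    (hfg : ∀ s, Lent χ s = (l.map (s - ·)).prod * g s) {η t : ℝ} (hη : 1 / (75000 * Real.log Q) ≤ η) (hη2 : η ≤ 1 / 20)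
    (hm : m * (|t| + 4) ^ 2 ≤ Q)
    (hl : ∀ ρ ∈ l, ‖ρ - (1 + η + t * I)‖ ≤ 1 / 4) :
    (nlogL χ (1 + η + t * I)).re ≤ (if χ = 1 then η / (η ^ 2 + t ^ 2) else 0)
      + 750 * Real.log Q - (l.map fun ρ => (1 / (1 + η + t * I - ρ)).re).sum := by
  obtain ⟨hQ1, hQ2⟩ := hQ
  have hη0 : 0 < η := lt_of_lt_of_le (by positivity) hη
  have hm1 : (1 : ℝ) ≤ m := by exact_mod_cast Nat.pos_of_ne_zero (NeZero.ne m)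
  have hQ0 : 0 < Q := lt_of_lt_of_le (by positivity) hm
  have h1 := landau_L χ l hg hfg hη0 (by linarith) hl
  have h2 : Real.log (900 * m * (|t| + 4) ^ 2 / η ^ 2) ≤ 3 * Real.log Q := by
    rw [← Real.log_rpow hQ0]
    apply Real.log_le_log (by positivity)
    have h3 : 900 / η ^ 2 ≤ Q ^ 2 := by
      refine le_trans ?_ hQ2
      rw [div_le_iff₀ (by positivity), mul_assoc, ← mul_pow]
      rw [div_le_iff₀ (by positivity)] at hη
      have : 1 ≤ (75000 * Real.log Q * η) ^ 2 := one_le_pow₀ (by linarith)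
      linarith
    calc 900 * m * (|t| + 4) ^ 2 / η ^ 2 = (m * (|t| + 4) ^ 2) * (900 / η ^ 2) := by ring
      _ ≤ Q * Q ^ 2 := by gcongr
      _ = _ := by norm_cast; ring
  have h4 : (l.length : ℝ) ≤ 2 := by exact_mod_cast hlen
  linarith

lemma Lent_dslope {m : ℕ} [NeZero m] {χ : DirichletCharacter ℂ m} {ρ : ℂ} (h : Lent χ ρ = 0) :
    Differentiable ℂ (dslope (Lent χ) ρ) ∧ ∀ s, Lent χ s = (s - ρ) * dslope (Lent χ) ρ s := by
  refine ⟨?_, fun z => ?_⟩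
  · rw [← differentiableOn_univ]
    exact (differentiableOn_dslope Filter.univ_mem).2 (Lent_differentiable χ).differentiableOn
  · have := sub_smul_dslope (Lent χ) ρ z
    simp only [h, sub_zero, smul_eq_mul] at this; exact this.symm

end

section
open Complex Metric Set Filter Topology MeasureTheory

lemma re_one_div (a b : ℝ) : (1 / (a + b * I)).re = a / (a ^ 2 + b ^ 2) := by
  rw [one_div, inv_re, normSq_apply]; simp [pow_two]

lemma zf_341 {Q : ℝ} (hQ : 1 ≤ Real.log Q ∧ 900 * (75000 * Real.log Q) ^ 2 ≤ Q ^ 2) {m : ℕ} [NeZero m]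
    {χ : DirichletCharacter ℂ m} {ρ : ℂ} {η : ℝ} (hη : η = 1 / (75000 * Real.log Q))
    (hm : m * (2 * |ρ.im| + 4) ^ 2 ≤ Q) (hρ : 1 - η / 10 ≤ ρ.re) (h0 : Lent χ ρ = 0) :
    χ ^ 2 = 1 ∧ |ρ.im| ≤ 5 * η := by
  classical
  have hη0 : 0 < η := by rw [hη]; have := hQ.1; positivity
  have hη1 : η ≤ 1 / 75000 := by
    rw [hη]; apply one_div_le_one_div_of_le (by norm_num); linarith [hQ.1]
  have hlog : Real.log Q = 1 / 75000 / η := by rw [hη]; have := hQ.1; field_simp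
  have hρ1 : ρ.re < 1 := by by_contra h; exact Lent_ne_zero χ (by linarith) h0
  have hm1 : (1 : ℝ) ≤ m := by exact_mod_cast Nat.pos_of_ne_zero (NeZero.ne m)
  have hmm : ∀ t : ℝ, |t| ≤ 2 * |ρ.im| → m * (|t| + 4) ^ 2 ≤ Q := fun t ht => le_trans (by gcongr) hm
  have p := pos_combo ![3, 4, 1] ![0, ρ.im, 2 * ρ.im] ![1, χ, χ ^ 2] hη0 (by
    intro n hn
    by_cases hu : IsUnit (n : ZMod m)
    · set z := χ n * (n : ℂ) ^ (-(ρ.im * I)) with hz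
      have hz1 : ‖z‖ = 1 := by
        rw [hz, norm_mul, norm_natCast_cpow_of_pos (Nat.pos_of_ne_zero hn)]
        have := DirichletCharacter.unit_norm_eq_one χ hu.unit
        rw [IsUnit.unit_spec] at this
        simp [this]
      have h2 : (χ ^ 2) n * (n : ℂ) ^ (-((2 * ρ.im : ℝ) * I)) = z ^ 2 := by
        rw [hz, mul_pow, MulChar.pow_apply' χ two_ne_zero, ← cpow_nat_mul]; congr 2; push_cast; ring
      simp only [Fin.sum_univ_three, Matrix.cons_val_zero, Matrix.cons_val_one, Matrix.cons_val, h2, ← hz]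
      have h3 : z.re ^ 2 + z.im ^ 2 = 1 := by
        have := Complex.sq_norm z; rw [hz1, normSq_apply] at this; nlinarith
      simp only [MulChar.one_apply hu, pow_two, mul_re]
      simp
      nlinarith [sq_nonneg (z.re + 1)]
    · simp [Fin.sum_univ_three, MulChar.map_nonunit _ hu])
  simp only [Fin.sum_univ_three, Matrix.cons_val_zero, Matrix.cons_val_one, Matrix.cons_val] at p
  have b1 := landau_L' hQ (1 : DirichletCharacter ℂ m) [] (Lent_differentiable _) (by simp) (fun _ => by rw [List.map_nil, List.prod_nil, one_mul])
    (t := 0) hη.ge (by linarith) (hmm 0 (by simp)) (by simp)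
  have b3 := landau_L' hQ (χ ^ 2) [] (Lent_differentiable _) (by simp) (fun _ => by rw [List.map_nil, List.prod_nil, one_mul])
    (t := 2 * ρ.im) hη.ge (by linarith) (hmm _ (by simp [abs_mul])) (by simp)
  have e : (1 + η + ρ.im * I - ρ : ℂ) = ((1 + η - ρ.re : ℝ) : ℂ) + (0 : ℝ) * I := by
    apply Complex.ext <;> simp
  have b2 := landau_L' hQ χ [ρ] (Lent_dslope h0).1 (by simp) (by simpa using (Lent_dslope h0).2)
    (t := ρ.im) hη.ge (by linarith) (hmm _ (by linarith [abs_nonneg ρ.im])) (by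
      simp only [List.mem_singleton, forall_eq]
      rw [norm_sub_rev, e]; simp only [ofReal_zero, zero_mul, add_zero, norm_real, Real.norm_eq_abs]
      rw [abs_of_nonneg] <;> linarith)
  simp only [List.map_cons, List.map_nil, List.sum_cons, List.sum_nil, e, re_one_div] at b1 b2 b3
  have e2 : 1 / (11 / 10) / η ≤ (1 + η - ρ.re) / ((1 + η - ρ.re) ^ 2 + 0 ^ 2) := by
    rw [div_div, div_le_div_iff₀ (by positivity) (by nlinarith)]; nlinarith
  have e1 : (if True then η / (η ^ 2 + 0 ^ 2) else 0) = 1 / η := by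
    rw [if_pos trivial]; field_simp; simp
  rw [e1] at b1
  have k1 : ∀ c : ℝ, c / η = c * (1 / η) := fun c => by ring
  have hpos : 0 < 1 / η := by positivity
  rw [hlog, k1 (1 / 75000)] at b1 b2 b3
  rw [k1] at e2
  by_cases hχ : χ ^ 2 = 1
  · refine ⟨hχ, ?_⟩
    by_contra! hg
    have g2 : 25 * η ^ 2 ≤ ρ.im ^ 2 := by
      rw [← sq_abs ρ.im]; nlinarith
    have h4 : (if χ = 1 then η / (η ^ 2 + ρ.im ^ 2) else 0) ≤ 1 / 26 * (1 / η) := by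
      split_ifs
      · rw [← k1, div_le_div_iff₀ (by positivity) hη0]; nlinarith
      · positivity
    have h5 : (if χ ^ 2 = 1 then η / (η ^ 2 + (2 * ρ.im) ^ 2) else 0) ≤ 1 / 101 * (1 / η) := by
      rw [if_pos hχ, ← k1, div_le_div_iff₀ (by positivity) hη0]; nlinarith
    linarith
  · rw [if_neg hχ] at b3
    rw [if_neg (by rintro rfl; simp at hχ)] at b2
    linarith

lemma triv_zf : ∃ δ > 0, ∀ (m : ℕ) [NeZero m] (ρ : ℂ), ‖ρ - 1‖ ≤ δ → Lent (1 : DirichletCharacter ℂ m) ρ ≠ 0 := by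
  have h1 : ∀ᶠ s in 𝓝 (1 : ℂ), Lent (1 : DirichletCharacter ℂ 1) s ≠ 0 :=
    (Lent_differentiable _).continuous.continuousAt.eventually_ne (Lent_ne_zero _ (by simp))
  obtain ⟨δ, hδ, h⟩ := Metric.eventually_nhds_iff.1 h1
  refine ⟨min (δ / 2) (1 / 2), by positivity, fun m _ ρ hρ => ?_⟩
  by_cases hρ1 : ρ = 1
  · rw [hρ1]; exact Lent_ne_zero _ (by simp)
  have h2 := h (y := ρ) (by rw [dist_eq_norm]; linarith [min_le_left (δ / 2) (1 / 2)])
  have hre : 0 < ρ.re := by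
    have := (abs_re_le_norm (ρ - 1)).trans hρ
    have := (abs_le.1 this).1; simp at this; linarith [min_le_right (δ / 2) (1 / 2), this]
  rw [Lent_eq _ hρ1] at h2 ⊢
  simp only [if_true, ne_eq, mul_eq_zero, not_or] at h2 ⊢
  refine ⟨h2.1, ?_⟩
  rw [DirichletCharacter.LFunction_modOne_eq] at h2
  have h3 := DirichletCharacter.LFunctionTrivChar_eq_mul_riemannZeta (N := m) hρ1
  rw [DirichletCharacter.LFunctionTrivChar] at h3
  rw [h3]
  refine mul_ne_zero (Finset.prod_ne_zero_iff.2 fun p hp => ?_) h2.2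
  have hp2 := (Nat.prime_of_mem_primeFactors hp)
  intro h0
  have h4 : ‖(p : ℂ) ^ (-ρ)‖ = 1 := by rw [← sub_eq_zero.1 h0]; simp
  rw [norm_natCast_cpow_of_pos hp2.pos] at h4
  have := Real.rpow_lt_one_of_one_lt_of_neg (x := p) (by exact_mod_cast hp2.one_lt) (z := (-ρ).re) (by simpa)
  linarith

lemma re_bound {η : ℝ} {ρ : ℂ} (hη : 0 < η) (h1 : 1 - η / 10 ≤ ρ.re) (h2 : ρ.re < 1) (h3 : |ρ.im| ≤ 5 * η) :
    466 / 10000 * (1 / η) ≤ (1 / (1 + (20 * η : ℝ) + (0 : ℝ) * I - ρ)).re := by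
  have e : (1 + (20 * η : ℝ) + (0 : ℝ) * I - ρ : ℂ) = ((1 + 20 * η - ρ.re : ℝ) : ℂ) + ((-ρ.im : ℝ) : ℂ) * I := by
    apply Complex.ext <;> simp
  rw [e, re_one_div]
  have : ρ.im ^ 2 ≤ 25 * η ^ 2 := by rw [← sq_abs]; nlinarith [abs_nonneg ρ.im]
  rw [← mul_div_assoc, div_le_div_iff₀ hη (by nlinarith)]
  have : (1 + 20 * η - ρ.re) ^ 2 ≤ (201 / 10 * η) ^ 2 := by
    apply pow_le_pow_left₀ <;> linarith
  nlinarith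

lemma near_bound {η : ℝ} {ρ : ℂ} (hη : 0 < η) (hη1 : η ≤ 1 / 75000) (h1 : 1 - η / 10 ≤ ρ.re) (h2 : ρ.re < 1)
    (h3 : |ρ.im| ≤ 5 * η) : ‖ρ - (1 + (20 * η : ℝ) + (0 : ℝ) * I)‖ ≤ 1 / 4 := by
  refine (norm_le_abs_re_add_abs_im _).trans ?_
  simp
  rw [abs_of_nonpos (by linarith)]; linarith

lemma two_zeros {Q : ℝ} (hQ : 1 ≤ Real.log Q ∧ 900 * (75000 * Real.log Q) ^ 2 ≤ Q ^ 2) {m : ℕ} [NeZero m]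
    {χ : DirichletCharacter ℂ m} {ρ ρ' : ℂ} {η : ℝ} (hη : η = 1 / (75000 * Real.log Q))
    (hm : m * 4 ^ 2 ≤ Q) (hρ : 1 - η / 10 ≤ ρ.re) (hρ1 : ρ.re < 1) (hγ : |ρ.im| ≤ 5 * η)
    (hρ' : 1 - η / 10 ≤ ρ'.re) (hρ1' : ρ'.re < 1) (hγ' : |ρ'.im| ≤ 5 * η) (hχ : χ ^ 2 = 1) (hχ1 : χ ≠ 1)
    (h0 : Lent χ ρ = 0) : dslope (Lent χ) ρ ρ' ≠ 0 := by
  classical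
  intro h0'
  have hη0 : 0 < η := by rw [hη]; have := hQ.1; positivity
  have hη1 : η ≤ 1 / 75000 := by
    rw [hη]; apply one_div_le_one_div_of_le (by norm_num); linarith [hQ.1]
  have hlog : Real.log Q = 1 / 75000 / η := by rw [hη]; have := hQ.1; field_simp
  have p := pos_combo ![1, 1] ![0, 0] ![1, χ] (η := 20 * η) (by positivity) (by
    intro n hn
    by_cases hu : IsUnit (n : ZMod m)
    · rcases real_val hχ _ hu with h | h <;> simp [Fin.sum_univ_two, MulChar.one_apply hu, h]
    · simp [Fin.sum_univ_two, MulChar.map_nonunit _ hu])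
  simp only [Fin.sum_univ_two, Matrix.cons_val_zero, Matrix.cons_val_one] at p
  have b1 := landau_L' hQ (1 : DirichletCharacter ℂ m) [] (Lent_differentiable _) (by simp) (fun _ => by rw [List.map_nil, List.prod_nil, one_mul])
    (t := 0) (η := 20 * η) (by linarith) (by linarith) (by simpa) (by simp)
  have hd : Differentiable ℂ (dslope (dslope (Lent χ) ρ) ρ') := by
    rw [← differentiableOn_univ]
    exact (differentiableOn_dslope Filter.univ_mem).2 (Lent_dslope h0).1.differentiableOn
  have b2 := landau_L' hQ χ [ρ, ρ'] hd (by simp) (fun s => by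
      have := sub_smul_dslope (dslope (Lent χ) ρ) ρ' s
      simp only [h0', sub_zero, smul_eq_mul] at this
      rw [(Lent_dslope h0).2 s, ← this]; simp [mul_assoc])
    (t := 0) (η := 20 * η) (by linarith) (by linarith) (by simpa) (by
      intro x hx
      simp only [List.mem_cons, List.not_mem_nil, or_false] at hx
      rcases hx with rfl | rfl <;> exact near_bound hη0 hη1 (by assumption) (by assumption) (by assumption))
  have c1 := re_bound hη0 hρ hρ1 hγ
  have c2 := re_bound hη0 hρ' hρ1' hγ'
  simp only [List.map_cons, List.map_nil, List.sum_cons, List.sum_nil] at b1 b2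
  rw [if_neg hχ1] at b2
  have e1 : (if True then 20 * η / ((20 * η) ^ 2 + 0 ^ 2) else 0) = 1 / 20 * (1 / η) := by
    rw [if_pos trivial]; field_simp; norm_num
  rw [e1] at b1
  have k1 : ∀ c : ℝ, c / η = c * (1 / η) := fun c => by ring
  have hpos : 0 < 1 / η := by positivity
  rw [hlog, k1 (1 / 75000)] at b1 b2
  linarith

lemma two_chars {Q : ℝ} (hQ : 1 ≤ Real.log Q ∧ 900 * (75000 * Real.log Q) ^ 2 ≤ Q ^ 2) {m : ℕ} [NeZero m]
    {χ χ' : DirichletCharacter ℂ m} {ρ ρ' : ℂ} {η : ℝ} (hη : η = 1 / (75000 * Real.log Q))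
    (hm : m * 4 ^ 2 ≤ Q) (hρ : 1 - η / 10 ≤ ρ.re) (hρ1 : ρ.re < 1) (hγ : |ρ.im| ≤ 5 * η)
    (hρ' : 1 - η / 10 ≤ ρ'.re) (hρ1' : ρ'.re < 1) (hγ' : |ρ'.im| ≤ 5 * η) (hχ : χ ^ 2 = 1) (hχ1 : χ ≠ 1)
    (hχ' : χ' ^ 2 = 1) (hχ1' : χ' ≠ 1)
    (h0 : Lent χ ρ = 0) (h0' : Lent χ' ρ' = 0) : χ = χ' := by
  classical
  by_contra hne
  have hχχ : χ * χ' ≠ 1 := fun h => hne (by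
    rw [pow_two] at hχ'; exact mul_right_cancel (h.trans hχ'.symm))
  have hη0 : 0 < η := by rw [hη]; have := hQ.1; positivity
  have hη1 : η ≤ 1 / 75000 := by
    rw [hη]; apply one_div_le_one_div_of_le (by norm_num); linarith [hQ.1]
  have hlog : Real.log Q = 1 / 75000 / η := by rw [hη]; have := hQ.1; field_simp
  have p := pos_combo ![1, 1, 1, 1] ![0, 0, 0, 0] ![1, χ, χ', χ * χ'] (η := 20 * η) (by positivity) (by
    intro n hn
    by_cases hu : IsUnit (n : ZMod m)
    · rcases real_val hχ _ hu with h | h <;> rcases real_val hχ' _ hu with h' | h' <;>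
        (simp [Fin.sum_univ_four, MulChar.one_apply hu, h, h']; try norm_num)
    · simp [Fin.sum_univ_four, MulChar.map_nonunit _ hu])
  simp only [Fin.sum_univ_four, Matrix.cons_val_zero, Matrix.cons_val_one, Matrix.cons_val] at p
  have b1 := landau_L' hQ (1 : DirichletCharacter ℂ m) [] (Lent_differentiable _) (by simp) (fun _ => by rw [List.map_nil, List.prod_nil, one_mul])
    (t := 0) (η := 20 * η) (by linarith) (by linarith) (by simpa) (by simp)
  have b4 := landau_L' hQ (χ * χ') [] (Lent_differentiable _) (by simp) (fun _ => by rw [List.map_nil, List.prod_nil, one_mul])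
    (t := 0) (η := 20 * η) (by linarith) (by linarith) (by simpa) (by simp)
  have b2 := landau_L' hQ χ [ρ] (Lent_dslope h0).1 (by simp) (by simpa using (Lent_dslope h0).2)
    (t := 0) (η := 20 * η) (by linarith) (by linarith) (by simpa)
    (by simpa using near_bound hη0 hη1 hρ hρ1 hγ)
  have b3 := landau_L' hQ χ' [ρ'] (Lent_dslope h0').1 (by simp) (by simpa using (Lent_dslope h0').2)
    (t := 0) (η := 20 * η) (by linarith) (by linarith) (by simpa)
    (by simpa using near_bound hη0 hη1 hρ' hρ1' hγ')
  have c1 := re_bound hη0 hρ hρ1 hγ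
  have c2 := re_bound hη0 hρ' hρ1' hγ'
  simp only [List.map_cons, List.map_nil, List.sum_cons, List.sum_nil] at b1 b2 b3 b4
  rw [if_neg hχ1] at b2
  rw [if_neg hχ1'] at b3
  rw [if_neg hχχ] at b4
  have e1 : (if True then 20 * η / ((20 * η) ^ 2 + 0 ^ 2) else 0) = 1 / 20 * (1 / η) := by
    rw [if_pos trivial]; field_simp; norm_num
  rw [e1] at b1
  have k1 : ∀ c : ℝ, c / η = c * (1 / η) := fun c => by ring
  have hpos : 0 < 1 / η := by positivity
  rw [hlog, k1 (1 / 75000)] at b1 b2 b3 b4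
  linarith

/-- zero-free region with at most one exceptional zero per modulus -/
theorem zero_free : ∃ b > 0, ∃ Q0 : ℝ, ∀ Q ≥ Q0, ∀ (m : ℕ) [NeZero m] (χ : DirichletCharacter ℂ m) (ρ : ℂ),
    m * (2 * |ρ.im| + 4) ^ 2 ≤ Q → 1 - b / Real.log Q ≤ ρ.re → Lent χ ρ = 0 →
    χ ^ 2 = 1 ∧ χ ≠ 1 ∧ ρ.im = 0 ∧ dslope (Lent χ) ρ ρ ≠ 0 ∧ ∀ (χ' : DirichletCharacter ℂ m) (ρ' : ℂ),
    m * (2 * |ρ'.im| + 4) ^ 2 ≤ Q → 1 - b / Real.log Q ≤ ρ'.re → Lent χ' ρ' = 0 → χ' = χ ∧ ρ' = ρ := by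
  obtain ⟨δ, hδ, hδ2⟩ := triv_zf
  have hev : ∀ᶠ Q : ℝ in atTop, 1 / δ ≤ Real.log Q := Real.tendsto_log_atTop.eventually_ge_atTop _
  obtain ⟨Q0, hQ0⟩ := eventually_atTop.1 (param_large.and hev)
  refine ⟨1 / 750000, by norm_num, Q0, fun Q hQQ m _ => ?_⟩
  obtain ⟨hQ, hQd⟩ := hQ0 Q hQQ
  obtain ⟨η, hη⟩ : ∃ η, η = 1 / (75000 * Real.log Q) := ⟨_, rfl⟩
  have hη0 : 0 < η := by rw [hη]; have := hQ.1; positivity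
  have hb : 1 / 750000 / Real.log Q = η / 10 := by rw [hη]; have := hQ.1; field_simp; norm_num
  have hηδ : 75000 * η ≤ δ := by
    rw [hη]; have := hQ.1; rw [div_le_iff₀ hδ] at hQd
    rw [← div_eq_mul_one_div, div_le_iff₀ (by positivity)]; nlinarith
  have key : ∀ (χ : DirichletCharacter ℂ m) (ρ : ℂ), m * (2 * |ρ.im| + 4) ^ 2 ≤ Q →
      1 - 1 / 750000 / Real.log Q ≤ ρ.re → Lent χ ρ = 0 →
      χ ^ 2 = 1 ∧ |ρ.im| ≤ 5 * η ∧ χ ≠ 1 ∧ ρ.re < 1 ∧ m * 4 ^ 2 ≤ Q := by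
    intro χ ρ hm hρ h0
    rw [hb] at hρ
    obtain ⟨h1, h2⟩ := zf_341 hQ hη hm hρ h0
    have hlt : ρ.re < 1 := by by_contra h; exact Lent_ne_zero χ (by linarith) h0
    refine ⟨h1, h2, ?_, hlt, le_trans (by gcongr; linarith [abs_nonneg ρ.im]) hm⟩
    rintro rfl
    refine hδ2 m ρ ((norm_le_abs_re_add_abs_im _).trans ?_) h0
    simp; rw [abs_of_nonpos (by linarith)]; linarith
  intro χ ρ hm hρ h0
  obtain ⟨h1, h2, h3, h4, h5⟩ := key χ ρ hm hρ h0
  have uniq : ∀ (ρ' : ℂ), m * (2 * |ρ'.im| + 4) ^ 2 ≤ Q → 1 - 1 / 750000 / Real.log Q ≤ ρ'.re →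
      Lent χ ρ' = 0 → ρ' = ρ := by
    intro ρ' hm' hρ' h0'
    obtain ⟨h1', h2', h3', h4', h5'⟩ := key χ ρ' hm' hρ' h0'
    by_contra hne
    refine two_zeros hQ hη h5 (hb ▸ hρ) h4 h2 (hb ▸ hρ') h4' h2' h1 h3 h0 ?_
    have := (Lent_dslope h0).2 ρ'
    rw [h0'] at this
    exact (mul_eq_zero.1 this.symm).resolve_left (sub_ne_zero.2 hne)
  refine ⟨h1, h3, ?_, two_zeros hQ hη h5 (hb ▸ hρ) h4 h2 (hb ▸ hρ) h4 h2 h1 h3 h0, fun χ' ρ' hm' hρ' h0' => ?_⟩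
  · have := uniq (starRingEnd ℂ ρ) (by simpa using hm) (by simpa using hρ) (by rw [Lent_conj h1, h0, map_zero])
    exact conj_eq_iff_im.1 this
  · obtain ⟨h1', h2', h3', h4', h5'⟩ := key χ' ρ' hm' hρ' h0'
    have := two_chars hQ hη h5 (hb ▸ hρ') h4' h2' (hb ▸ hρ) h4 h2 h1' h3' h1 h3 h0' h0
    subst this
    exact ⟨rfl, uniq ρ' hm' hρ' h0'⟩

end

section
open Complex Metric Set Filter Topology MeasureTheory

noncomputable def pk (σ y : ℝ) : ℂ := 1 / ((σ + y * I) * (σ + y * I + 1))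

lemma pk_norm {σ : ℝ} (hσ : 1 / 2 ≤ σ) (y : ℝ) : ‖pk σ y‖ ≤ 4 * (1 + y ^ 2)⁻¹ := by
  have h1 : ∀ τ : ℝ, 1 / 2 ≤ τ → 1 / 2 * Real.sqrt (1 + y ^ 2) ≤ ‖(τ + y * I : ℂ)‖ := by
    intro τ h
    rw [← Real.sqrt_sq (norm_nonneg _), Complex.sq_norm, normSq_apply]
    rw [show (1 / 2 : ℝ) = Real.sqrt (1 / 4) by rw [show (1 / 4 : ℝ) = (1 / 2) ^ 2 by norm_num, Real.sqrt_sq (by norm_num)],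
      ← Real.sqrt_mul (by norm_num)]
    apply Real.sqrt_le_sqrt; simp; nlinarith
  have h2 := h1 (σ + 1) (by linarith)
  have h3 := h1 σ hσ
  have h4 := Real.sqrt_pos.2 (show (0 : ℝ) < 1 + y ^ 2 by positivity)
  have h5 := Real.mul_self_sqrt (show (0 : ℝ) ≤ 1 + y ^ 2 by positivity)
  have h6 : 0 < ‖(σ + y * I : ℂ)‖ := lt_of_lt_of_le (by positivity) h3
  have h7 : 0 < ‖((σ + 1 : ℝ) + y * I : ℂ)‖ := lt_of_lt_of_le (by positivity) h2
  rw [pk, norm_div, norm_one, norm_mul, show (σ + y * I + 1 : ℂ) = ((σ + 1 : ℝ) : ℂ) + y * I by push_cast; ring,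
    ← one_div, mul_one_div, div_le_div_iff₀ (by positivity) (by positivity)]
  nlinarith [mul_le_mul h3 h2 (by positivity) (by positivity)]

lemma pk_integrable {σ : ℝ} (hσ : 1 / 2 ≤ σ) : Integrable (pk σ) := by
  refine (integrable_inv_one_add_sq.const_mul 4).mono' ?_ (ae_of_all _ (pk_norm hσ))
  apply Measurable.aestronglyMeasurable
  unfold pk; fun_prop

lemma perron_kernel {σ : ℝ} (hσ : 1 / 2 ≤ σ) {t : ℝ} (ht : 0 < t) :
    (1 / (2 * Real.pi)) • ∫ y : ℝ, (t : ℂ) ^ (-(σ + y * I)) • pk σ y = ((max (1 - t) 0 : ℝ) : ℂ) := by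
  set f : ℝ → ℂ := fun t => ((max (1 - t) 0 : ℝ) : ℂ) with hf
  have hm : ∀ s : ℂ, 0 < s.re → HasMellin f s (1 / (s * (s + 1))) := by
    intro s hs
    have h1 := hasMellin_one_Ioc hs
    have h2 := hasMellin_cpow_Ioc 1 (s := s) (by simp; linarith)
    have h3 := hasMellin_sub h1.1 h2.1
    rw [h1.2, h2.2] at h3
    have e : ∀ t ∈ Ioi (0 : ℝ), indicator (Ioc 0 1) (fun _ => 1 : ℝ → ℂ) t
        - indicator (Ioc 0 1) (fun t => ↑t ^ (1 : ℂ) : ℝ → ℂ) t = f t := by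
      intro t ht
      by_cases h : t ∈ Ioc (0 : ℝ) 1
      · rw [indicator_of_mem h, indicator_of_mem h, hf]; simp [h.2]
      · rw [indicator_of_notMem h, indicator_of_notMem h, hf]
        have : 1 ≤ t := by by_contra h'; exact h ⟨ht, by linarith⟩
        simp [this]
    have hs0 : s ≠ 0 := by rintro rfl; simp at hs
    have hs1 : s + 1 ≠ 0 := by
      intro h; have := congrArg re h; simp at this; linarith
    refine ⟨?_, ?_⟩
    · refine (integrableOn_congr_fun (fun t ht => ?_) measurableSet_Ioi).1 h3.1
      simp only [e t ht]
    · rw [← show 1 / s - 1 / (s + 1) = 1 / (s * (s + 1)) by field_simp; ring, ← h3.2, mellin, mellin]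
      refine setIntegral_congr_fun measurableSet_Ioi fun t ht => ?_
      simp only [e t ht]
  have hre : ∀ y : ℝ, (σ + y * I : ℂ).re = σ := fun y => by simp
  have h1 := mellinInv_mellin_eq σ f ht (hm σ (by simp; linarith)).1 (by
    refine (pk_integrable hσ).congr (ae_of_all _ fun y => ?_)
    simp only; rw [(hm _ (by rw [hre]; linarith)).2, pk]) (by rw [hf]; fun_prop)
  rw [← show f t = ((max (1 - t) 0 : ℝ) : ℂ) from rfl, ← h1, mellinInv]
  congr 1
  refine integral_congr_ae (ae_of_all _ fun y => ?_)
  simp only; rw [(hm _ (by rw [hre]; linarith)).2, pk]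

lemma perron_sum {a : ℕ → ℂ} {σ x : ℝ} (hσ : 1 / 2 ≤ σ) (hx : 0 < x) (ha : LSeriesSummable a σ) {X : ℕ} (hX : x ≤ X) :
    ∑ n ∈ Finset.Icc 1 X, a n * ((max (1 - n / x) 0 : ℝ) : ℂ)
      = (1 / (2 * Real.pi)) • ∫ y : ℝ, LSeries a (σ + y * I) * ((x : ℂ) ^ (σ + y * I : ℂ) * pk σ y) := by
  have hx' : (x : ℂ) ≠ 0 := by exact_mod_cast hx.ne'
  have hsum : ∀ y : ℝ, LSeriesSummable a (σ + y * I) := fun y =>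
    (LSeriesSummable_iff_of_re_eq_re (by simp)).2 ha
  have hn : ∀ n (y : ℝ), ‖LSeries.term a (σ + y * I) n * ((x : ℂ) ^ (σ + y * I : ℂ) * pk σ y)‖
      = ‖LSeries.term a σ n‖ * x ^ σ * ‖pk σ y‖ := by
    intro n y
    rw [norm_mul, norm_mul, norm_cpow_eq_rpow_re_of_pos hx, LSeries.norm_term_eq, LSeries.norm_term_eq]
    simp [mul_assoc]
  have key := hasSum_integral_of_summable_integral_norm (μ := volume)
    (F := fun n (y : ℝ) => LSeries.term a (σ + y * I) n * ((x : ℂ) ^ (σ + y * I : ℂ) * pk σ y)) ?_ ?_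
  · have e1 : (∫ y : ℝ, ∑' n, LSeries.term a (σ + y * I) n * ((x : ℂ) ^ (σ + y * I : ℂ) * pk σ y))
        = ∫ y : ℝ, LSeries a (σ + y * I) * ((x : ℂ) ^ (σ + y * I : ℂ) * pk σ y) := by
      congr 1; ext y; rw [tsum_mul_right]; rfl
    rw [e1] at key
    have key2 := (key.const_smul (1 / (2 * Real.pi)))
    rw [← key2.tsum_eq]
    have e2 : ∀ n, (1 / (2 * Real.pi)) • ∫ y : ℝ, LSeries.term a (σ + y * I) n * ((x : ℂ) ^ (σ + y * I : ℂ) * pk σ y)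
        = if n = 0 then 0 else a n * ((max (1 - n / x) 0 : ℝ) : ℂ) := by
      intro n
      rcases eq_or_ne n 0 with rfl | h0
      · simp
      rw [if_neg h0, ← perron_kernel hσ (t := n / x) (by positivity), mul_smul_comm, ← integral_const_mul]
      congr 2; ext y
      rw [LSeries.term_of_ne_zero h0, smul_eq_mul, ofReal_div, div_cpow_ofReal_nonneg (by positivity) hx.le,
        cpow_neg, cpow_neg, ofReal_natCast]
      field_simp
    rw [tsum_congr e2, tsum_eq_sum (s := Finset.Icc 1 X)]
    · refine Finset.sum_congr rfl fun n hn => ?_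
      rw [if_neg]; have := (Finset.mem_Icc.1 hn).1; omega
    · intro n hn
      split_ifs with h0
      · rfl
      have : X < n := by by_contra h; exact hn (Finset.mem_Icc.2 ⟨by omega, by omega⟩)
      have h2 : x < n := hX.trans_lt (by exact_mod_cast this)
      rw [max_eq_right]; · simp
      rw [sub_nonpos, le_div_iff₀ hx]; linarith
  · intro n
    refine ((pk_integrable hσ).norm.const_mul (‖LSeries.term a σ n‖ * x ^ σ)).mono' ?_
      (ae_of_all _ fun y => (hn n y).le)
    refine AEStronglyMeasurable.mul (Continuous.aestronglyMeasurable ?_)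
      (AEStronglyMeasurable.mul (Continuous.aestronglyMeasurable ?_) (pk_integrable hσ).1)
    · rcases eq_or_ne n 0 with rfl | h0
      · simp only [LSeries.term_zero]; fun_prop
      · simp only [LSeries.term_of_ne_zero h0]
        have : ((n : ℕ) : ℂ) ≠ 0 := by exact_mod_cast h0
        refine continuous_const.div ?_ fun y => by simp [cpow_eq_zero_iff, this]
        exact Continuous.const_cpow (by fun_prop) (Or.inl this)
    · exact Continuous.const_cpow (by fun_prop) (Or.inl hx')
  · simp_rw [hn, integral_const_mul]
    exact (ha.norm.mul_right _).mul_right _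

end

section
open Complex Metric Set Filter Topology MeasureTheory

lemma tail_int {T : ℝ} (hT : 0 < T) : ∫ y in (Ioc (-T) T)ᶜ, (1 + y ^ 2)⁻¹ ≤ 2 / T := by
  have h := integral_add_compl (μ := volume) (f := fun y : ℝ => (1 + y ^ 2)⁻¹) (s := Ioc (-T) T) measurableSet_Ioc
    integrable_inv_one_add_sq
  rw [integral_univ_inv_one_add_sq, ← intervalIntegral.integral_of_le (by linarith), integral_inv_one_add_sq,
    Real.arctan_neg] at h
  have h2 := Real.arctan_inv_of_pos hT
  have h3 : Real.arctan T⁻¹ ≤ T⁻¹ := by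
    have := Real.le_tan (Real.arctan_nonneg.2 (inv_nonneg.2 hT.le)) (Real.arctan_lt_pi_div_two _)
    rwa [Real.tan_arctan] at this
  rw [div_eq_mul_inv]; linarith

lemma perron_bound {a : ℕ → ℂ} {G : ℂ → ℂ} {σ₀ σ x T A M : ℝ} (h0 : 1 / 2 ≤ σ₀) (h1 : σ₀ ≤ σ) (h2 : σ ≤ 2)
    (hT : 1 ≤ T) (hx : 1 ≤ x) (ha : LSeriesSummable a σ) {X : ℕ} (hX : x ≤ X)
    (hA : ∀ y : ℝ, ‖LSeries a (σ + y * I)‖ ≤ A)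
    (hG : DifferentiableOn ℂ G ((uIcc σ₀ σ) ×ℂ (uIcc (-T) T)))
    (hGa : ∀ y : ℝ, |y| ≤ T → LSeries a (σ + y * I) = G (σ + y * I))
    (hM : ∀ s ∈ (uIcc σ₀ σ) ×ℂ (uIcc (-T) T), ‖G s‖ ≤ M) :
    ‖∑ n ∈ Finset.Icc 1 X, a n * ((max (1 - n / x) 0 : ℝ) : ℂ)‖
      ≤ 2 * A * x ^ σ / T + 4 * M * x ^ σ / T ^ 2 + 4 * T * M * x ^ σ₀ := by
  have hx0 : 0 < x := by linarith
  have hσ : 1 / 2 ≤ σ := by linarith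
  have hx' : (x : ℂ) ≠ 0 := by exact_mod_cast hx0.ne'
  have hM0 : 0 ≤ M := (norm_nonneg _).trans (hM (σ : ℂ) ⟨by simp, by
    simp [mem_uIcc]; left; linarith⟩)
  have hA0 : 0 ≤ A := (norm_nonneg _).trans (hA 0)
  rw [perron_sum hσ hx0 ha hX]
  set f : ℂ → ℂ := fun s => G s * ((x : ℂ) ^ s * (1 / (s * (s + 1)))) with hf
  set F : ℝ → ℂ := fun y => LSeries a (σ + y * I) * ((x : ℂ) ^ (σ + y * I : ℂ) * pk σ y) with hF
  have hFn : ∀ y, ‖F y‖ ≤ A * x ^ σ * 4 * (1 + y ^ 2)⁻¹ := by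
    intro y
    rw [hF]; simp only
    rw [norm_mul, norm_mul, norm_cpow_eq_rpow_re_of_pos hx0]
    simp only [add_re, ofReal_re, mul_re, I_re, mul_zero, ofReal_im, I_im, mul_one, sub_self, add_zero]
    calc _ ≤ A * (x ^ σ * (4 * (1 + y ^ 2)⁻¹)) := by gcongr; exact hA y; exact pk_norm hσ y
      _ = _ := by ring
  have hcont : Continuous fun y : ℝ => LSeries a (σ + y * I) := by
    have : (fun y : ℝ => LSeries a (σ + y * I)) = fun y : ℝ => ∑' n, LSeries.term a (σ + y * I) n := rfl
    rw [this]
    refine continuous_tsum (u := fun n => ‖LSeries.term a σ n‖) (fun n => ?_) ha.norm fun n y => ?_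
    · rcases eq_or_ne n 0 with rfl | h0
      · simp only [LSeries.term_zero]; fun_prop
      · simp only [LSeries.term_of_ne_zero h0]
        have : ((n : ℕ) : ℂ) ≠ 0 := by exact_mod_cast h0
        refine continuous_const.div ?_ fun y => by simp [cpow_eq_zero_iff, this]
        exact Continuous.const_cpow (by fun_prop) (Or.inl this)
    · rw [LSeries.norm_term_eq, LSeries.norm_term_eq]; simp
  have hFi : Integrable F := by
    refine (integrable_inv_one_add_sq.const_mul (A * x ^ σ * 4)).mono' ?_ (ae_of_all _ hFn)
    exact hcont.aestronglyMeasurable.mul ((Continuous.const_cpow (by fun_prop) (Or.inl hx')).aestronglyMeasurable.mul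
      (pk_integrable hσ).1)
  have hsplit := integral_add_compl (μ := volume) (f := F) (s := Ioc (-T) T) measurableSet_Ioc hFi
  have htail : ‖∫ y in (Ioc (-T) T)ᶜ, F y‖ ≤ A * x ^ σ * 4 * (2 / T) := by
    refine (norm_integral_le_of_norm_le ((integrable_inv_one_add_sq.const_mul (A * x ^ σ * 4)).integrableOn)
      (ae_of_all _ hFn)).trans ?_
    rw [integral_const_mul]
    gcongr; exact tail_int (by linarith)
  rw [← intervalIntegral.integral_of_le (by linarith)] at hsplit
  have hmid : ∫ y in (-T)..T, F y = ∫ y in (-T)..T, f (σ + y * I) := by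
    refine intervalIntegral.integral_congr fun y hy => ?_
    rw [uIcc_of_le (by linarith)] at hy
    simp only [hF, hf, pk]
    rw [hGa y (abs_le.2 hy)]
  have hfd : DifferentiableOn ℂ f ((uIcc σ₀ σ) ×ℂ (uIcc (-T) T)) := by
    refine hG.mul (DifferentiableOn.mul (fun s _ => ?_) fun s hs => ?_)
    · exact (DifferentiableAt.const_cpow differentiableAt_id (Or.inl hx')).differentiableWithinAt
    · have : σ₀ ≤ s.re := by have := hs.1; rw [mem_preimage, uIcc_of_le h1] at this; exact this.1
      have e1 : s ≠ 0 := by rintro rfl; simp at this; linarith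
      have e2 : s + 1 ≠ 0 := by intro h; have h' := congrArg re h; simp at h'; linarith
      exact (by fun_prop (disch := simp [e1, e2]) : DifferentiableAt ℂ (fun s : ℂ => 1 / (s * (s + 1))) s).differentiableWithinAt
  have hrect := integral_boundary_rect_eq_zero_of_differentiableOn f (σ₀ + (-T : ℝ) * I) (σ + T * I) (by simpa using hfd)
  simp only [add_re, ofReal_re, mul_re, I_re, mul_zero, ofReal_im, I_im, mul_one, sub_self, add_zero, add_im,
    mul_im, zero_add] at hrect
  have hfn : ∀ τ y : ℝ, τ ∈ Icc σ₀ σ → |y| ≤ T → ‖f (τ + y * I)‖ ≤ M * (x ^ τ * (4 * (1 + y ^ 2)⁻¹)) := by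
    intro τ y hτ hy
    rw [hf]; simp only
    rw [norm_mul, norm_mul, norm_cpow_eq_rpow_re_of_pos hx0]
    simp only [add_re, ofReal_re, mul_re, I_re, mul_zero, ofReal_im, I_im, mul_one, sub_self, add_zero]
    gcongr
    · refine hM _ ⟨by simpa [uIcc_of_le h1] using hτ, ?_⟩
      rw [mem_preimage, uIcc_of_le (by linarith)]; simpa using abs_le.1 hy
    · exact pk_norm (by linarith [hτ.1]) y
  have hhor : ∀ y : ℝ, |y| = T → ‖∫ u in σ₀..σ, f (u + y * I)‖ ≤ M * (x ^ σ * (4 / T ^ 2)) * (σ - σ₀) := by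
    intro y hy
    refine (intervalIntegral.norm_integral_le_of_norm_le_const (C := M * (x ^ σ * (4 / T ^ 2))) fun u hu => ?_).trans_eq
      (by rw [abs_of_nonneg (by linarith)])
    rw [uIoc_of_le h1] at hu
    refine (hfn u y ⟨hu.1.le, hu.2⟩ hy.le).trans ?_
    have : (1 + y ^ 2)⁻¹ ≤ 1 / T ^ 2 := by
      rw [← one_div, ← sq_abs, hy]; apply one_div_le_one_div_of_le (by positivity); linarith
    calc M * (x ^ u * (4 * (1 + y ^ 2)⁻¹)) ≤ M * (x ^ σ * (4 * (1 / T ^ 2))) := by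
          gcongr; exact hu.2
      _ = _ := by ring
  have hvert : ‖∫ y in (-T)..T, f (σ₀ + y * I)‖ ≤ M * (x ^ σ₀ * 4) * (2 * T) := by
    refine (intervalIntegral.norm_integral_le_of_norm_le_const (C := M * (x ^ σ₀ * 4)) fun y hy => ?_).trans_eq
      (by rw [abs_of_nonneg (by linarith)]; ring)
    rw [uIoc_of_le (by linarith)] at hy
    refine (hfn σ₀ y ⟨le_rfl, h1⟩ (abs_le.2 ⟨hy.1.le, hy.2⟩)).trans ?_
    gcongr
    have : (1 + y ^ 2)⁻¹ ≤ 1 := inv_le_one_of_one_le₀ (by nlinarith [sq_nonneg y])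
    linarith
  have hb := hhor (-T) (by rw [abs_neg, abs_of_nonneg]; linarith)
  have ht := hhor T (abs_of_nonneg (by linarith))
  have hmain : ‖∫ y in (-T)..T, f (σ + y * I)‖ ≤ M * (x ^ σ₀ * 4) * (2 * T) + 2 * (M * (x ^ σ * (4 / T ^ 2)) * (σ - σ₀)) := by
    have e : I • ∫ y in (-T)..T, f (σ + y * I) = I • (∫ y in (-T)..T, f (σ₀ + y * I))
        - (∫ u in σ₀..σ, f (u + (-T : ℝ) * I)) + ∫ u in σ₀..σ, f (u + T * I) := by
      linear_combination hrect
    have e2 := congrArg norm e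
    rw [norm_smul, norm_I, one_mul] at e2
    rw [e2]
    refine (norm_add_le _ _).trans ?_
    refine (add_le_add_left (norm_sub_le _ _) _).trans ?_
    rw [norm_smul, norm_I, one_mul]; linarith
  have hpi : 1 / (2 * Real.pi) ≤ 1 / 6 := one_div_le_one_div_of_le (by norm_num) (by linarith [Real.pi_gt_three])
  rw [← hsplit, hmid, norm_smul, Real.norm_of_nonneg (by positivity)]
  have h9 : M * (x ^ σ * (4 / T ^ 2)) * (σ - σ₀) ≤ M * (x ^ σ * (4 / T ^ 2)) * (3 / 2) := by gcongr; linarith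
  calc _ ≤ 1 / 6 * (M * (x ^ σ₀ * 4) * (2 * T) + 2 * (M * (x ^ σ * (4 / T ^ 2)) * (3 / 2)) + A * x ^ σ * 4 * (2 / T)) := by
        gcongr; refine (norm_add_le _ _).trans ?_; linarith
    _ = 4 / 3 * (A * x ^ σ / T) + 2 * (M * x ^ σ / T ^ 2) + 4 / 3 * (T * M * x ^ σ₀) := by ring
    _ ≤ 2 * (A * x ^ σ / T) + 4 * (M * x ^ σ / T ^ 2) + 4 * (T * M * x ^ σ₀) := by
        gcongr <;> norm_num
    _ = _ := by ring

end

section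
open Complex Metric Set Filter Topology MeasureTheory
open ArithmeticFunction (vonMangoldt)

noncomputable def zd : ℂ → ℂ := dslope (Lent (1 : DirichletCharacter ℂ 1)) 1

lemma zd_diff : Differentiable ℂ zd := by
  rw [← differentiableOn_univ]
  exact (differentiableOn_dslope Filter.univ_mem).2 (Lent_differentiable _).differentiableOn

lemma Lent_one_one : Lent (1 : DirichletCharacter ℂ 1) 1 = 1 := by simp [Lent]

lemma zd_eq {w : ℂ} (hw : w ≠ 1) : riemannZeta w - 1 / (w - 1) = zd w := by
  classical
  have h := Lent_eq (1 : DirichletCharacter ℂ 1) hw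
  have hw' := sub_ne_zero.2 hw
  rw [zd, dslope_of_ne _ hw, slope_def_field, Lent_one_one, h, if_pos rfl,
    DirichletCharacter.LFunction_modOne_eq]
  field_simp

lemma zd_bound : ∃ K ≥ (1 : ℝ), ∀ w : ℂ, 1 / 2 ≤ w.re → ‖zd w‖ ≤ K * (‖w‖ + 1) := by
  obtain ⟨K, hK⟩ := (isCompact_closedBall (1 : ℂ) 1).exists_bound_of_continuousOn zd_diff.continuous.continuousOn
  refine ⟨max K 33, by simp, fun w hw => ?_⟩
  have h1 : 1 ≤ ‖w‖ + 1 := by linarith [norm_nonneg w]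
  by_cases h : w ∈ closedBall (1 : ℂ) 1
  · have := hK w h
    nlinarith [le_max_left K 33, le_max_right K 33]
  · have h2 : 1 < ‖w - 1‖ := by simpa [dist_eq_norm] using h
    have hw1 : w ≠ 1 := by rintro rfl; simp at h2; linarith
    have h3 := Lent_bound (1 : DirichletCharacter ℂ 1) hw
    have h5 : ‖w‖ ≤ ‖w - 1‖ + 1 := by
      have := norm_add_le (w - 1) 1
      simpa using this
    rw [zd, dslope_of_ne _ hw1, slope_def_field, Lent_one_one, norm_div, div_le_iff₀ (by linarith)]
    refine (norm_sub_le _ _).trans ?_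
    simp at h3 ⊢
    have h6 : 33 * (‖w‖ + 1) * ‖w - 1‖ ≤ max K 33 * (‖w‖ + 1) * ‖w - 1‖ := by
      gcongr; exact le_max_right K 33
    nlinarith

noncomputable def ca {m : ℕ} (χ : DirichletCharacter ℂ m) (e β : ℝ) (n : ℕ) : ℂ :=
  χ n * (vonMangoldt n : ℂ) - e * (n : ℂ) ^ ((β - 1 : ℝ) : ℂ)

lemma pow_term (β : ℝ) (s : ℂ) (n : ℕ) : LSeries.term (fun n => (n : ℂ) ^ ((β - 1 : ℝ) : ℂ)) s n
    = LSeries.term 1 (s + 1 - β) n := by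
  rcases eq_or_ne n 0 with rfl | h0
  · simp
  have h : (n : ℂ) ≠ 0 := by exact_mod_cast h0
  rw [LSeries.term_of_ne_zero h0, LSeries.term_of_ne_zero h0, ← cpow_sub _ _ h, Pi.one_apply, one_div, ← cpow_neg]
  congr 1; push_cast; ring

lemma pow_LSeries {β : ℝ} (hβ : β ≤ 1) {s : ℂ} (hs : 1 < s.re) :
    LSeriesSummable (fun n => (n : ℂ) ^ ((β - 1 : ℝ) : ℂ)) s ∧
    LSeries (fun n => (n : ℂ) ^ ((β - 1 : ℝ) : ℂ)) s = riemannZeta (s + 1 - β) := by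
  have h : 1 < (s + 1 - β).re := by simp; linarith
  refine ⟨?_, ?_⟩
  · rw [LSeriesSummable, funext (pow_term β s)]; exact LSeriesSummable_one_iff.2 h
  · rw [← LSeries_one_eq_riemannZeta h, LSeries, tsum_congr (pow_term β s)]; rfl

lemma ca_LSeries {m : ℕ} [NeZero m] (χ : DirichletCharacter ℂ m) (e : ℝ) {β : ℝ} (hβ : β ≤ 1) {s : ℂ} (hs : 1 < s.re) :
    LSeriesSummable (ca χ e β) s ∧ LSeries (ca χ e β) s = nlogL χ s - e * riemannZeta (s + 1 - β) := by
  have h1 := DirichletCharacter.LSeriesSummable_twist_vonMangoldt χ hs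
  have h2 := pow_LSeries hβ hs
  have h3 := h2.1.smul (c := (e : ℂ))
  refine ⟨LSeriesSummable.sub h1 h3, ?_⟩
  rw [nlogL_eq_LSeries χ hs, ← h2.2, ← LSeries_smul]
  exact LSeries_sub h1 h3

lemma nlogL_bound {m : ℕ} [NeZero m] (χ : DirichletCharacter ℂ m) {s : ℂ} {L : ℝ} (hL : 1 ≤ L) (hs : s.re = 1 + 1 / L) :
    ‖nlogL χ s‖ ≤ 360 * L ^ 2 := by
  have hL0 : 0 < L := by linarith
  have hs1 : 1 < s.re := by rw [hs]; simp [hL0]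
  rw [nlogL_eq_LSeries χ hs1]
  have hre : (s - (1 / (2 * L) : ℝ)).re = 1 + 1 / (2 * L) := by
    simp [hs]; field_simp; ring
  have h := LSeries_norm_le_zeta (f := fun n => χ n * ((vonMangoldt n / (2 * L * (n : ℝ) ^ (1 / (2 * L))) : ℝ) : ℂ))
    (s := s - (1 / (2 * L) : ℝ)) ?_ ?_ ?_
  · have e : LSeries (fun n => χ n * (vonMangoldt n : ℂ)) s = (2 * L : ℝ) *
        LSeries (fun n => χ n * ((vonMangoldt n / (2 * L * (n : ℝ) ^ (1 / (2 * L))) : ℝ) : ℂ)) (s - (1 / (2 * L) : ℝ)) := by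
      rw [LSeries, LSeries, ← tsum_mul_left]
      refine tsum_congr fun n => ?_
      rcases eq_or_ne n 0 with rfl | h0
      · simp
      have hn : (n : ℂ) ≠ 0 := by exact_mod_cast h0
      have hp : (n : ℂ) ^ (((1 / (2 * L) : ℝ)) : ℂ) ≠ 0 := by simp [cpow_eq_zero_iff, hn]
      have hL' : (L : ℂ) ≠ 0 := by exact_mod_cast hL0.ne'
      have hp2 : (n : ℂ) ^ s ≠ 0 := by simp [cpow_eq_zero_iff, hn]
      rw [LSeries.term_of_ne_zero h0, LSeries.term_of_ne_zero h0, cpow_sub _ _ hn, ofReal_div, ofReal_mul (2 * L),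
        ofReal_cpow (Nat.cast_nonneg n), ofReal_natCast]
      field_simp
    rw [e, norm_mul, norm_real, Real.norm_of_nonneg (by positivity)]
    rw [hre] at h
    calc _ ≤ 2 * L * (90 / (1 + 1 / (2 * L) - 1)) := by gcongr
      _ = _ := by field_simp; ring
  · intro n
    rcases eq_or_ne n 0 with rfl | h0
    · simp
    have hn : (0 : ℝ) < n := by positivity
    rw [norm_mul, norm_real, Real.norm_of_nonneg (div_nonneg ArithmeticFunction.vonMangoldt_nonneg (by positivity))]
    refine mul_le_one₀ (DirichletCharacter.norm_le_one χ _) (div_nonneg ArithmeticFunction.vonMangoldt_nonneg (by positivity)) ?_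
    rw [div_le_one (by positivity)]
    refine ArithmeticFunction.vonMangoldt_le_log.trans ((Real.log_le_rpow_div hn.le (ε := 1 / (2 * L)) (by positivity)).trans_eq ?_)
    field_simp
  · rw [hre]; simp [hL0]
  · rw [hre]
    have : 1 / (2 * L) ≤ 1 / 2 := one_div_le_one_div_of_le (by norm_num) (by linarith)
    linarith

lemma pnt_smooth {K : ℝ} (hK1 : 1 ≤ K) (hK : ∀ w : ℂ, 1 / 2 ≤ w.re → ‖zd w‖ ≤ K * (‖w‖ + 1))
    {m : ℕ} [NeZero m] {χ : DirichletCharacter ℂ m} {F : ℂ → ℂ} {e β κ T Ml : ℝ}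
    (hFd : Differentiable ℂ F) (he : |e| ≤ 1) (hβ : 3 / 4 ≤ β) (hβ1 : β ≤ 1) (hκ1 : κ ≤ 1 / 8)
    (hT : 1 ≤ T) (hMl : 0 < Ml)
    (hF : ∀ s : ℂ, 1 < s.re → nlogL χ s = -(deriv F s / F s) + e / (s - β))
    (h0 : ∀ s : ℂ, 1 - 2 * κ ≤ s.re → |s.im| ≤ T + 1 → F s ≠ 0)
    (hb : ∀ t : ℝ, |t| ≤ T → ∀ z ∈ ball (1 + κ + t * I : ℂ) (3 * κ), ‖F z‖ ≤ Real.exp Ml * ‖F (1 + κ + t * I)‖)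
    {N : ℕ} (hN : 1 ≤ Real.log N) (hκL : 1 / Real.log N ≤ κ) {x : ℕ} (hx1 : 1 ≤ x) (hx2 : x ≤ N) :
    ‖∑ n ∈ Finset.Icc 1 x, ca χ e β n * ((max (1 - n / (x : ℝ)) 0 : ℝ) : ℂ)‖ ≤
      2700 * Real.log N ^ 2 * N / T + 12 * (20 * Ml / κ + K * (T + 4)) * N / T ^ 2
        + 4 * T * (20 * Ml / κ + K * (T + 4)) * (N : ℝ) ^ (1 - κ) := by
  set L := Real.log N with hL
  have hL0 : 0 < L := by linarith
  have hκ : 0 < κ := lt_of_lt_of_le (by positivity) hκL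
  have hN1 : (1 : ℝ) ≤ x := by exact_mod_cast hx1
  have hxN : (x : ℝ) ≤ N := by exact_mod_cast hx2
  have hσ1 : ∀ y : ℝ, ((1 + 1 / L : ℝ) + y * I : ℂ).re = 1 + 1 / L := fun y => by simp
  have hL1 : 1 / L ≤ 1 := by rw [div_le_one hL0]; exact hN
  have hσ2 : 1 < 1 + 1 / L := by simp [hL0]
  have hne : ∀ s : ℂ, 1 < s.re → s - β ≠ 0 := fun s hs h => by
    have := congrArg re h; simp at this; linarith
  have key := perron_bound (a := ca χ e β) (G := fun s => -(deriv F s / F s) - e * zd (s + 1 - β))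
    (σ₀ := 1 - κ) (σ := 1 + 1 / L) (x := x) (T := T) (A := 450 * L ^ 2) (M := 20 * Ml / κ + K * (T + 4)) (X := x)
    (by linarith) (by linarith [show 0 < 1 / L by positivity]) (by linarith) hT hN1
    (ca_LSeries χ e hβ1 (by simpa using hL0)).1 le_rfl ?_ ?_ ?_ ?_
  · have hp1 : (x : ℝ) ^ (1 + 1 / L) ≤ 3 * N := by
      calc (x : ℝ) ^ (1 + 1 / L) ≤ (N : ℝ) ^ (1 + 1 / L) := by gcongr
        _ = N * (N : ℝ) ^ (1 / L) := by rw [Real.rpow_add (by linarith), Real.rpow_one]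
        _ ≤ N * 3 := by
          gcongr
          rw [Real.rpow_def_of_pos (by linarith), ← hL, mul_one_div_cancel hL0.ne']
          exact Real.exp_one_lt_d9.le.trans (by norm_num)
        _ = _ := by ring
    refine key.trans ?_
    calc _ ≤ 2 * (450 * L ^ 2) * (3 * N) / T + 4 * (20 * Ml / κ + K * (T + 4)) * (3 * N) / T ^ 2 +
          4 * T * (20 * Ml / κ + K * (T + 4)) * (N : ℝ) ^ (1 - κ) := by
          gcongr; linarith
      _ = _ := by ring
  · intro y
    have h2 := hσ1 y
    rw [(ca_LSeries χ e hβ1 (by rw [h2]; exact hσ2)).2, ← (pow_LSeries hβ1 (by rw [h2]; exact hσ2)).2]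
    have h3 := nlogL_bound χ hN h2
    have h4 := LSeries_norm_le_zeta (f := fun n => ((n : ℂ) ^ ((β - 1 : ℝ) : ℂ)))
      (s := (1 + 1 / L : ℝ) + y * I) ?_ (by rw [h2]; exact hσ2) (by rw [h2]; linarith)
    · rw [h2] at h4
      refine (norm_sub_le _ _).trans ?_
      rw [norm_mul, norm_real, Real.norm_eq_abs]
      have h5 : 90 / (1 + 1 / L - 1) = 90 * L := by field_simp; ring
      rw [h5] at h4
      have h6 := mul_le_mul he h4 (norm_nonneg _) zero_le_one
      nlinarith
    · intro n
      rcases Nat.eq_zero_or_pos n with rfl | hn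
      · by_cases hb1 : β - 1 = 0
        · simp [hb1]
        · rw [Nat.cast_zero, zero_cpow (by exact_mod_cast hb1)]; simp
      · rw [norm_natCast_cpow_of_pos hn]
        exact Real.rpow_le_one_of_one_le_of_nonpos (by exact_mod_cast hn) (by simpa)
  · intro s hs
    rw [mem_reProdIm, uIcc_of_le (by linarith [show 0 < 1 / L by positivity]), uIcc_of_le (by linarith)] at hs
    have h1 := h0 s (by linarith [hs.1.1]) (by have := abs_le.2 hs.2; linarith)
    have h2 : DifferentiableAt ℂ (deriv F) s := (hFd.contDiff (n := 2)).differentiable_deriv_two s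
    have h3 : DifferentiableAt ℂ (fun s => zd (s + 1 - β)) s :=
      (zd_diff _).comp s (by fun_prop)
    exact ((h2.div (hFd s) h1).neg.sub (h3.const_mul _)).differentiableWithinAt
  · intro y hy
    have h2 : 1 < ((1 + 1 / L : ℝ) + y * I : ℂ).re := by rw [hσ1 y]; exact hσ2
    rw [(ca_LSeries χ e hβ1 h2).2, hF _ h2, ← zd_eq]
    · have := hne _ h2
      field_simp
      ring
    · intro h; apply hne _ h2; linear_combination h
  · intro s hs
    rw [mem_reProdIm, uIcc_of_le (by linarith [show 0 < 1 / L by positivity]), uIcc_of_le (by linarith)] at hs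
    have hsT : |s.im| ≤ T := abs_le.2 hs.2
    have hc := logDeriv_bound hFd (c := 1 + κ + s.im * I) (R := 3 * κ) (M := Ml) (by positivity) hMl ?_ (hb _ hsT)
      (z := s) ?_
    · refine (norm_sub_le _ _).trans ?_
      rw [norm_neg, norm_mul, norm_real, Real.norm_eq_abs]
      have hw := hK (s + 1 - β) (by simp; linarith [hs.1.1])
      have hn : ‖s + 1 - β‖ ≤ T + 3 := by
        refine (norm_le_abs_re_add_abs_im _).trans ?_
        simp only [sub_re, add_re, one_re, ofReal_re, sub_im, add_im, one_im, ofReal_im]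
        rw [abs_of_nonneg (by linarith [hs.1.1])]
        simp only [add_zero, sub_zero]
        linarith [hs.1.2]
      have h6 := mul_le_mul he hw (norm_nonneg _) zero_le_one
      have h7 : K * (‖s + 1 - β‖ + 1) ≤ K * (T + 4) :=
        mul_le_mul_of_nonneg_left (by linarith) (by linarith)
      have h8 : 60 * Ml / (3 * κ) = 20 * Ml / κ := by field_simp; norm_num
      linarith
    · intro z hz
      rw [mem_ball, dist_eq_norm] at hz
      have h1 := (abs_re_le_norm _).trans_lt hz
      have h2 := (abs_im_le_norm _).trans_lt hz
      simp at h1 h2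
      rw [abs_lt] at h1 h2
      refine h0 z (by linarith [h1.1]) ?_
      rw [abs_le] at hsT ⊢
      constructor <;> linarith [hsT.1, hsT.2]
    · have : s - (1 + κ + s.im * I) = ((s.re - 1 - κ : ℝ) : ℂ) := by
        apply Complex.ext <;> simp; ring
      rw [this, norm_real, Real.norm_eq_abs, abs_le]
      constructor <;> linarith [hs.1.1, hs.1.2]

lemma desmooth {a : ℕ → ℂ} {E l : ℝ} {N : ℕ} (hE : ∀ x : ℕ, 1 ≤ x → x ≤ N →
      ‖∑ n ∈ Finset.Icc 1 x, a n * ((max (1 - n / (x : ℝ)) 0 : ℝ) : ℂ)‖ ≤ E)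
    (hl : ∀ n ∈ Finset.Icc 1 N, ‖a n‖ ≤ l) {x H : ℕ} (hH : 1 ≤ H) (hx : x + H ≤ N) :
    ‖∑ n ∈ Finset.Icc 1 x, a n‖ ≤ 2 * N * E / H + H * l := by
  have hE0 : 0 ≤ E := (norm_nonneg _).trans (hE 1 le_rfl (by omega))
  have hl0 : 0 ≤ l := (norm_nonneg _).trans (hl 1 (Finset.mem_Icc.2 ⟨le_rfl, by omega⟩))
  have hP : ∀ y : ℕ, y ≤ N → ‖∑ n ∈ Finset.Icc 1 y, a n * ((y : ℂ) - n)‖ ≤ N * E := by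
    intro y hy
    rcases Nat.eq_zero_or_pos y with rfl | hy0
    · simp; positivity
    have e : ∑ n ∈ Finset.Icc 1 y, a n * ((y : ℂ) - n) =
        y * ∑ n ∈ Finset.Icc 1 y, a n * ((max (1 - n / (y : ℝ)) 0 : ℝ) : ℂ) := by
      rw [Finset.mul_sum]
      refine Finset.sum_congr rfl fun n hn => ?_
      have : (n : ℝ) ≤ y := by exact_mod_cast (Finset.mem_Icc.1 hn).2
      have hy' : (y : ℂ) ≠ 0 := by exact_mod_cast hy0.ne'
      rw [max_eq_left (by rw [sub_nonneg, div_le_one (by positivity)]; exact this)]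
      push_cast; field_simp
    rw [e, norm_mul, norm_natCast]
    gcongr; exact hE y hy0 hy
  have h1 := hP x (by omega)
  have h2 := hP (x + H) hx
  have hsub : Finset.Icc 1 (x + H) = Finset.Icc 1 x ∪ Finset.Icc (x + 1) (x + H) := by ext; simp; omega
  have hdis : Disjoint (Finset.Icc 1 x) (Finset.Icc (x + 1) (x + H)) := by
    rw [Finset.disjoint_left]; intro n; simp; omega
  have e : (H : ℂ) * ∑ n ∈ Finset.Icc 1 x, a n = ∑ n ∈ Finset.Icc 1 (x + H), a n * (((x + H : ℕ) : ℂ) - n)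
      - ∑ n ∈ Finset.Icc 1 x, a n * ((x : ℂ) - n) - ∑ n ∈ Finset.Icc (x + 1) (x + H), a n * (((x + H : ℕ) : ℂ) - n) := by
    rw [hsub, Finset.sum_union hdis, Finset.mul_sum]
    have : ∑ n ∈ Finset.Icc 1 x, a n * (((x + H : ℕ) : ℂ) - n) = ∑ n ∈ Finset.Icc 1 x, (H * a n + a n * ((x : ℂ) - n)) :=
      Finset.sum_congr rfl fun n _ => by push_cast; ring
    rw [this, Finset.sum_add_distrib]; ring
  have h3 : ‖∑ n ∈ Finset.Icc (x + 1) (x + H), a n * (((x + H : ℕ) : ℂ) - n)‖ ≤ H * (l * H) := by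
    refine (norm_sum_le_of_le (f := fun n => a n * (((x + H : ℕ) : ℂ) - n)) _ (n := fun _ => l * H) fun n hn => ?_).trans_eq (by simp)
    rw [Finset.mem_Icc] at hn
    rw [norm_mul, ← Nat.cast_sub hn.2, norm_natCast]
    gcongr
    · exact hl n (Finset.mem_Icc.2 ⟨by omega, by omega⟩)
    · omega
  have hH0 : (0 : ℝ) < H := by exact_mod_cast hH
  have h4 := congrArg norm e
  rw [norm_mul, norm_natCast] at h4
  have h5 : H * ‖∑ n ∈ Finset.Icc 1 x, a n‖ ≤ 2 * N * E + H * (l * H) := by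
    rw [h4]; refine (norm_sub_le _ _).trans (add_le_add ((norm_sub_le _ _).trans ?_) h3); linarith
  rw [← sub_nonneg] at h5 ⊢
  have : 2 * N * E / H + H * l - ‖∑ n ∈ Finset.Icc 1 x, a n‖ = (2 * N * E + H * (l * H) - H * ‖∑ n ∈ Finset.Icc 1 x, a n‖) / H := by
    field_simp
  rw [this]; positivity

end

section
open Complex Metric Set Filter Topology MeasureTheory
open ArithmeticFunction (vonMangoldt)

lemma ev_log (C : ℝ) (k : ℕ) : ∀ᶠ Q : ℝ in atTop, C * Real.log Q ^ k ≤ Q := by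
  have h := (Real.isLittleO_pow_log_id_atTop (n := k)).const_mul_left C
  have h2 := h.bound (c := 1) one_pos
  filter_upwards [h2, eventually_ge_atTop 0] with Q hQ h0
  have := (le_abs_self _).trans hQ
  simpa [abs_of_nonneg h0] using this

lemma ev_const (C : ℝ) : ∀ᶠ Q : ℝ in atTop, C ≤ Q := eventually_ge_atTop C

lemma ev_llog (C : ℝ) : ∀ᶠ Q : ℝ in atTop, C ≤ Real.log Q := Real.tendsto_log_atTop.eventually_ge_atTop C

lemma ca_norm {m : ℕ} (χ : DirichletCharacter ℂ m) {e β : ℝ} (he : |e| ≤ 1) (hβ : β ≤ 1) {n : ℕ} (hn : 1 ≤ n) :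
    ‖ca χ e β n‖ ≤ Real.log n + 1 := by
  unfold ca
  refine (norm_sub_le _ _).trans (add_le_add ?_ ?_)
  · rw [norm_mul, norm_real, Real.norm_of_nonneg ArithmeticFunction.vonMangoldt_nonneg]
    calc _ ≤ 1 * Real.log n := mul_le_mul (DirichletCharacter.norm_le_one χ _) ArithmeticFunction.vonMangoldt_le_log
          ArithmeticFunction.vonMangoldt_nonneg zero_le_one
      _ = _ := one_mul _
  · rw [norm_mul, norm_real, Real.norm_eq_abs, norm_natCast_cpow_of_pos hn]
    exact mul_le_one₀ he (by positivity) (Real.rpow_le_one_of_one_le_of_nonpos (by exact_mod_cast hn) (by simpa))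

lemma pnt_core (B k : ℕ) {b : ℝ} (hb0 : 0 < b) : ∀ᶠ Q : ℝ in atTop, ∀ N : ℕ, Real.log N = Real.log Q ^ 3 →
    ∀ (m : ℕ) [NeZero m] (χ : DirichletCharacter ℂ m) (F : ℂ → ℂ) (e β : ℝ),
    Differentiable ℂ F → |e| ≤ 1 → 3 / 4 ≤ β → β ≤ 1 →
    (∀ s : ℂ, 1 < s.re → nlogL χ s = -(deriv F s / F s) + e / (s - β)) →
    (∀ s : ℂ, 1 - 2 * (b / Real.log Q) ≤ s.re → |s.im| ≤ Q ^ (2 * B + 6) + 1 → F s ≠ 0) →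
    (∀ t : ℝ, |t| ≤ Q ^ (2 * B + 6) → ∀ z ∈ ball (1 + (b / Real.log Q : ℝ) + t * I : ℂ) (3 * (b / Real.log Q)),
      ‖F z‖ ≤ Q ^ k * ‖F (1 + (b / Real.log Q : ℝ) + t * I)‖) →
    ∀ x : ℕ, x ≤ 2 * N → ‖∑ n ∈ Finset.Icc 1 x, ca χ e β n‖ ≤ N / Q ^ B := by
  obtain ⟨K0, hK1, hK⟩ := zd_bound
  filter_upwards [ev_const 40000, ev_const (20 * K0), ev_llog 2, ev_llog (8 * b), ev_llog (1 / b), ev_llog ((3 * (2 * B + 6) : ℕ) / b),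
    ev_log 2 3, ev_log (80 * (k + 1) / b) 2] with Q h1 h2 h3 h4 h5 h6 h7 h8 N hN m _ χ F e β hFd he hβ hβ1 hF h0 hb x hx
  set ℓ := Real.log Q with hℓ
  obtain ⟨T, hTdef⟩ : ∃ T, T = Q ^ (2 * B + 6) := ⟨_, rfl⟩
  rw [← hTdef] at h0 hb
  have hQ0 : 0 < Q := by linarith
  have hQ1 : 1 ≤ Q := by linarith
  have hℓ0 : 0 < ℓ := by linarith
  have hTQ : Q ≤ T := by rw [hTdef]; exact le_self_pow₀ hQ1 (by omega)
  have hT0 : 0 < T := by linarith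
  have hN0 : 0 < N := by
    rcases Nat.eq_zero_or_pos N with rfl | h
    · simp at hN; nlinarith [pow_pos hℓ0 3]
    · exact h
  have hNr : (0 : ℝ) < N := by exact_mod_cast hN0
  have hl4 : Real.log 4 ≤ 2 := by
    have : (4 : ℝ) = 2 ^ 2 := by norm_num
    rw [this, Real.log_pow]; push_cast; linarith [Real.log_two_lt_d9]
  have hl40 : 0 ≤ Real.log 4 := Real.log_nonneg (by norm_num)
  have hL : Real.log ((4 * N : ℕ) : ℝ) = Real.log 4 + ℓ ^ 3 := by
    push_cast; rw [Real.log_mul (by norm_num) hNr.ne', hN]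
  have h8' : 8 ≤ ℓ ^ 3 := by nlinarith [pow_le_pow_left₀ (by norm_num) h3 3]
  have hLQ : Real.log ((4 * N : ℕ) : ℝ) + 1 ≤ Q := by rw [hL]; linarith
  have hκ0 : 0 < b / ℓ := by positivity
  have hE := fun (x : ℕ) (hx1 : 1 ≤ x) (hx2 : x ≤ 4 * N) => pnt_smooth hK1 hK (κ := b / ℓ) (T := T) (Ml := (k + 1) * ℓ) hFd he hβ hβ1
    (by rw [div_le_iff₀ hℓ0]; linarith) (by linarith) (by positivity) hF h0
    (fun t ht z hz => by
      refine (hb t ht z hz).trans ?_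
      gcongr
      rw [hℓ, ← Nat.cast_succ, ← Real.log_pow, Real.exp_log (by positivity)]
      exact pow_le_pow_right₀ hQ1 (Nat.le_succ k)) (N := 4 * N) (by rw [hL]; linarith)
    (by
      rw [hL, div_le_div_iff₀ (by positivity) hℓ0]
      have : 1 ≤ b * ℓ := by rw [div_le_iff₀ hb0] at h5; linarith
      have h9 : ℓ ≤ ℓ ^ 3 * b := by
        have : ℓ * 1 ≤ ℓ * (ℓ * (b * ℓ)) := by gcongr; nlinarith
        nlinarith
      nlinarith) hx1 hx2
  have hM : 20 * ((k + 1) * ℓ) / (b / ℓ) + K0 * (T + 4) ≤ Q * T := by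
    have e1 : 20 * ((k + 1) * ℓ) / (b / ℓ) = (80 * (k + 1) / b * ℓ ^ 2) / 4 := by field_simp; norm_num
    rw [e1]
    have : K0 * (T + 4) ≤ Q / 20 * (2 * T) := by gcongr <;> linarith
    nlinarith
  have hNk : ((4 * N : ℕ) : ℝ) ^ (1 - b / ℓ) ≤ 4 * N / T ^ 3 := by
    have hp : (0 : ℝ) < ((4 * N : ℕ) : ℝ) := by push_cast; positivity
    rw [Real.rpow_sub hp, Real.rpow_one]
    push_cast
    gcongr
    rw [Real.rpow_def_of_pos (by positivity), hTdef, ← pow_mul]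
    have : Real.log (4 * N) = Real.log 4 + ℓ ^ 3 := by rw [← hL]; push_cast; rfl
    rw [this, ← Real.log_le_log_iff (by positivity) (Real.exp_pos _), Real.log_exp, Real.log_pow, ← hℓ]
    rw [div_le_iff₀ hb0] at h6
    have h9 : (ℓ ^ 3) * (b / ℓ) = ℓ * b * ℓ := by field_simp
    have h10 : 0 ≤ Real.log 4 * (b / ℓ) := by positivity
    rw [add_mul (Real.log 4), h9]
    have h11 : ((((2 * B + 6) * 3 : ℕ)) : ℝ) * ℓ ≤ ℓ * b * ℓ := by
      gcongr
      rw [mul_comm (2 * B + 6) 3]; exact h6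
    linarith
  have hEE : ∀ x : ℕ, 1 ≤ x → x ≤ 4 * N →
      ‖∑ n ∈ Finset.Icc 1 x, ca χ e β n * ((max (1 - n / (x : ℝ)) 0 : ℝ) : ℂ)‖ ≤ N * Q ^ 3 / T := by
    intro x hx1 hx2
    refine (hE x hx1 hx2).trans ?_
    calc _ ≤ 2700 * Q ^ 2 * (4 * N) / T + 12 * (Q * T) * (4 * N) / T ^ 2 + 4 * T * (Q * T) * (4 * N / T ^ 3) := by
          have h9 : 0 ≤ Real.log ((4 * N : ℕ) : ℝ) := by rw [hL]; linarith
          have e4 : ((4 * N : ℕ) : ℝ) = 4 * N := by push_cast; rfl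
          rw [e4] at hNk h9 ⊢
          rw [e4] at hLQ
          gcongr
          linarith
      _ = (10800 * Q ^ 2 + 64 * Q) * N / T := by field_simp; ring
      _ ≤ (Q ^ 3) * N / T := by gcongr; nlinarith [pow_pos hQ0 2]
      _ = _ := by ring
  obtain ⟨H, hH⟩ : ∃ H, H = ⌈(N : ℝ) / Q ^ (B + 2)⌉₊ := ⟨_, rfl⟩
  have hQB : Q ≤ Q ^ (B + 2) := le_self_pow₀ hQ1 (by omega)
  have hH0 : 1 ≤ H := by rw [hH]; exact Nat.ceil_pos.2 (by positivity)
  have hN2 : Q ^ (B + 2) ≤ N := by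
    rw [← Real.log_le_log_iff (by positivity) hNr, hN, Real.log_pow, ← hℓ]
    rw [div_le_iff₀ hb0] at h6
    have hb8 : b ≤ ℓ := by linarith
    have : (((3 * (2 * B + 6) : ℕ)) : ℝ) ≤ ℓ * ℓ := h6.trans (by gcongr)
    have h9 : ((B + 2 : ℕ) : ℝ) ≤ ℓ * ℓ := le_trans (by exact_mod_cast (by omega)) this
    calc _ ≤ ℓ * ℓ * ℓ := by gcongr
      _ = _ := by ring
  have hH1 : (N : ℝ) / Q ^ (B + 2) ≤ H := by rw [hH]; exact Nat.le_ceil _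
  have hH2 : (H : ℝ) ≤ 2 * N / Q ^ (B + 2) := by
    have := Nat.ceil_lt_add_one (show 0 ≤ (N : ℝ) / Q ^ (B + 2) by positivity)
    rw [← hH] at this
    have h9 : 1 ≤ (N : ℝ) / Q ^ (B + 2) := by rw [one_le_div (by positivity)]; exact hN2
    rw [mul_div_assoc]; linarith
  have hHN : x + H ≤ 4 * N := by
    have : (H : ℝ) ≤ 2 * N := hH2.trans (div_le_self (by positivity) (by linarith))
    have : H ≤ 2 * N := by exact_mod_cast this
    omega
  have hl : ∀ n ∈ Finset.Icc 1 (4 * N), ‖ca χ e β n‖ ≤ Q := by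
    intro n hn
    rw [Finset.mem_Icc] at hn
    refine (ca_norm χ he hβ1 hn.1).trans (le_trans ?_ hLQ)
    gcongr
    · exact_mod_cast hn.1
    · exact hn.2
  refine (desmooth hEE hl hH0 hHN).trans ?_
  have hHr : (0 : ℝ) < H := by exact_mod_cast hH0
  calc 2 * ((4 * N : ℕ) : ℝ) * (N * Q ^ 3 / T) / H + H * Q
      ≤ 2 * (4 * N) * (N * Q ^ 3 / T) / (N / Q ^ (B + 2)) + 2 * N / Q ^ (B + 2) * Q := by
        push_cast; gcongr
    _ = 10 * N / Q ^ (B + 1) := by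
        rw [hTdef, show 2 * B + 6 = (B + 2) + (B + 1) + 3 by omega, pow_add, pow_add]
        rw [show B + 2 = (B + 1) + 1 by omega, pow_succ Q (B + 1)]
        field_simp
        ring
    _ ≤ Q * N / Q ^ (B + 1) := by
        have : 10 ≤ Q := by linarith
        gcongr
    _ = _ := by rw [pow_succ]; field_simp

end

section
open Complex Metric Set Filter Topology MeasureTheory

def BadZ (κ : ℝ) {m : ℕ} [NeZero m] (χ : DirichletCharacter ℂ m) (β : ℝ) : Prop :=
  χ ≠ 1 ∧ Lent χ (β : ℂ) = 0 ∧ 1 - κ ≤ β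

set_option maxHeartbeats 1000000 in
theorem pnt_main (K B : ℕ) : ∃ b > 0, ∀ᶠ Q : ℝ in atTop, ∀ N : ℕ, Real.log N = Real.log Q ^ 3 →
    ∀ (m : ℕ) [NeZero m], (m : ℝ) ≤ Q ^ K →
    (∀ x ≤ 2 * N, ‖∑ n ∈ Finset.Icc 1 x, ca (1 : DirichletCharacter ℂ m) 1 1 n‖ ≤ N / Q ^ B) ∧
    (∀ χ : DirichletCharacter ℂ m, χ ≠ 1 → (∀ β, ¬ BadZ (b / Real.log Q) χ β) →
      ∀ x ≤ 2 * N, ‖∑ n ∈ Finset.Icc 1 x, ca χ 0 1 n‖ ≤ N / Q ^ B) ∧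
    (∀ (χ : DirichletCharacter ℂ m) (β : ℝ), BadZ (b / Real.log Q) χ β → χ ^ 2 = 1 ∧ 3 / 4 ≤ β ∧ β < 1 ∧
      (∀ x ≤ 2 * N, ‖∑ n ∈ Finset.Icc 1 x, ca χ (-1) β n‖ ≤ N / Q ^ B) ∧
      ∀ (χ' : DirichletCharacter ℂ m) (β' : ℝ), BadZ (b / Real.log Q) χ' β' → χ' = χ ∧ β' = β) := by
  classical
  obtain ⟨b0, hb0, Q0, hzf⟩ := zero_free
  set K' := K + 4 * B + 14 with hK'
  have hK'0 : (0 : ℝ) < K' := by rw [hK']; positivity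
  obtain ⟨bc, hbc⟩ : ∃ bc, bc = b0 / (2 * K') := ⟨_, rfl⟩
  have hbc0 : 0 < bc := by rw [hbc]; positivity
  refine ⟨2 * bc, by positivity, ?_⟩
  filter_upwards [pnt_core B (K' + 2 * B + 8) hbc0, ev_const 10, ev_const Q0, ev_llog (24 * bc), ev_log (7200 / bc ^ 2) 2, ev_llog 1]
    with Q hcore hQ10 hQQ0 hℓ24 hℓ2 hℓ1 N hN m _ hm
  have hcore' := fun χ F e β => hcore N hN m χ F e β
  clear hcore
  set ℓ := Real.log Q with hℓ
  obtain ⟨T, hT⟩ : ∃ T, T = Q ^ (2 * B + 6) := ⟨_, rfl⟩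
  rw [← hT] at hcore'
  have hQ1 : 1 ≤ Q := by linarith
  have hQ0 : 0 < Q := by linarith
  have hℓ0 : 0 < ℓ := by linarith
  have hT1 : 1 ≤ T := by rw [hT]; exact one_le_pow₀ hQ1
  have hTs : T + 9 * T ≤ Q ^ (2 * B + 7) := by rw [pow_succ, ← hT]; nlinarith
  have hm1 : (1 : ℝ) ≤ m := by exact_mod_cast Nat.pos_of_ne_zero (NeZero.ne m)
  have hlev : m * (2 * (T + 1) + 4) ^ 2 ≤ Q ^ K' := by
    calc m * (2 * (T + 1) + 4) ^ 2 ≤ Q ^ K * (Q ^ (2 * B + 7)) ^ 2 := by gcongr; linarith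
      _ = _ := by rw [← pow_mul, ← pow_add, hK']; congr 1; omega
  have hlev' : ∀ t : ℝ, |t| ≤ T + 1 → m * (2 * |t| + 4) ^ 2 ≤ Q ^ K' := fun t ht => le_trans (by gcongr) hlev
  have hQK : Q0 ≤ Q ^ K' := hQQ0.trans (le_self_pow₀ hQ1 (by omega))
  have hth : b0 / Real.log (Q ^ K') = 2 * bc / ℓ := by
    rw [Real.log_pow, hbc, ← hℓ]; field_simp
  obtain ⟨κ, hκ⟩ : ∃ κ, κ = bc / ℓ := ⟨_, rfl⟩
  have hκ2 : 2 * bc / ℓ = 2 * κ := by rw [hκ]; ring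
  have hκ0 : 0 < κ := by rw [hκ]; positivity
  have hκs : κ ≤ 1 / 24 := by rw [hκ, div_le_iff₀ hℓ0]; linarith
  rw [← hκ] at hcore'
  rw [hκ2]
  have hz := hzf (Q ^ K') hQK m
  rw [hth, hκ2] at hz
  have hnl : ∀ (χ : DirichletCharacter ℂ m) (s : ℂ), 1 < s.re → nlogL χ s = -(deriv (Lent χ) s / Lent χ s) + if χ = 1 then 1 / (s - 1) else 0 :=
    fun χ s hs => nlogL_eq χ (by rintro rfl; simp at hs) (Lent_ne_zero χ hs.le)
  have hcb : ∀ t : ℝ, |t| ≤ T → ‖(1 + κ + t * I : ℂ)‖ ≤ T + 2 := fun t ht => by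
    refine (norm_le_abs_re_add_abs_im _).trans ?_
    simp; rw [abs_of_nonneg (by linarith)]; linarith
  have hball : ∀ t : ℝ, |t| ≤ T → ∀ z ∈ ball (1 + κ + t * I : ℂ) (3 * κ), 1 / 2 ≤ z.re ∧ ‖z‖ ≤ T + 3 := by
    intro t ht z hz
    rw [mem_ball, dist_eq_norm] at hz
    constructor
    · have h1 := (abs_re_le_norm _).trans_lt hz
      simp at h1
      rw [abs_lt] at h1
      linarith [h1.1]
    · have := norm_add_le (z - (1 + κ + t * I)) (1 + κ + t * I)
      simp only [sub_add_cancel] at this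
      linarith [hcb t ht]
  have hup : ∀ (χ : DirichletCharacter ℂ m) (z : ℂ), 1 / 2 ≤ z.re → ‖z‖ ≤ T + 3 → ‖Lent χ z‖ ≤ 10 * Q ^ K' := by
    intro χ z h1 h2
    refine (Lent_bound χ h1).trans ?_
    calc 10 * m * (‖z‖ + 1) ^ 2 = 10 * (m * (‖z‖ + 1) ^ 2) := by ring
      _ ≤ 10 * (m * (2 * (T + 1) + 4) ^ 2) := by
        have : ‖z‖ + 1 ≤ 2 * (T + 1) + 4 := by linarith
        have := pow_le_pow_left₀ (by positivity) this 2
        gcongr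
      _ ≤ _ := by gcongr
  have hlow : ∀ (χ : DirichletCharacter ℂ m) (t : ℝ), κ ^ 2 / 90 ≤ ‖Lent χ (1 + κ + t * I)‖ := by
    intro χ t
    have := Lent_lower χ (s := 1 + κ + t * I) (by simp; linarith) (by simp; linarith)
    simpa using this
  have hκQ : 80 ≤ Q * (κ ^ 2 / 90) := by
    have : 7200 / bc ^ 2 * ℓ ^ 2 = 7200 / κ ^ 2 := by rw [hκ]; field_simp
    rw [this, div_le_iff₀ (by positivity)] at hℓ2
    linarith
  have hLb : ∀ (χ : DirichletCharacter ℂ m) (t : ℝ), |t| ≤ T → ∀ z ∈ ball (1 + κ + t * I : ℂ) (3 * κ),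
      ‖Lent χ z‖ ≤ Q ^ (K' + 2 * B + 8) * ‖Lent χ (1 + κ + t * I)‖ := by
    intro χ t ht z hz
    obtain ⟨h1, h2⟩ := hball t ht z hz
    calc _ ≤ 10 * Q ^ K' := hup χ z h1 h2
      _ ≤ Q ^ K' * (Q * (κ ^ 2 / 90)) := by nlinarith [pow_pos hQ0 K']
      _ = Q ^ (K' + 1) * (κ ^ 2 / 90) := by ring
      _ ≤ _ := by
        have h5 : Q ^ (K' + 1) ≤ Q ^ (K' + 2 * B + 8) := pow_le_pow_right₀ hQ1 (by omega)
        exact mul_le_mul h5 (hlow χ t) (by positivity) (by positivity)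
  have hT0 : ∀ s : ℝ, |((s : ℂ)).im| ≤ T + 1 := fun s => by simp; linarith
  refine ⟨?_, ?_, ?_⟩
  · refine hcore' 1 (Lent 1) 1 1 (Lent_differentiable _) (by simp) (by norm_num) le_rfl ?_ ?_ (hLb 1)
    · intro s hs; rw [hnl _ s hs, if_pos rfl]; simp
    · intro s h1 h2 h3
      exact (hz 1 s (hlev' _ h2) h1 h3).2.1 rfl
  · intro χ hχ hnb
    refine hcore' χ (Lent χ) 0 1 (Lent_differentiable _) (by simp) (by norm_num) le_rfl ?_ ?_ (hLb χ)
    · intro s hs; rw [hnl _ s hs, if_neg hχ]; simp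
    · intro s h1 h2 h3
      obtain ⟨_, _, h4, _⟩ := hz χ s (hlev' _ h2) h1 h3
      have : s = (s.re : ℂ) := by apply Complex.ext <;> simp [h4]
      exact hnb s.re ⟨hχ, by rw [← this]; exact h3, h1⟩
  · intro χ β ⟨hχ, hβ0, hβκ⟩
    obtain ⟨g1, g2, g3, g4, g5⟩ := hz χ β (hlev' _ (hT0 β)) (by simpa using hβκ) hβ0
    have hβ1 : β < 1 := by
      by_contra h
      exact Lent_ne_zero χ (s := β) (by simpa using h) hβ0
    refine ⟨g1, by linarith, hβ1, ?_, ?_⟩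
    · obtain ⟨hd, hds⟩ := Lent_dslope hβ0
      set F := dslope (Lent χ) (β : ℂ) with hF
      refine hcore' χ F (-1) β hd (by simp) (by linarith) hβ1.le ?_ ?_ ?_
      · intro s hs
        have hsβ : s - β ≠ 0 := fun h => by
          have := congrArg re h; simp at this; linarith
        have hL0 := Lent_ne_zero χ hs.le
        rw [hnl _ s hs, if_neg hχ]
        have hF0 : F s ≠ 0 := by intro h; rw [hds, h] at hL0; simp at hL0
        have hder : deriv (Lent χ) s = F s + (s - β) * deriv F s := by
          have h1 : HasDerivAt (fun s : ℂ => (s - β) * F s) (1 * F s + (s - β) * deriv F s) s :=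
            ((hasDerivAt_id s).sub_const _).mul (hd s).hasDerivAt
          rw [funext hds, h1.deriv, one_mul]
        rw [hder, hds s]
        push_cast
        field_simp
        ring
      · intro s h1 h2 h3
        have h4 : Lent χ s = 0 := by rw [hds, h3, mul_zero]
        have h5 := (g5 χ s (hlev' _ h2) h1 h4).2
        rw [h5] at h3
        exact g4 h3
      · intro t ht z hz'
        obtain ⟨h1, h2⟩ := hball t ht z hz'
        have hupF : ‖F z‖ ≤ 80 * Q ^ K' := by
          by_cases hn : ‖z - β‖ < 1 / 4
          · have h3 := norm_dslope_le_div_of_mapsTo_ball (f := Lent χ) (c := (β : ℂ)) (R₁ := 1 / 4) (R₂ := 10 * Q ^ K') (z := z)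
              (Lent_differentiable χ).differentiableOn ?_ (by rwa [mem_ball, dist_eq_norm])
            · refine h3.trans ?_
              linarith [pow_pos hQ0 K']
            · intro w hw
              rw [mem_ball, dist_eq_norm] at hw
              rw [hβ0, mem_closedBall, dist_zero_right]
              refine hup χ w ?_ ?_
              · have h1 := (abs_re_le_norm _).trans_lt hw
                simp at h1
                rw [abs_lt] at h1
                linarith [h1.1]
              · have := norm_add_le (w - β) β
                simp only [sub_add_cancel, norm_real, Real.norm_eq_abs] at this
                rw [abs_of_nonneg (by linarith)] at this
                linarith
          · push Not at hn
            have h3 := hup χ z h1 h2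
            rw [hds z, norm_mul] at h3
            nlinarith [norm_nonneg (F z)]
        have hlowF : κ ^ 2 / 90 ≤ Q ^ (2 * B + 7) * ‖F (1 + κ + t * I)‖ := by
          have h3 := hlow χ t
          rw [hds, norm_mul] at h3
          have h4 : ‖(1 + κ + t * I : ℂ) - β‖ ≤ T + 3 := by
            refine (norm_sub_le _ _).trans ?_
            rw [norm_real, Real.norm_eq_abs, abs_of_nonneg (by linarith)]
            linarith [hcb t ht]
          refine h3.trans (mul_le_mul_of_nonneg_right (by linarith) (norm_nonneg _))
        calc _ ≤ 80 * Q ^ K' := hupF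
          _ ≤ Q ^ K' * (Q * (κ ^ 2 / 90)) := by nlinarith [pow_pos hQ0 K']
          _ ≤ Q ^ K' * (Q * (Q ^ (2 * B + 7) * ‖F (1 + κ + t * I)‖)) := by gcongr
          _ = _ := by ring
    · intro χ' β' ⟨_, h2, h3⟩
      have := g5 χ' β' (hlev' _ (hT0 β')) (by simpa using h3) h2
      exact ⟨this.1, by exact_mod_cast this.2⟩

end

section
open Complex Metric Set Filter Topology MeasureTheory

lemma abel_var {a g : ℕ → ℂ} {E : ℝ} (hE : ∀ k, ‖∑ n ∈ Finset.range k, a n‖ ≤ E) (M : ℕ) :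
    ‖∑ n ∈ Finset.range M, a n * g n‖ ≤ E * (‖g (M - 1)‖ + ∑ n ∈ Finset.range (M - 1), ‖g (n + 1) - g n‖) := by
  have := Finset.sum_range_by_parts g a M
  simp only [smul_eq_mul] at this
  rw [Finset.sum_congr rfl fun n _ => mul_comm (a n) (g n), this, mul_add]
  refine (norm_sub_le _ _).trans (add_le_add ?_ ((norm_sum_le_of_le _ fun n _ => ?_).trans_eq (Finset.mul_sum _ _ _).symm))
  · rw [norm_mul, mul_comm]; gcongr; exact hE _
  · rw [norm_mul, mul_comm]; gcongr; exact hE _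

lemma abel_mono {a : ℕ → ℂ} {E : ℝ} (hE : ∀ k, ‖∑ n ∈ Finset.range k, a n‖ ≤ E) {g : ℕ → ℝ} (hg : Antitone g)
    (hg0 : ∀ n, 0 ≤ g n) (M : ℕ) : ‖∑ n ∈ Finset.range M, a n * g n‖ ≤ E * g 0 := by
  refine (abel_var hE (g := fun n => (g n : ℂ)) M).trans_eq ?_
  have : ∑ n ∈ Finset.range (M - 1), ‖((g (n + 1) : ℂ)) - g n‖ = g 0 - g (M - 1) := by
    rw [← Finset.sum_range_sub']
    refine Finset.sum_congr rfl fun n _ => ?_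
    rw [← ofReal_sub, norm_real, Real.norm_eq_abs, abs_sub_comm, abs_of_nonneg (sub_nonneg.2 (hg (Nat.le_succ n)))]
  rw [this, norm_real, Real.norm_of_nonneg (hg0 _)]; ring

lemma geo_amgm {y : ℝ} (hy : 0 ≤ y) (k : ℕ) : k * y ^ k ≤ y * ∑ i ∈ Finset.range k, y ^ (2 * i) := by
  induction k using Nat.twoStepInduction with
  | zero => simp
  | one => simp
  | more k ih _ =>
    rw [Finset.sum_range_succ, Finset.sum_range_succ']
    have e : ∑ i ∈ Finset.range k, y ^ (2 * (i + 1)) = y ^ 2 * ∑ i ∈ Finset.range k, y ^ (2 * i) := by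
      rw [Finset.mul_sum]; exact Finset.sum_congr rfl fun i _ => by ring
    rw [e]
    have h1 : 2 * y ^ (k + 1) ≤ 1 + y ^ (2 * (k + 1)) := by
      have := sq_nonneg (1 - y ^ (k + 1)); rw [mul_comm 2 (k + 1), pow_mul]; nlinarith
    have h2 := mul_le_mul_of_nonneg_left ih (sq_nonneg y)
    have h3 := mul_le_mul_of_nonneg_left h1 hy
    push_cast
    simp only [mul_zero, pow_zero]
    have e1 : ((k : ℝ) + 2) * y ^ (k + 2) = y ^ 2 * (k * y ^ k) + y * (2 * y ^ (k + 1)) := by ring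
    rw [e1]
    calc _ ≤ _ := add_le_add h2 h3
      _ = _ := by ring

lemma monsky_ineq {x : ℝ} (hx0 : 0 < x) (hx1 : x < 1) (n : ℕ) :
    (n + 1) * (n + 2) * x ^ (n + 1) * (1 - x) ^ 2 ≤ (1 - x ^ (n + 1)) * (1 - x ^ (n + 2)) := by
  set y := Real.sqrt x with hy
  have hy0 : 0 < y := Real.sqrt_pos.2 hx0
  have hyx : y ^ 2 = x := Real.sq_sqrt hx0.le
  have hy1 : y ≤ 1 := by rw [hy]; exact Real.sqrt_le_one.2 hx1.le
  have h1 := geo_amgm hy0.le (n + 1)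
  have h2 := geo_amgm hy0.le (n + 2)
  simp only [pow_mul, hyx] at h1 h2
  have g1 := geom_sum_mul_neg x (n + 1)
  have g2 := geom_sum_mul_neg x (n + 2)
  set S1 := ∑ i ∈ Finset.range (n + 1), x ^ i
  set S2 := ∑ i ∈ Finset.range (n + 2), x ^ i
  rw [← g1, ← g2]
  have h3 := mul_le_mul h1 h2 (by positivity) (by positivity)
  push_cast at h3
  have h4 : (n + 1) * (n + 2) * y ^ (2 * n + 1) ≤ S1 * S2 := by
    have : y ^ 2 * ((n + 1) * (n + 2) * y ^ (2 * n + 1)) ≤ y ^ 2 * (S1 * S2) := by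
      calc _ = ((n : ℝ) + 1) * y ^ (n + 1) * ((n + 2) * y ^ (n + 2)) := by ring
        _ ≤ _ := h3
        _ = _ := by ring
    exact le_of_mul_le_mul_left this (by positivity)
  have h5 : x ^ (n + 1) ≤ y ^ (2 * n + 1) := by
    rw [← hyx, ← pow_mul]; exact pow_le_pow_of_le_one hy0.le hy1 (by omega)
  have h6 : ((n : ℝ) + 1) * (n + 2) * x ^ (n + 1) ≤ S1 * S2 := le_trans (by gcongr) h4
  calc _ ≤ S1 * S2 * (1 - x) ^ 2 := by gcongr
    _ = _ := by ring

noncomputable def mkt (x : ℝ) (n : ℕ) : ℝ := 1 / ((n + 1) * (1 - x)) - x ^ (n + 1) / (1 - x ^ (n + 1))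

lemma mkt_anti {x : ℝ} (hx0 : 0 < x) (hx1 : x < 1) : Antitone (mkt x) := by
  refine antitone_nat_of_succ_le fun n => ?_
  have h := monsky_ineq hx0 hx1 n
  have p1 : 0 < 1 - x ^ (n + 1) := sub_pos.2 (pow_lt_one₀ hx0.le hx1 (by omega))
  have p2 : 0 < 1 - x ^ (n + 2) := sub_pos.2 (pow_lt_one₀ hx0.le hx1 (by omega))
  have p3 : 0 < 1 - x := by linarith
  unfold mkt
  rw [← sub_nonneg]
  have : 1 / ((n + 1) * (1 - x)) - x ^ (n + 1) / (1 - x ^ (n + 1)) -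
    (1 / (((n + 1 : ℕ) + 1) * (1 - x)) - x ^ (n + 1 + 1) / (1 - x ^ (n + 1 + 1))) =
    ((1 - x ^ (n + 1)) * (1 - x ^ (n + 2)) - (n + 1) * (n + 2) * x ^ (n + 1) * (1 - x) ^ 2) /
     ((n + 1) * (n + 2) * (1 - x) * ((1 - x ^ (n + 1)) * (1 - x ^ (n + 2)))) := by
    push_cast
    rw [show n + 1 + 1 = n + 2 by ring, show (n : ℝ) + 1 + 1 = n + 2 by ring]
    field_simp
    ring
  rw [this]
  exact div_nonneg (by linarith) (by positivity)

lemma mkt_nonneg {x : ℝ} (hx0 : 0 < x) (hx1 : x < 1) (n : ℕ) : 0 ≤ mkt x n := by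
  have p1 : 0 < 1 - x ^ (n + 1) := sub_pos.2 (pow_lt_one₀ hx0.le hx1 (by omega))
  have p3 : 0 < 1 - x := by linarith
  unfold mkt
  rw [sub_nonneg, div_le_div_iff₀ p1 (by positivity), one_mul]
  have g1 := geom_sum_mul_neg x (n + 1)
  rw [← g1]
  have : ((n : ℝ) + 1) * x ^ (n + 1) ≤ ∑ i ∈ Finset.range (n + 1), x ^ i := by
    have := Finset.card_nsmul_le_sum (Finset.range (n + 1)) (fun i => x ^ i) (x ^ (n + 1)) fun i hi =>
      pow_le_pow_of_le_one hx0.le hx1.le (by simp at hi; omega)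
    simpa using this
  nlinarith

lemma chi_partial {m : ℕ} [NeZero m] {χ : DirichletCharacter ℂ m} (hχ : χ ≠ 1) (j k : ℕ) :
    ‖∑ n ∈ Finset.range k, χ ((n + j : ℕ) : ZMod m)‖ ≤ m := by
  have := periodic_sum_bound (a := fun n => χ ((n + j : ℕ) : ZMod m)) (B := 1) (Nat.pos_of_ne_zero (NeZero.ne m))
    (fun n => by push_cast; simp) ?_ (fun n => DirichletCharacter.norm_le_one χ _) k
  · simpa using this
  · have h := sum_range_zmod m (fun x : ZMod m => χ (x + j))
    push_cast
    rw [h, Fintype.sum_equiv (Equiv.addRight (j : ZMod m)) (fun x => χ (x + j)) χ fun x => rfl]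
    exact MulChar.sum_eq_zero_of_ne_one hχ

lemma L_one_tendsto {m : ℕ} [NeZero m] {χ : DirichletCharacter ℂ m} (hχ : χ ≠ 1) :
    Tendsto (fun M : ℕ => ∑ n ∈ Finset.range M, χ ((n + 1 : ℕ) : ZMod m) * ((1 / (n + 1) : ℝ) : ℂ)) atTop (𝓝 (χ.LFunction 1)) := by
  have key : ∀ M : ℕ, ‖χ.LFunction 1 - ∑ n ∈ Finset.range M, χ ((n + 1 : ℕ) : ZMod m) * ((1 / (n + 1) : ℝ) : ℂ)‖ ≤ m * (1 / (M + 1)) := by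
    intro M
    have h1 : ∀ s : ℝ, 1 < s → ‖χ.LFunction s - ∑ n ∈ Finset.range M, χ ((n + 1 : ℕ) : ZMod m) * (((n + 1 : ℝ) ^ (-s) : ℝ) : ℂ)‖ ≤
        m * (1 / (M + 1)) := by
      intro s hs
      have hs' : 1 < (s : ℂ).re := by simpa
      have hsum := DirichletCharacter.LSeriesSummable_of_one_lt_re χ hs'
      have hsum1 := (hasSum_nat_add_iff' 1).2 hsum.hasSum
      have e : ∀ n : ℕ, LSeries.term (fun n => χ n) s (n + 1) = χ ((n + 1 : ℕ) : ZMod m) * (((n + 1 : ℝ) ^ (-s) : ℝ) : ℂ) := by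
        intro n
        rw [LSeries.term_of_ne_zero (by omega), ofReal_cpow (by positivity), ofReal_neg, cpow_neg, div_eq_mul_inv]
        push_cast; rfl
      simp only [e, Finset.range_one, Finset.sum_singleton, LSeries.term_zero, sub_zero] at hsum1
      rw [DirichletCharacter.LFunction_eq_LSeries χ hs']
      have ht := hsum1.tendsto_sum_nat.sub_const (∑ n ∈ Finset.range M, χ ((n + 1 : ℕ) : ZMod m) * (((n + 1 : ℝ) ^ (-s) : ℝ) : ℂ))
      refine le_of_tendsto ht.norm ?_
      filter_upwards [eventually_ge_atTop M] with M' hM'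
      obtain ⟨k, rfl⟩ := Nat.exists_eq_add_of_le hM'
      rw [Finset.sum_range_add, add_sub_cancel_left]
      have := abel_mono (a := fun n => χ ((n + (M + 1) : ℕ) : ZMod m)) (chi_partial hχ (M + 1))
        (g := fun n => ((M + n : ℕ) + 1 : ℝ) ^ (-s)) ?_ (fun n => by positivity) k
      · refine le_trans (le_of_eq ?_) (this.trans ?_)
        · congr 1
          refine Finset.sum_congr rfl fun n _ => ?_
          rw [show M + n + 1 = n + (M + 1) by ring]
        · gcongr
          rw [add_zero, one_div, ← Real.rpow_neg_one]
          exact Real.rpow_le_rpow_of_exponent_le (by simp) (by linarith)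
      · intro i j hij
        refine Real.rpow_le_rpow_of_nonpos (by positivity) ?_ (by linarith)
        have : ((M + i : ℕ) : ℝ) ≤ (M + j : ℕ) := by exact_mod_cast (by omega)
        linarith
    have hc : Tendsto (fun s : ℝ => ‖χ.LFunction s - ∑ n ∈ Finset.range M, χ ((n + 1 : ℕ) : ZMod m) * (((n + 1 : ℝ) ^ (-s) : ℝ) : ℂ)‖)
        (𝓝[>] 1) (𝓝 ‖χ.LFunction ((1 : ℝ) : ℂ) - ∑ n ∈ Finset.range M, χ ((n + 1 : ℕ) : ZMod m) * (((n + 1 : ℝ) ^ (-(1 : ℝ)) : ℝ) : ℂ)‖) := by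
      refine Tendsto.mono_left (ContinuousAt.tendsto ?_) nhdsWithin_le_nhds
      refine ContinuousAt.norm (ContinuousAt.sub ?_ (tendsto_finsetSum _ fun n _ => ?_))
      · exact ((DirichletCharacter.differentiable_LFunction hχ).continuous.comp continuous_ofReal).continuousAt
      · refine Tendsto.const_mul _ ?_
        refine (continuous_ofReal.comp ?_).continuousAt
        exact Continuous.rpow continuous_const continuous_neg fun _ => Or.inl (by positivity)
    have := le_of_tendsto hc (by filter_upwards [self_mem_nhdsWithin] with s hs using h1 s hs)
    simpa [Real.rpow_neg_one] using this
  rw [tendsto_iff_norm_sub_tendsto_zero]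
  refine squeeze_zero (g := fun M : ℕ => (m : ℝ) * (1 / (M + 1))) (fun _ => norm_nonneg _) (fun M => by rw [norm_sub_rev]; exact key M) ?_
  simpa using tendsto_one_div_add_atTop_nhds_zero_nat.const_mul (m : ℝ)

end

section
open Complex Metric Set Filter Topology MeasureTheory

lemma zetaMul_apply' {m : ℕ} (χ : DirichletCharacter ℂ m) (n : ℕ) : χ.zetaMul n = ∑ d ∈ n.divisors, χ d := by
  rw [DirichletCharacter.zetaMul, ArithmeticFunction.coe_zeta_mul_apply]
  refine Finset.sum_congr rfl fun d hd => ?_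
  exact if_neg (Nat.pos_of_mem_divisors hd).ne'

open scoped ComplexOrder in
lemma zetaMul_sq {m : ℕ} [NeZero m] {χ : DirichletCharacter ℂ m} (hχ : χ ^ 2 = 1) {k : ℕ} (hk : k ≠ 0) :
    1 ≤ (χ.zetaMul (k ^ 2)).re ∧ ∀ n, 0 ≤ (χ.zetaMul n).re ∧ ((χ.zetaMul n).re : ℂ) = χ.zetaMul n := by
  have h0 : ∀ n, 0 ≤ χ.zetaMul n := DirichletCharacter.zetaMul_nonneg hχ
  have hp : ∀ p : ℕ, p.Prime → ∀ j, Even j → 1 ≤ χ.zetaMul (p ^ j) := by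
    intro p hp j hj
    simp only [zetaMul_apply', Nat.sum_divisors_prime_pow hp, Nat.cast_pow, map_pow]
    have hodd : ¬ Even (j + 1) := by simpa [Nat.even_add_one] using hj
    rcases MulChar.isQuadratic_iff_sq_eq_one.mpr hχ p with h | h | h
    · rw [Finset.sum_range_succ', h]; simp
    · simp [h]
    · simp only [h, neg_one_geom_sum, hodd, ↓reduceIte, le_refl]
  have h1 : 1 ≤ χ.zetaMul (k ^ 2) := by
    rw [χ.isMultiplicative_zetaMul.multiplicative_factorization _ (pow_ne_zero 2 hk)]
    refine Finset.prod_induction _ (fun z : ℂ => 1 ≤ z) (fun a b ha hb => one_le_mul_of_one_le_of_one_le ha hb) le_rfl fun p hp' => ?_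
    refine hp p (Nat.prime_of_mem_primeFactors hp') _ ?_
    rw [Nat.factorization_pow]; simp
  refine ⟨by simpa using (Complex.le_def.1 h1).1, fun n => ⟨by simpa using (Complex.le_def.1 (h0 n)).1, ?_⟩⟩
  exact Complex.ext (by simp) (by simpa using (Complex.le_def.1 (h0 n)).2)

lemma lam_tail {x : ℝ} (hx0 : 0 < x) (hx1 : x < 1) (M d : ℕ) :
    |x ^ (d + 1) / (1 - x ^ (d + 1)) - ∑ n ∈ (Finset.Ioc 0 M).filter ((d + 1) ∣ ·), x ^ n| ≤ x ^ M / (1 - x) := by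
  set K := M / (d + 1)
  have hK : M < (d + 1) * (K + 1) := Nat.lt_mul_div_succ M (by omega)
  have hK2 : (d + 1) * K ≤ M := Nat.mul_div_le M (d + 1)
  have e : (Finset.Ioc 0 M).filter ((d + 1) ∣ ·) = (Finset.range K).image (fun k => (d + 1) * (k + 1)) := by
    ext n
    simp only [Finset.mem_filter, Finset.mem_Ioc, Finset.mem_image, Finset.mem_range]
    constructor
    · rintro ⟨⟨h1, h2⟩, ⟨k, rfl⟩⟩
      have : 0 < k := Nat.pos_of_mul_pos_left h1
      refine ⟨k - 1, ?_, by rw [Nat.sub_add_cancel this]⟩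
      have : k < K + 1 := lt_of_mul_lt_mul_left (h2.trans_lt hK) (Nat.zero_le _)
      omega
    · rintro ⟨k, hk, rfl⟩
      exact ⟨⟨by positivity, (Nat.mul_le_mul_left _ (by omega)).trans hK2⟩, dvd_mul_right _ _⟩
  rw [e, Finset.sum_image (fun a _ b _ h => by simpa using h)]
  set y := x ^ (d + 1) with hy
  have hy1 : y < 1 := pow_lt_one₀ hx0.le hx1 (by omega)
  have hyx : y ≤ x := by simpa [hy] using pow_le_pow_of_le_one hx0.le hx1.le (show 1 ≤ d + 1 by omega)
  have g := geom_sum_mul_neg y K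
  have e2 : ∑ k ∈ Finset.range K, x ^ ((d + 1) * (k + 1)) = y * ∑ k ∈ Finset.range K, y ^ k := by
    rw [Finset.mul_sum]; exact Finset.sum_congr rfl fun k _ => by rw [pow_mul, ← hy]; ring
  have e3 : y / (1 - y) - y * ∑ k ∈ Finset.range K, y ^ k = y ^ (K + 1) / (1 - y) := by
    rw [eq_div_iff (by linarith), sub_mul, div_mul_cancel₀ _ (by linarith), mul_assoc, g]; ring
  rw [e2, e3, abs_of_nonneg (div_nonneg (by positivity) (by linarith))]
  have : y ^ (K + 1) ≤ x ^ M := by rw [hy, ← pow_mul]; exact pow_le_pow_of_le_one hx0.le hx1.le hK.le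
  have : 0 < 1 - x := by linarith
  gcongr

lemma L_one_lower {m : ℕ} [NeZero m] {χ : DirichletCharacter ℂ m} (hχ : χ ≠ 1) (h2 : χ ^ 2 = 1) :
    1 / (32 * m) ≤ ‖χ.LFunction 1‖ := by
  have hm : (1 : ℝ) ≤ m := by exact_mod_cast Nat.pos_of_ne_zero (NeZero.ne m)
  set J : ℕ := 4 * m with hJ
  have hJ1 : (1 : ℝ) ≤ J := by rw [hJ]; push_cast; linarith
  set x : ℝ := 1 - 1 / (2 * (J : ℝ) ^ 2) with hx
  have hx' : 1 / (2 * (J : ℝ) ^ 2) ≤ 1 / 2 := by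
    apply one_div_le_one_div_of_le (by norm_num); nlinarith
  have hx0 : 0 < x := by linarith
  have hx1 : x < 1 := by have : 0 < 1 / (2 * (J : ℝ) ^ 2) := by positivity
                         linarith
  have hxJ : 1 / 2 ≤ x ^ (J ^ 2) := by
    have := one_add_mul_le_pow (a := -(1 / (2 * (J : ℝ) ^ 2))) (by linarith) (J ^ 2)
    rw [← sub_eq_add_neg, ← hx] at this
    refine le_trans (le_of_eq ?_) this
    push_cast; field_simp; norm_num
  have key : ∀ M : ℕ, J ^ 2 ≤ M → J * x ^ (J ^ 2) ≤
      ‖∑ n ∈ Finset.range M, χ ((n + 1 : ℕ) : ZMod m) * ((1 / (n + 1) : ℝ) : ℂ)‖ * (1 / (1 - x)) + m + M * x ^ M * (1 / (1 - x)) := by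
    intro M hM
    set LM := ∑ n ∈ Finset.range M, χ ((n + 1 : ℕ) : ZMod m) * ((1 / (n + 1) : ℝ) : ℂ) with hLM
    set G := ∑ n ∈ Finset.Ioc 0 M, χ.zetaMul n * ((x ^ n : ℝ) : ℂ) with hG
    have hGlow : J * x ^ (J ^ 2) ≤ ‖G‖ := by
      refine le_trans ?_ (Complex.re_le_norm G)
      rw [hG, Complex.re_sum]
      have h3 : ∑ n ∈ (Finset.Ioc 0 J).image (fun k => k ^ 2), (χ.zetaMul n * ((x ^ n : ℝ) : ℂ)).re ≤
          ∑ n ∈ Finset.Ioc 0 M, (χ.zetaMul n * ((x ^ n : ℝ) : ℂ)).re := by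
        refine Finset.sum_le_sum_of_subset_of_nonneg ?_ fun n _ _ => ?_
        · intro n hn
          obtain ⟨k, hk, rfl⟩ := Finset.mem_image.1 hn
          rw [Finset.mem_Ioc] at hk ⊢
          exact ⟨pow_pos hk.1 2, (Nat.pow_le_pow_left hk.2 2).trans hM⟩
        · rw [Complex.re_mul_ofReal]; exact mul_nonneg ((zetaMul_sq h2 one_ne_zero).2 n).1 (by positivity)
      refine le_trans ?_ h3
      rw [Finset.sum_image (fun a _ b _ h => Nat.pow_left_injective (n := 2) (by norm_num) h)]
      have := Finset.card_nsmul_le_sum (Finset.Ioc 0 J) (fun k => (χ.zetaMul (k ^ 2) * ((x ^ (k ^ 2) : ℝ) : ℂ)).re) (x ^ (J ^ 2)) ?_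
      · simpa using this
      · intro k hk
        rw [Finset.mem_Ioc] at hk
        rw [Complex.re_mul_ofReal]
        have h5 := (zetaMul_sq h2 (k := k) (by omega)).1
        have h6 : x ^ (J ^ 2) ≤ x ^ (k ^ 2) := pow_le_pow_of_le_one hx0.le hx1.le (Nat.pow_le_pow_left hk.2 2)
        nlinarith [pow_pos hx0 (k ^ 2)]
    refine hGlow.trans ?_
    have hGeq : G = ∑ d ∈ Finset.range M, χ ((d + 1 : ℕ) : ZMod m) * ((∑ n ∈ (Finset.Ioc 0 M).filter ((d + 1) ∣ ·), x ^ n : ℝ) : ℂ) := by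
      simp only [hG, zetaMul_apply', Finset.sum_mul, ofReal_sum, Finset.mul_sum]
      have := Finset.sum_image (s := Finset.range M) (g := fun d => d + 1)
        (f := fun d => ∑ n ∈ (Finset.Ioc 0 M).filter (d ∣ ·), χ (d : ZMod m) * ((x ^ n : ℝ) : ℂ)) (fun a _ b _ h => by simpa using h)
      rw [← this]
      refine Finset.sum_comm' fun n d => ?_
      simp only [Finset.mem_Ioc, Nat.mem_divisors, Finset.mem_filter, Finset.mem_image, Finset.mem_range]
      constructor
      · rintro ⟨⟨h1, h2⟩, h3, h4⟩
        exact ⟨⟨⟨h1, h2⟩, h3⟩, d - 1, by have := Nat.le_of_dvd h1 h3; have := Nat.pos_of_dvd_of_pos h3 h1; omega⟩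
      · rintro ⟨⟨⟨h1, h2⟩, h3⟩, -⟩
        exact ⟨⟨h1, h2⟩, h3, by omega⟩
    have hT := abel_mono (a := fun n => χ ((n + 1 : ℕ) : ZMod m)) (chi_partial hχ 1) (mkt_anti hx0 hx1) (mkt_nonneg hx0 hx1) M
    have hmk0 : mkt x 0 = 1 := by
      have : 1 - x ≠ 0 := by linarith
      simp [mkt]; field_simp
    rw [hmk0, mul_one] at hT
    have hdec : G = LM * ((1 / (1 - x) : ℝ) : ℂ) - ∑ n ∈ Finset.range M, χ ((n + 1 : ℕ) : ZMod m) * (mkt x n : ℂ) -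
        ∑ d ∈ Finset.range M, χ ((d + 1 : ℕ) : ZMod m) * ((x ^ (d + 1) / (1 - x ^ (d + 1)) - ∑ n ∈ (Finset.Ioc 0 M).filter ((d + 1) ∣ ·), x ^ n : ℝ) : ℂ) := by
      rw [hGeq, hLM, Finset.sum_mul, ← Finset.sum_sub_distrib, ← Finset.sum_sub_distrib]
      refine Finset.sum_congr rfl fun d _ => ?_
      rw [mul_assoc, ← ofReal_mul, ← mul_sub, ← mul_sub, ← ofReal_sub, ← ofReal_sub]
      congr 2
      rw [mkt, one_div_mul_one_div]; ring
    rw [hdec]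
    refine (norm_sub_le _ _).trans (add_le_add ((norm_sub_le _ _).trans (add_le_add ?_ hT)) ?_)
    · rw [norm_mul, norm_real, Real.norm_of_nonneg (one_div_nonneg.2 (by linarith))]
    · refine (norm_sum_le_of_le (Finset.range M) (n := fun _ => x ^ M / (1 - x)) fun d _ => ?_).trans_eq ?_
      · rw [norm_mul, norm_real, Real.norm_eq_abs]
        have := lam_tail hx0 hx1 M d
        have h1 := DirichletCharacter.norm_le_one χ ((d + 1 : ℕ) : ZMod m)
        calc _ ≤ 1 * (x ^ M / (1 - x)) := by gcongr
          _ = _ := one_mul _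
      · simp; ring
  have hlim : Tendsto (fun M : ℕ => ‖∑ n ∈ Finset.range M, χ ((n + 1 : ℕ) : ZMod m) * ((1 / (n + 1) : ℝ) : ℂ)‖ * (1 / (1 - x)) + m + M * x ^ M * (1 / (1 - x))) atTop
      (𝓝 (‖χ.LFunction 1‖ * (1 / (1 - x)) + m + 0 * (1 / (1 - x)))) := by
    refine (((L_one_tendsto hχ).norm.mul_const _).add_const _).add (Tendsto.mul_const _ ?_)
    exact tendsto_self_mul_const_pow_of_lt_one hx0.le hx1
  have := ge_of_tendsto hlim (by filter_upwards [eventually_ge_atTop (J ^ 2)] with M hM using key M hM)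
  have e : 1 / (1 - x) = 2 * (J : ℝ) ^ 2 := by rw [hx, sub_sub_cancel, one_div_one_div]
  rw [e] at this
  have hJm : (J : ℝ) = 4 * m := by rw [hJ]; push_cast; ring
  have h7 : (J : ℝ) * (1 / 2) ≤ J * x ^ (J ^ 2) := by gcongr
  rw [div_le_iff₀ (by positivity)]
  rw [hJm] at this h7
  have h8 : 2 * (m : ℝ) ≤ ‖χ.LFunction 1‖ * (2 * (4 * m) ^ 2) + m := by linarith
  have h9 : (m : ℝ) * 1 ≤ m * (‖χ.LFunction 1‖ * (32 * m)) := by nlinarith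
  exact le_of_mul_le_mul_left h9 (by linarith)

lemma bad_lower {m : ℕ} [NeZero m] {χ : DirichletCharacter ℂ m} (hχ : χ ≠ 1) (h2 : χ ^ 2 = 1) {β : ℝ} (hβ : 3 / 4 ≤ β)
    (hβ1 : β < 1) (h0 : Lent χ (β : ℂ) = 0) : 1 / (25600 * (m : ℝ) ^ 2) ≤ 1 - β := by
  have hm : (1 : ℝ) ≤ m := by exact_mod_cast Nat.pos_of_ne_zero (NeZero.ne m)
  have hL : Lent χ 1 = χ.LFunction 1 := by simp [Lent, hχ]
  have h1 := L_one_lower hχ h2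
  have hb : ∀ s ∈ ball (1 : ℂ) (1 / 2), ‖Lent χ s‖ ≤ 10 * m * (3 : ℝ) ^ 2 := by
    intro s hs
    rw [mem_ball_iff_norm] at hs
    have hre : 1 / 2 ≤ s.re := by
      have := (abs_le.1 ((Complex.abs_re_le_norm (s - 1)).trans hs.le)).1
      simp at this; linarith
    refine (Lent_bound χ hre).trans ?_
    have : ‖s‖ ≤ ‖s - 1‖ + 1 := by simpa using norm_add_le (s - 1) 1
    gcongr; linarith
  have hd := norm_dslope_le_div_of_mapsTo_ball (f := Lent χ) (c := (1 : ℂ)) (R₁ := 1 / 2) (R₂ := 200 * m) (z := (β : ℂ))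
    (Lent_differentiable χ).differentiableOn ?_ ?_
  · rw [dslope_of_ne _ (by exact_mod_cast hβ1.ne), slope_def_module, h0, zero_sub, norm_smul, norm_neg, hL, norm_inv] at hd
    have e : ‖(β : ℂ) - 1‖ = 1 - β := by
      rw [← ofReal_one, ← ofReal_sub, norm_real, Real.norm_eq_abs, abs_sub_comm, abs_of_nonneg (by linarith)]
    rw [e, ← div_eq_inv_mul, div_le_iff₀ (by linarith)] at hd
    have h3 := h1.trans hd
    rw [div_le_iff₀ (by positivity)] at h3 ⊢
    nlinarith
  · intro s hs
    rw [mem_closedBall, dist_eq_norm]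
    have := hb s hs
    have h4 := hb 1 (mem_ball_self (by norm_num))
    refine (norm_sub_le _ _).trans ?_
    linarith
  · rw [mem_ball_iff_norm, ← ofReal_one, ← ofReal_sub, norm_real, Real.norm_eq_abs, abs_lt]
    constructor <;> linarith

end

section
open Complex Metric Set Filter Topology MeasureTheory

noncomputable def dens (ε β : ℝ) (i : ℕ) : ℝ := 1 - ε * (i : ℝ) ^ (β - 1)

def PNTW (Q : ℝ) (N W : ℕ) (ε β : ℝ) (k B : ℕ) : Prop := ∀ M : ℕ, 0 < M → W ∣ M → (M : ℝ) ≤ Q ^ k →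
  ∀ s : ℕ, s.Coprime M → s ≡ 1 [MOD W] → ∀ x ≤ 2 * N,
  |∑ n ∈ (Finset.Icc 1 x).filter (· ≡ s [MOD M]), ArithmeticFunction.vonMangoldt n -
    (∑ n ∈ Finset.Icc 1 x, dens ε β n) / M.totient| ≤ N / Q ^ B

lemma psi_orth {M : ℕ} [NeZero M] {E : ℝ} (e b : DirichletCharacter ℂ M → ℝ) (x : ℕ)
    (hE : ∀ χ, ‖∑ n ∈ Finset.Icc 1 x, ca χ (e χ) (b χ) n‖ ≤ E) {s : ℕ} (hs : s.Coprime M) (D : ℕ → ℝ)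
    (hD : ∀ n ∈ Finset.Icc 1 x, (D n : ℂ) = ∑ χ : DirichletCharacter ℂ M, χ (s : ZMod M)⁻¹ * (e χ * (n : ℂ) ^ ((b χ - 1 : ℝ) : ℂ))) :
    |∑ n ∈ (Finset.Icc 1 x).filter (· ≡ s [MOD M]), ArithmeticFunction.vonMangoldt n -
    (∑ n ∈ Finset.Icc 1 x, D n) / M.totient| ≤ E := by
  have hu : IsUnit (s : ZMod M) := (ZMod.isUnit_iff_coprime _ _).2 hs
  have hφ : (0 : ℝ) < M.totient := by exact_mod_cast Nat.totient_pos.2 (Nat.pos_of_ne_zero (NeZero.ne M))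
  have key : ((M.totient * ∑ n ∈ (Finset.Icc 1 x).filter (· ≡ s [MOD M]), ArithmeticFunction.vonMangoldt n -
      ∑ n ∈ Finset.Icc 1 x, D n : ℝ) : ℂ) = ∑ χ : DirichletCharacter ℂ M, χ (s : ZMod M)⁻¹ * ∑ n ∈ Finset.Icc 1 x, ca χ (e χ) (b χ) n := by
    simp only [Finset.mul_sum, ca, mul_sub, Finset.sum_sub_distrib]
    rw [Finset.sum_comm, Finset.sum_comm (s := Finset.univ) (t := Finset.Icc 1 x)]
    push_cast
    rw [Finset.sum_congr rfl hD]
    congr 1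
    swap; · simp only [ofReal_sub, ofReal_one]
    rw [Finset.sum_filter]
    refine Finset.sum_congr rfl fun n _ => ?_
    have := DirichletCharacter.sum_char_inv_mul_char_eq ℂ hu (n : ZMod M)
    simp only [← mul_assoc, ← Finset.sum_mul]
    rw [this]
    by_cases h : n ≡ s [MOD M]
    · simp [h, ((ZMod.natCast_eq_natCast_iff _ _ _).2 h).symm]
    · rw [if_neg h, if_neg (fun h' => h ((ZMod.natCast_eq_natCast_iff _ _ _).1 h'.symm))]; simp
  have hcard : (Finset.univ : Finset (DirichletCharacter ℂ M)).card = M.totient := by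
    rw [Finset.card_univ, ← Nat.card_eq_fintype_card, DirichletCharacter.card_eq_totient_of_hasEnoughRootsOfUnity]
  have h2 : |M.totient * ∑ n ∈ (Finset.Icc 1 x).filter (· ≡ s [MOD M]), ArithmeticFunction.vonMangoldt n -
      ∑ n ∈ Finset.Icc 1 x, D n| ≤ M.totient * E := by
    rw [← Real.norm_eq_abs, ← norm_real, key]
    refine (norm_sum_le_of_le (n := fun _ => E) _ fun χ _ => ?_).trans_eq ?_
    · rw [norm_mul]
      have h1 := DirichletCharacter.norm_le_one χ (s : ZMod M)⁻¹
      have := mul_le_mul h1 (hE χ) (norm_nonneg _) zero_le_one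
      simpa using this
    · rw [Finset.sum_const, hcard, nsmul_eq_mul]
  rw [← mul_le_mul_iff_right₀ hφ, ← abs_of_pos hφ, ← abs_mul, abs_of_pos hφ, mul_sub, mul_div_cancel₀ _ hφ.ne']
  exact h2

lemma bad_lift {q M : ℕ} [NeZero q] [NeZero M] (h : q ∣ M) {χ : DirichletCharacter ℂ q} {κ β : ℝ} (hb : BadZ κ χ β) :
    BadZ κ (DirichletCharacter.changeLevel h χ) β := by
  obtain ⟨h1, h2, h3⟩ := hb
  have h1' : DirichletCharacter.changeLevel h χ ≠ 1 := h1 ∘ (DirichletCharacter.changeLevel_eq_one_iff h).mp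
  refine ⟨h1', ?_, h3⟩
  unfold Lent at h2 ⊢
  rw [if_neg h1] at h2
  rw [if_neg h1', DirichletCharacter.LFunction_changeLevel h χ (Or.inl h1), h2, zero_mul]

theorem pnt_W (K B kA : ℕ) (hk : kA ≤ K) : ∀ᶠ Q : ℝ in atTop, ∀ N : ℕ, Real.log N = Real.log Q ^ 3 →
    PNTW Q N 2 0 1 kA B ∨ ∃ (W : ℕ) (β : ℝ), 0 < W ∧ Even W ∧ (W : ℝ) ≤ 2 * Q ^ kA ∧ 3 / 4 ≤ β ∧ β < 1 ∧
      1 / (25600 * (Q ^ kA) ^ 2) ≤ 1 - β ∧ PNTW Q N W 1 β K B := by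
  classical
  obtain ⟨b, hb, h⟩ := pnt_main K B
  filter_upwards [h, ev_const 2] with Q hQ hQ2 N hN
  have hQ := hQ N hN
  have hkQ : Q ^ kA ≤ Q ^ K := pow_le_pow_right₀ (by linarith) hk
  by_cases hbad : ∃ (q : ℕ) (_ : NeZero q) (χ : DirichletCharacter ℂ q) (β : ℝ), (q : ℝ) ≤ Q ^ kA ∧ BadZ (b / Real.log Q) χ β
  · right
    obtain ⟨q, _, χ, β, hq, hB⟩ := hbad
    obtain ⟨-, -, h3⟩ := hQ q (hq.trans hkQ)
    obtain ⟨hs, hβ, hβ1, -⟩ := h3 χ β hB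
    have hq0 := Nat.pos_of_ne_zero (NeZero.ne q)
    have hlow := bad_lower hB.1 hs hβ hβ1 hB.2.1
    refine ⟨2 * q, β, by omega, even_two_mul q, by push_cast; linarith, hβ, hβ1, le_trans ?_ hlow, ?_⟩
    · have : (0 : ℝ) < q := by exact_mod_cast hq0
      gcongr
    · intro M hM0 hWM hMQ s hs hs1 x hx
      haveI : NeZero M := ⟨hM0.ne'⟩
      have hqM : q ∣ M := (dvd_mul_left q 2).trans hWM
      set χ' := DirichletCharacter.changeLevel hqM χ with hχ'
      have hB' : BadZ (b / Real.log Q) χ' β := bad_lift hqM hB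
      obtain ⟨g1, g2, g3⟩ := hQ M hMQ
      obtain ⟨-, -, -, g4, g5⟩ := g3 χ' β hB'
      refine psi_orth (fun ψ => if ψ = 1 then 1 else if ψ = χ' then -1 else 0) (fun ψ => if ψ = χ' then β else 1) x (fun ψ => ?_) hs _ ?_
      · by_cases e1 : ψ = 1
        · subst e1; simpa [Ne.symm hB'.1] using g1 x hx
        · by_cases e2 : ψ = χ'
          · subst e2; simpa [e1] using g4 x hx
          · simp only [e1, e2, if_false]
            exact g2 ψ e1 (fun β' hb' => e2 (g5 ψ β' hb').1) x hx
      · intro n hn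
        have hu : IsUnit (s : ZMod M) := (ZMod.isUnit_iff_coprime _ _).2 hs
        have hcs : χ' (s : ZMod M)⁻¹ = 1 := by
          have h1 : χ' (s : ZMod M) = 1 := by
            have := DirichletCharacter.changeLevel_eq_cast_of_dvd χ hqM hu.unit
            rw [IsUnit.unit_spec] at this
            rw [hχ', this]
            have : ((s : ZMod M).cast : ZMod q) = 1 := by
              rw [ZMod.cast_natCast hqM]
              have := (ZMod.natCast_eq_natCast_iff s 1 q).2 (hs1.of_dvd (dvd_mul_left q 2))
              simpa using this
            rw [this, map_one]
          have h2 : χ' (s : ZMod M)⁻¹ * χ' (s : ZMod M) = 1 := by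
            rw [← map_mul, ZMod.inv_mul_of_unit _ hu, map_one]
          rwa [h1, mul_one] at h2
        have hcs1 : (1 : DirichletCharacter ℂ M) (s : ZMod M)⁻¹ = 1 := by
          refine MulChar.one_apply ?_
          exact ⟨hu.unit⁻¹, by simp [ZMod.inv_coe_unit, ← ZMod.inv_coe_unit]⟩
        have hne : (1 : DirichletCharacter ℂ M) ≠ χ' := Ne.symm hB'.1
        rw [Fintype.sum_eq_add (1 : DirichletCharacter ℂ M) χ' hne]
        · simp only [hcs, hcs1, if_true, hne, hB'.1, if_false]
          rw [dens]; push_cast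
          rw [ofReal_cpow (Nat.cast_nonneg n)]
          simp; ring
        · rintro ψ ⟨h1, h2⟩
          simp [h1, h2]
  · left
    push Not at hbad
    intro M hM0 hWM hMQ s hs hs1 x hx
    haveI : NeZero M := ⟨hM0.ne'⟩
    obtain ⟨g1, g2, g3⟩ := hQ M (hMQ.trans hkQ)
    refine psi_orth (fun ψ => if ψ = 1 then 1 else 0) (fun ψ => 1) x (fun ψ => ?_) hs _ ?_
    · by_cases e1 : ψ = 1
      · subst e1; simpa using g1 x hx
      · simp only [e1, if_false]
        exact g2 ψ e1 (fun β' => hbad M ‹_› ψ β' hMQ) x hx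
    · intro n hn
      have hu : IsUnit (s : ZMod M) := (ZMod.isUnit_iff_coprime _ _).2 hs
      rw [Fintype.sum_eq_single (1 : DirichletCharacter ℂ M) (fun ψ h1 => by simp [h1]), MulChar.one_apply]
      · simp [dens]
      · exact ⟨hu.unit⁻¹, by simp [ZMod.inv_coe_unit, ← ZMod.inv_coe_unit]⟩

end

section
open Complex Metric Set Filter Topology MeasureTheory

noncomputable def lam (W n : ℕ) : ℝ := if (W * n + 1).Prime then (W.totient / W : ℝ) * Real.log (W * n + 1 : ℕ) else 0

noncomputable def rho (W : ℕ) (ε β : ℝ) (n : ℕ) : ℝ := (∑ i ∈ Finset.range W, dens ε β (W * n + i + 2)) / W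

noncomputable def ul (W l n : ℕ) : ℝ := if l ∣ W * n + 1 then 0 else l / (l - 1)

noncomputable def uu (W m n : ℕ) : ℝ := ∏ l ∈ m.primeFactors.filter (¬ · ∣ W), ul W l n

noncomputable def avg (m : ℕ) (F : ℕ → ℂ) : ℂ := (∑ c ∈ Finset.range m, F c) / m

lemma uu_eq {W m : ℕ} (hW : 0 < W) (hm : 0 < m) (c : ℕ) :
    uu W m c = if (W * c + 1).Coprime m then (m * W.totient / (W * m).totient : ℝ) else 0 := by
  classical
  unfold uu
  split_ifs with h
  · have h1 : ∀ l ∈ m.primeFactors.filter (¬ · ∣ W), ul W l c = (1 - (l : ℝ)⁻¹)⁻¹ := by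
      intro l hl
      rw [Finset.mem_filter, Nat.mem_primeFactors] at hl
      have : ¬ l ∣ W * c + 1 := fun h' => (Nat.not_coprime_of_dvd_of_dvd hl.1.1.one_lt h' hl.1.2.1) h
      have h2 : (1 : ℝ) < l := by exact_mod_cast hl.1.1.one_lt
      have h3 : (l : ℝ) - 1 ≠ 0 := by linarith
      rw [ul, if_neg this]; field_simp
    have t1 : ∀ n : ℕ, (n.totient : ℝ) = n * ∏ p ∈ n.primeFactors, (1 - (p : ℝ)⁻¹) := by
      intro n
      have := congrArg (fun x : ℚ => (x : ℝ)) (Nat.totient_eq_mul_prod_factors n)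
      push_cast at this; exact this
    have hp : ∀ p : ℕ, p.Prime → (1 - (p : ℝ)⁻¹) ≠ 0 := by
      intro p hp
      have h2 : (1 : ℝ) < p := by exact_mod_cast hp.one_lt
      have := inv_lt_one_of_one_lt₀ h2
      linarith
    have hset : (W * m).primeFactors = W.primeFactors ∪ m.primeFactors.filter (¬ · ∣ W) := by
      rw [Nat.primeFactors_mul hW.ne' hm.ne']
      ext p
      simp only [Finset.mem_union, Finset.mem_filter, Nat.mem_primeFactors]
      have : W ≠ 0 := hW.ne'
      tauto
    have hdis : Disjoint W.primeFactors (m.primeFactors.filter (¬ · ∣ W)) := by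
      rw [Finset.disjoint_left]
      intro p h1 h2
      exact (Finset.mem_filter.1 h2).2 (Nat.dvd_of_mem_primeFactors h1)
    rw [Finset.prod_congr rfl h1, Finset.prod_inv_distrib, t1 (W * m), t1 W, hset, Finset.prod_union hdis]
    have a1 : ∏ p ∈ W.primeFactors, (1 - (p : ℝ)⁻¹) ≠ 0 := Finset.prod_ne_zero_iff.2 fun p h => hp p (Nat.prime_of_mem_primeFactors h)
    have a2 : ∏ p ∈ m.primeFactors.filter (¬ · ∣ W), (1 - (p : ℝ)⁻¹) ≠ 0 :=
      Finset.prod_ne_zero_iff.2 fun p h => hp p (Nat.prime_of_mem_primeFactors (Finset.mem_filter.1 h).1)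
    have : (W : ℝ) ≠ 0 := by positivity
    have : (m : ℝ) ≠ 0 := by positivity
    generalize ∏ p ∈ W.primeFactors, (1 - (p : ℝ)⁻¹) = a at *
    generalize ∏ p ∈ m.primeFactors.filter (¬ · ∣ W), (1 - (p : ℝ)⁻¹) = b at *
    push_cast
    field_simp
  · obtain ⟨p, hp, h1, h2⟩ := Nat.Prime.not_coprime_iff_dvd.1 h
    refine Finset.prod_eq_zero (i := p) ?_ (by rw [ul, if_pos h1])
    rw [Finset.mem_filter, Nat.mem_primeFactors]
    refine ⟨⟨hp, h2, hm.ne'⟩, fun h3 => hp.one_lt.ne' (Nat.dvd_one.1 ?_)⟩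
    exact (Nat.dvd_add_right (h3.mul_right c)).1 h1

lemma dens_bd {ε β : ℝ} (hε : 0 ≤ ε ∧ ε ≤ 1) (hβ : β ≤ 1) {i : ℕ} (hi : 1 ≤ i) : 0 ≤ dens ε β i ∧ dens ε β i ≤ 1 := by
  have h1 : (i : ℝ) ^ (β - 1) ≤ 1 := Real.rpow_le_one_of_one_le_of_nonpos (by exact_mod_cast hi) (by linarith)
  have h2 : 0 ≤ (i : ℝ) ^ (β - 1) := by positivity
  unfold dens
  constructor <;> nlinarith [hε.1, hε.2]

lemma rho_sum {W : ℕ} (hW : 0 < W) {ε β : ℝ} (x : ℕ) :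
    ∑ i ∈ Finset.Icc 1 (W * x), dens ε β i + dens ε β (W * x + 1) = W * ∑ n ∈ Finset.range x, rho W ε β n + dens ε β 1 := by
  induction x with
  | zero => simp
  | succ x ih =>
    have hW' : (W : ℝ) ≠ 0 := by positivity
    rw [Finset.sum_range_succ, mul_add (W : ℝ), add_right_comm, ← ih, rho, mul_div_cancel₀ _ hW']
    have : ∀ k, ∑ i ∈ Finset.Icc 1 (W * x + k), dens ε β i + dens ε β (W * x + k + 1) =
        ∑ i ∈ Finset.Icc 1 (W * x), dens ε β i + dens ε β (W * x + 1) + ∑ i ∈ Finset.range k, dens ε β (W * x + i + 2) := by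
      intro k
      induction k with
      | zero => simp
      | succ k ih2 => 
        rw [Finset.sum_range_succ, ← add_assoc (_ + _), ← ih2, ← add_assoc, Finset.sum_Icc_succ_top (by omega)]
    exact this W

lemma ev_pow (j : ℕ) : ∀ᶠ Q : ℝ in atTop, ∀ N : ℕ, Real.log N = Real.log Q ^ 3 → Q ^ j ≤ N := by
  filter_upwards [ev_llog (j + 1), ev_const 2] with Q h1 h2 N hN
  have hN0 : (0 : ℝ) < N := by
    rcases Nat.eq_zero_or_pos N with rfl | h
    · have hj : (0:ℝ) ≤ j := by positivity
      have : 0 < Real.log Q ^ 3 := by have : 0 < Real.log Q := by linarith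
                                      positivity
      simp at hN; linarith
    · exact_mod_cast h
  rw [← Real.log_le_log_iff (by positivity) hN0, Real.log_pow, hN]
  have hj : (0:ℝ) ≤ j := by positivity
  nlinarith [mul_nonneg (by linarith : 0 ≤ Real.log Q) (by nlinarith : 0 ≤ Real.log Q ^ 2 - j)]

lemma ap_class {k B : ℕ} : ∀ᶠ Q : ℝ in atTop, ∀ N : ℕ, Real.log N = Real.log Q ^ 3 → ∀ (W : ℕ) (ε β : ℝ), 0 < W →
    0 ≤ ε ∧ ε ≤ 1 → β ≤ 1 → PNTW Q N W ε β k (B + 1) → ∀ m, 0 < m → ((W * m : ℕ) : ℝ) ≤ Q ^ k → ∀ c < m, ∀ x, W * x ≤ 2 * N →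
    |∑ n ∈ (Finset.range x).filter (· ≡ c [MOD m]), lam W n - uu W m c / m * ∑ n ∈ Finset.range x, rho W ε β n| ≤ N / Q ^ B := by
  obtain ⟨C, hC⟩ := Chebyshev.psi_sub_theta_le_mul_sqrt
  filter_upwards [ev_pow (2 * k + B), ev_pow (B + 2), ev_pow (2 * B + 4), ev_const (2 * C ^ 2), ev_const 3] with Q hQ1 hQ2 hQ3 hQ4 hQ5 N hN W ε β hW hε hβ hP m hm hmQ c hc x hx
  have hQ1 := hQ1 N hN
  have hQ2 := hQ2 N hN
  have hQ3 := hQ3 N hN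
  have hm' : (0 : ℝ) < m := by positivity
  have hW' : (0 : ℝ) < W := by positivity
  have hlam0 : ∀ n, 0 ≤ lam W n := by
    intro n; unfold lam; split_ifs
    · exact mul_nonneg (by positivity) (Real.log_nonneg (by simp; positivity))
    · exact le_rfl
  have htW : (W.totient / W : ℝ) ≤ 1 := by
    rw [div_le_one hW']; exact_mod_cast Nat.totient_le W
  have htW0 : (0 : ℝ) ≤ W.totient / W := by positivity
  rw [uu_eq hW hm]
  split_ifs with hcop
  · have hcop' : (W * c + 1).Coprime (W * m) := by
      refine Nat.Coprime.mul_right ?_ hcop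
      simp
    have h1 := hP (W * m) (by positivity) (dvd_mul_right _ _) hmQ (W * c + 1) hcop' (by simp [Nat.ModEq]) (W * x) hx
    set S := (Finset.Icc 1 (W * x)).filter (· ≡ W * c + 1 [MOD (W * m)]) with hS
    have hφ : (1 : ℝ) ≤ (W * m).totient := by exact_mod_cast Nat.totient_pos.2 (by positivity)
    have h2 : |∑ n ∈ S, ArithmeticFunction.vonMangoldt n - ∑ n ∈ S.filter Nat.Prime, Real.log n| ≤ N / Q ^ (B + 1) := by
      have e : ∑ n ∈ S, ArithmeticFunction.vonMangoldt n - ∑ n ∈ S.filter Nat.Prime, Real.log n =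
          ∑ n ∈ S.filter (¬ Nat.Prime ·), ArithmeticFunction.vonMangoldt n := by
        rw [← Finset.sum_filter_add_sum_filter_not S Nat.Prime, add_sub_right_comm, ← Finset.sum_sub_distrib,
          Finset.sum_eq_zero, zero_add]
        intro p hp
        rw [ArithmeticFunction.vonMangoldt_apply_prime (Finset.mem_filter.1 hp).2, sub_self]
      rw [e, abs_of_nonneg (Finset.sum_nonneg fun _ _ => ArithmeticFunction.vonMangoldt_nonneg)]
      have h3 := hC (W * x : ℕ)
      rw [Chebyshev.psi_sub_theta_eq_sum_not_prime, Nat.floor_natCast] at h3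
      refine le_trans (Finset.sum_le_sum_of_subset_of_nonneg ?_ fun _ _ _ => ArithmeticFunction.vonMangoldt_nonneg) (h3.trans ?_)
      · intro n hn
        simp only [hS, Finset.mem_filter, Finset.mem_Icc, Finset.mem_Ioc] at hn ⊢
        exact ⟨⟨by omega, hn.1.1.2⟩, hn.2⟩
      · have h4 : Real.sqrt (W * x : ℕ) ≤ Real.sqrt (2 * N) := Real.sqrt_le_sqrt (by exact_mod_cast hx)
        have h5 : C * Real.sqrt (W * x : ℕ) ≤ |C| * Real.sqrt (2 * N) :=
          mul_le_mul (le_abs_self C) h4 (Real.sqrt_nonneg _) (abs_nonneg _)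
        refine h5.trans ?_
        refine abs_le_of_sq_le_sq' ?_ (by positivity) |>.2
        rw [mul_pow, sq_abs, Real.sq_sqrt (by positivity), div_pow, le_div_iff₀ (by positivity)]
        have h6 : 2 * C ^ 2 * (Q ^ (B + 1)) ^ 2 ≤ N := by
          refine le_trans ?_ hQ3
          calc _ ≤ Q * (Q ^ (B + 1)) ^ 2 := by gcongr
            _ = Q ^ (2 * B + 3) := by ring
            _ ≤ _ := pow_le_pow_right₀ (by linarith) (by omega)
        have hN0 : (0 : ℝ) ≤ N := by positivity
        nlinarith
    have h7 : ∑ n ∈ (Finset.range x).filter (· ≡ c [MOD m]), lam W n = (W.totient / W : ℝ) * ∑ n ∈ S.filter Nat.Prime, Real.log n := by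
      rw [Finset.mul_sum]
      have e1 : ∑ n ∈ (Finset.range x).filter (· ≡ c [MOD m]), lam W n =
        ∑ n ∈ ((Finset.range x).filter (· ≡ c [MOD m])).filter (fun n => (W * n + 1).Prime), (W.totient / W : ℝ) * Real.log (W * n + 1 : ℕ) := by
        rw [Finset.sum_filter (fun n => (W * n + 1).Prime)]; rfl
      rw [e1]
      refine Finset.sum_bij (fun n _ => W * n + 1) ?_ ?_ ?_ (fun n _ => rfl)
      · intro n hn
        simp only [hS, Finset.mem_filter, Finset.mem_range, Finset.mem_Icc] at hn ⊢
        refine ⟨⟨⟨by omega, ?_⟩, (hn.1.2.mul_left' W).add_right 1⟩, hn.2⟩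
        have := Nat.mul_le_mul_left W (Nat.succ_le_of_lt hn.1.1)
        rw [Nat.mul_succ] at this; omega
      · intro a _ b _ h
        exact Nat.eq_of_mul_eq_mul_left hW (by simpa using h)
      · intro p hp
        simp only [hS, Finset.mem_filter, Finset.mem_Icc] at hp
        obtain ⟨⟨⟨hp1, hp2⟩, hp3⟩, hp4⟩ := hp
        have h8 : p ≡ 1 [MOD W] := (hp3.of_dvd (dvd_mul_right W m)).trans (by simp [Nat.ModEq])
        obtain ⟨n, hn⟩ := (Nat.modEq_iff_dvd' hp1).1 h8.symm
        have hpe : p = W * n + 1 := by omega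
        refine ⟨n, ?_, hpe.symm⟩
        simp only [Finset.mem_filter, Finset.mem_range]
        rw [hpe] at hp3
        refine ⟨⟨?_, Nat.ModEq.mul_left_cancel' hW.ne' (Nat.ModEq.add_right_cancel' 1 hp3)⟩, hpe ▸ hp4⟩
        refine lt_of_mul_lt_mul_left (a := W) ?_ (Nat.zero_le _); omega
    have h9 := rho_sum hW (ε := ε) (β := β) x
    have d1 := dens_bd hε hβ (le_refl 1)
    have d2 := dens_bd hε hβ (show 1 ≤ W * x + 1 by omega)
    rw [h7]
    set P := ∑ n ∈ S.filter Nat.Prime, Real.log n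
    set L := ∑ n ∈ S, ArithmeticFunction.vonMangoldt n
    set R := ∑ n ∈ Finset.range x, rho W ε β n
    set φ : ℝ := ((W * m).totient : ℝ)
    set Dn := ∑ i ∈ Finset.Icc 1 (W * x), dens ε β i
    have h10 : |Dn / φ - W * R / φ| ≤ N / Q ^ (B + 1) := by
      rw [← sub_div, abs_div, abs_of_pos (by linarith : 0 < φ)]
      have : |Dn - W * R| ≤ 1 := by rw [abs_le]; constructor <;> linarith
      refine (div_le_one_of_le₀ (this.trans hφ) (by linarith)).trans ?_
      rw [le_div_iff₀ (by positivity), one_mul]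
      exact (pow_le_pow_right₀ (by linarith) (by omega)).trans hQ2
    have h11 : |P - W * R / φ| ≤ N / Q ^ B := by
      have e : P - W * R / φ = -(L - P) + (L - Dn / φ) + (Dn / φ - W * R / φ) := by ring
      have : |P - W * R / φ| ≤ 3 * (N / Q ^ (B + 1)) := by
        rw [e]; refine (abs_add_three _ _ _).trans ?_
        rw [abs_neg]; linarith
      refine this.trans ?_
      rw [pow_succ, ← div_div, mul_div_assoc', div_le_iff₀ (by linarith), mul_comm]
      gcongr
    have e : (W.totient / W : ℝ) * P - m * W.totient / φ / m * R = (W.totient / W : ℝ) * (P - W * R / φ) := by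
      field_simp
    rw [e, abs_mul, abs_of_nonneg htW0]
    calc _ ≤ 1 * (N / Q ^ B : ℝ) := by gcongr
      _ = _ := one_mul _
  · rw [zero_div, zero_mul, sub_zero, abs_of_nonneg (Finset.sum_nonneg fun n _ => hlam0 n)]
    obtain ⟨g, hg, h1, h2⟩ := Nat.Prime.not_coprime_iff_dvd.1 hcop
    have hb : ∀ n ∈ (Finset.range x).filter (· ≡ c [MOD m]), lam W n ≤ if n < m then (m : ℝ) else 0 := by
      intro n hn
      have hn2 := (Finset.mem_filter.1 hn).2
      unfold lam
      split_ifs with a1 a2 a2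
      · have hle : W * n + 1 ≤ m := by
          have : g ∣ W * n + 1 := (((hn2.of_dvd h2).mul_left W).add_right 1).dvd_iff (dvd_refl g) |>.2 h1
          rw [← (Nat.prime_dvd_prime_iff_eq hg a1).1 this]
          exact Nat.le_of_dvd hm h2
        have h0 : Real.log (W * n + 1 : ℕ) ≤ m := by
          refine (Real.log_le_sub_one_of_pos (by positivity)).trans ?_
          have : ((W * n + 1 : ℕ) : ℝ) ≤ m := by exact_mod_cast hle
          linarith
        have h00 : 0 ≤ Real.log (W * n + 1 : ℕ) := Real.log_nonneg (by simp; positivity)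
        calc _ ≤ 1 * (m : ℝ) := by gcongr
          _ = _ := one_mul _
      · exfalso
        have : g ∣ W * n + 1 := (((hn2.of_dvd h2).mul_left W).add_right 1).dvd_iff (dvd_refl g) |>.2 h1
        have := (Nat.prime_dvd_prime_iff_eq hg a1).1 this
        have := Nat.le_of_dvd hm h2
        have := Nat.le_mul_of_pos_left n hW
        omega
      · positivity
      · exact le_rfl
    refine (Finset.sum_le_sum hb).trans ?_
    have h3 : ∑ n ∈ (Finset.range x).filter (· ≡ c [MOD m]), (if n < m then (m : ℝ) else 0) ≤ m * m := by
      rw [← Finset.sum_filter, Finset.sum_const, nsmul_eq_mul]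
      gcongr
      refine (Finset.card_le_card (t := Finset.range m) ?_).trans_eq (Finset.card_range m)
      intro n hn; simpa using (Finset.mem_filter.1 hn).2
    refine h3.trans ?_
    have hmk : (m : ℝ) ≤ Q ^ k := by
      refine le_trans ?_ hmQ; exact_mod_cast Nat.le_mul_of_pos_left m hW
    rw [le_div_iff₀ (by positivity)]
    refine le_trans ?_ hQ1
    calc (m : ℝ) * m * Q ^ B ≤ Q ^ k * Q ^ k * Q ^ B := by gcongr
      _ = _ := by ring

def APH (Q : ℝ) (N W : ℕ) (ρ : ℕ → ℝ) (k B : ℕ) : Prop := ∀ m : ℕ, 0 < m → (m : ℝ) ≤ Q ^ k →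
  ∀ (F : ℕ → ℂ) (C : ℝ), (∀ n, F (n + m) = F n) → (∀ n, ‖F n‖ ≤ C) → ∀ x, W * x ≤ 2 * N →
  ‖∑ n ∈ Finset.range x, lam W n * F n - avg m (fun n => uu W m n * F n) * ∑ n ∈ Finset.range x, (ρ n : ℂ)‖ ≤ m * C * (N / Q ^ B)

lemma ap_fun {k w B : ℕ} : ∀ᶠ Q : ℝ in atTop, ∀ N : ℕ, Real.log N = Real.log Q ^ 3 → ∀ (W : ℕ) (ε β : ℝ), 0 < W → (W : ℝ) ≤ Q ^ w →
    0 ≤ ε ∧ ε ≤ 1 → β ≤ 1 → PNTW Q N W ε β (k + w) (B + 1) → APH Q N W (rho W ε β) k B := by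
  filter_upwards [ap_class (k := k + w) (B := B), ev_const 1] with Q h hQ1 N hN W ε β hW hWQ hε hβ hP m hm hmk F C hF hC x hx
  have h := h N hN W ε β hW hε hβ hP m hm (by push_cast; rw [pow_add, mul_comm]; gcongr)
  have hFp : ∀ n, F n = F (n % m) := fun n => by
    have : Function.Periodic F m := hF
    exact (this.map_mod_nat n).symm
  have e1 : ∑ n ∈ Finset.range x, lam W n * F n = ∑ c ∈ Finset.range m, F c * ((∑ n ∈ (Finset.range x).filter (· ≡ c [MOD m]), lam W n : ℝ) : ℂ) := by
    rw [← Finset.sum_fiberwise_of_maps_to (s := Finset.range x) (t := Finset.range m) (g := fun n => n % m) fun n _ => Finset.mem_range.2 (Nat.mod_lt n hm)]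
    refine Finset.sum_congr rfl fun c hc => ?_
    have hcm := Nat.mod_eq_of_lt (Finset.mem_range.1 hc)
    push_cast
    rw [Finset.mul_sum]
    have : (Finset.range x).filter (fun n => n % m = c) = (Finset.range x).filter (· ≡ c [MOD m]) :=
      Finset.filter_congr fun n _ => by rw [Nat.ModEq, hcm]
    rw [← this]
    refine Finset.sum_congr rfl fun n hn => ?_
    rw [hFp n, (Finset.mem_filter.1 hn).2, mul_comm]
  have e2 : avg m (fun n => uu W m n * F n) * ∑ n ∈ Finset.range x, (rho W ε β n : ℂ) =
      ∑ c ∈ Finset.range m, F c * ((uu W m c / m * ∑ n ∈ Finset.range x, rho W ε β n : ℝ) : ℂ) := by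
    rw [avg, Finset.sum_div, Finset.sum_mul]
    refine Finset.sum_congr rfl fun c _ => ?_
    push_cast; ring
  rw [e1, e2, ← Finset.sum_sub_distrib]
  refine (norm_sum_le_of_le (n := fun _ => C * (N / Q ^ B)) _ fun c hc => ?_).trans_eq ?_
  · rw [← mul_sub, ← ofReal_sub, norm_mul, norm_real, Real.norm_eq_abs]
    exact mul_le_mul (hC c) (h c (Finset.mem_range.1 hc) x hx) (abs_nonneg _) ((norm_nonneg _).trans (hC c))
  · simp; ring

end

section
open Complex Metric Set Filter Topology MeasureTheory

noncomputable def ee (t : ℝ) : ℂ := cexp ((2 * Real.pi * t : ℝ) * I)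

lemma ee_add (s t : ℝ) : ee (s + t) = ee s * ee t := by
  unfold ee; rw [← Complex.exp_add]; congr 1; push_cast; ring

lemma ee_norm (t : ℝ) : ‖ee t‖ = 1 := by unfold ee; exact norm_exp_ofReal_mul_I _

lemma ee_int (k : ℤ) : ee k = 1 := by
  unfold ee; rw [Complex.exp_eq_one_iff]; exact ⟨k, by push_cast; ring⟩

lemma ee_add_int (t : ℝ) (k : ℤ) : ee (t + k) = ee t := by rw [ee_add, ee_int, mul_one]

lemma ee_zero : ee 0 = 1 := by simpa using ee_int 0

lemma ee_nmul (n : ℕ) (t : ℝ) : ee (n * t) = ee t ^ n := by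
  unfold ee; rw [← Complex.exp_nat_mul]; congr 1; push_cast; ring

lemma ee_conj (t : ℝ) : (starRingEnd ℂ) (ee t) = ee (-t) := by
  unfold ee
  rw [← Complex.exp_conj]; congr 1
  rw [map_mul, conj_ofReal, conj_I]; push_cast; ring

lemma ee_re (t : ℝ) : (ee t).re = Real.cos (2 * Real.pi * t) := exp_ofReal_mul_I_re _

/-- distance to nearest integer -/
noncomputable def nn (t : ℝ) : ℝ := |t - round t|

lemma nn_nonneg (t : ℝ) : 0 ≤ nn t := abs_nonneg _

lemma nn_le (t : ℝ) (k : ℤ) : nn t ≤ |t - k| := round_le t k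

lemma ee_sub_one (t : ℝ) : 4 * nn t ≤ ‖ee t - 1‖ := by
  set s := t - round t with hs
  have e : ee t = ee s := by
    have := ee_add_int s (round t); rw [hs, sub_add_cancel] at this; exact this
  have hs2 : |s| ≤ 1 / 2 := abs_sub_round t
  rw [e, ee, mul_comm _ I, Complex.norm_exp_I_mul_ofReal_sub_one, norm_mul, Real.norm_eq_abs, Real.norm_eq_abs, abs_two,
    show 2 * Real.pi * s / 2 = Real.pi * s by ring]
  have hp := Real.pi_pos
  have h1 : Real.sin (Real.pi * |s|) ≤ |Real.sin (Real.pi * s)| := by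
    rcases abs_cases s with ⟨h, -⟩ | ⟨h, -⟩ <;> rw [h]
    · exact le_abs_self _
    · rw [mul_neg, Real.sin_neg]; exact neg_le_abs _
  have h2 := Real.mul_le_sin (x := Real.pi * |s|) (by positivity) (by nlinarith)
  have h3 : 2 / Real.pi * (Real.pi * |s|) = 2 * |s| := by field_simp
  have h4 : nn t = |s| := rfl
  linarith

lemma geo_ee (t : ℝ) (ht : 0 < nn t) (k : ℕ) : ‖∑ n ∈ Finset.range k, ee (n * t)‖ ≤ 1 / (2 * nn t) := by
  have h := ee_sub_one t
  have hne : ee t ≠ 1 := fun h' => by rw [h', sub_self, norm_zero] at h; linarith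
  simp only [ee_nmul]
  rw [geom_sum_eq hne, norm_div]
  have h1 : ‖ee t ^ k - 1‖ ≤ 2 := by
    refine (norm_sub_le _ _).trans ?_
    rw [norm_pow, ee_norm]; norm_num
  rw [div_le_div_iff₀ (by linarith) (by linarith)]
  nlinarith

lemma lin_ee (t : ℝ) (ht : 0 < nn t) (U Y : ℕ) : ‖∑ d ∈ Finset.Ioc U Y, (d : ℂ) * ee (d * t)‖ ≤ 2 * Y / nn t := by
  rcases le_total Y U with h | h
  · rw [Finset.Ioc_eq_empty_of_le h]; simp; have := nn_nonneg t; positivity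
  have key : ∀ M : ℕ, M ≤ Y → ‖∑ d ∈ Finset.range (M + 1), ee (d * t) * (d : ℂ)‖ ≤ Y / nn t := by
    intro M hM
    refine (abel_var (geo_ee t ht) (g := fun n => (n : ℂ)) (M + 1)).trans ?_
    have : (M : ℝ) ≤ Y := by exact_mod_cast hM
    simp only [Nat.add_sub_cancel, Nat.cast_add, Nat.cast_one, add_sub_cancel_left, norm_one, Finset.sum_const, Finset.card_range, norm_natCast, nsmul_eq_mul, mul_one]
    rw [div_mul_eq_mul_div, div_le_div_iff₀ (by positivity) ht]
    nlinarith
  have e : ∑ d ∈ Finset.Ioc U Y, (d : ℂ) * ee (d * t) = ∑ d ∈ Finset.range (Y + 1), ee (d * t) * (d : ℂ) - ∑ d ∈ Finset.range (U + 1), ee (d * t) * (d : ℂ) := by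
    rw [← Finset.sum_Ico_eq_sub _ (by omega)]
    refine Finset.sum_congr (by ext; simp only [Finset.mem_Ioc, Finset.mem_Ico]; omega) fun d _ => mul_comm _ _
  rw [e]
  refine (norm_sub_le _ _).trans ((add_le_add (key Y le_rfl) (key U h)).trans_eq ?_)
  ring

lemma sep {θ : ℝ} {a : ℤ} {q : ℕ} (hq : 0 < q) (hc : IsCoprime a (q : ℤ)) (hθ : |θ - a / q| ≤ 1 / (q : ℝ) ^ 2) {d : ℤ} (hd0 : d ≠ 0)
    (hd : 2 * |d| ≤ q) : 1 / (2 * q) ≤ nn (d * θ) := by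
  have hq' : (0 : ℝ) < q := by exact_mod_cast hq
  set k := round (d * θ) with hk
  have h1 : (1 : ℝ) ≤ |((d * a - k * q : ℤ) : ℝ)| := by
    rw [← Int.cast_abs]
    have : (d * a - k * q : ℤ) ≠ 0 := by
      intro h
      have h2 : (q : ℤ) ∣ d * a := ⟨k, by linarith⟩
      have h3 : (q : ℤ) ∣ d := hc.symm.dvd_of_dvd_mul_right h2
      have := Int.le_of_dvd (abs_pos.2 hd0) ((dvd_abs _ _).2 h3)
      have := abs_pos.2 hd0
      omega
    exact_mod_cast Int.one_le_abs this
  have h4 : (2 * |(d : ℝ)|) ≤ q := by exact_mod_cast hd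
  have e : ((d * a - k * q : ℤ) : ℝ) / q = (d * θ - k) - d * (θ - a / q) := by push_cast; field_simp; ring
  have h5 : 1 / (q : ℝ) ≤ |(d * θ - k) - d * (θ - a / q)| := by
    rw [← e, abs_div, abs_of_pos hq']; gcongr
  have h6 : |(d : ℝ) * (θ - a / q)| ≤ 1 / (2 * q) := by
    rw [abs_mul]
    calc _ ≤ (q / 2 : ℝ) * (1 / (q : ℝ) ^ 2) := by gcongr; linarith
      _ = _ := by field_simp
  have h7 := abs_sub (d * θ - k) (d * (θ - a / q))
  have e8 : 1 / (q : ℝ) = 1 / (2 * q) + 1 / (2 * q) := by field_simp; norm_num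
  rw [nn, ← hk]; linarith

noncomputable def mi (D t : ℝ) : ℝ := if nn t = 0 then D else min D (1 / nn t)

lemma mi_le (D t : ℝ) : mi D t ≤ D := by
  unfold mi; split_ifs
  · exact le_rfl
  · exact min_le_left _ _

noncomputable def HH (n : ℕ) : ℝ := ∑ s ∈ Finset.Icc 1 n, 1 / (s : ℝ)

lemma HH_nonneg (n : ℕ) : 0 ≤ HH n := Finset.sum_nonneg fun s _ => by positivity

lemma block {θ : ℝ} {a : ℤ} {q : ℕ} (hq : 0 < q) (hc : IsCoprime a (q : ℤ)) (hθ : |θ - a / q| ≤ 1 / (q : ℝ) ^ 2) {D : ℝ} (hD : 0 ≤ D)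
    (t J : ℕ) (hJ : 2 * J ≤ q) : ∑ j ∈ Finset.range J, mi D ((t + j : ℕ) * θ) ≤ 2 * D + 4 * q * HH (2 * q) := by
  have hq' : (0 : ℝ) < q := by exact_mod_cast hq
  set G : ℕ → ℕ := fun j => ⌊2 * q * Int.fract ((t + j : ℕ) * θ)⌋₊ with hG
  set B : ℕ → ℝ := fun s => (if s = 0 then D else 2 * q * (1 / (s : ℝ))) + if s = 2 * q - 1 then D else 2 * q * (1 / ((2 * q - 1 - s : ℕ) : ℝ)) with hB
  have hGfloor : ∀ j, (G j : ℝ) ≤ 2 * q * Int.fract ((t + j : ℕ) * θ) ∧ 2 * q * Int.fract ((t + j : ℕ) * θ) < G j + 1 := fun j =>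
    ⟨Nat.floor_le (mul_nonneg (by positivity) (Int.fract_nonneg _)), Nat.lt_floor_add_one _⟩
  have hGlt : ∀ j, G j < 2 * q := by
    intro j
    have h1 := (hGfloor j).1
    have h2 := Int.fract_lt_one ((t + j : ℕ) * θ)
    have : (G j : ℝ) < 2 * q := by nlinarith
    exact_mod_cast this
  have hB0 : ∀ s, 0 ≤ B s := fun s => by
    simp only [hB]; refine add_nonneg ?_ ?_ <;> split_ifs <;> positivity
  have hle : ∀ j, mi D ((t + j : ℕ) * θ) ≤ B (G j) := by
    intro j
    have h1 := hGfloor j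
    have hlt := hGlt j
    simp only [hB]
    set s := G j
    by_cases h0 : s = 0
    · rw [if_pos h0]
      refine (mi_le _ _).trans (le_add_of_nonneg_right ?_)
      split_ifs <;> positivity
    by_cases h0' : s = 2 * q - 1
    · rw [if_pos h0']
      refine (mi_le _ _).trans (le_add_of_nonneg_left ?_)
      split_ifs <;> positivity
    rw [if_neg h0, if_neg h0']
    set y := ((t + j : ℕ) : ℝ) * θ
    set f := Int.fract y with hf
    have hs0 : (0 : ℝ) < s := by exact_mod_cast Nat.pos_of_ne_zero h0
    have hs1 : (0 : ℝ) < (2 * q - 1 - s : ℕ) := by exact_mod_cast (by omega : 0 < 2 * q - 1 - s)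
    have hs1e : ((2 * q - 1 - s : ℕ) : ℝ) = 2 * q - 1 - s := by
      rw [Nat.cast_sub (by omega), Nat.cast_sub (by omega)]; push_cast; ring
    have hf1 := Int.fract_lt_one y
    have hnn : nn y = min f (1 - f) := abs_sub_round_eq_min y
    have hfs : (s : ℝ) / (2 * q) ≤ f := by rw [div_le_iff₀ (by positivity)]; linarith
    have hfs' : ((2 * q - 1 - s : ℕ) : ℝ) / (2 * q) ≤ 1 - f := by rw [div_le_iff₀ (by positivity), hs1e]; nlinarith
    have hn0 : 0 < nn y := by
      rw [hnn]; refine lt_min (lt_of_lt_of_le (by positivity) hfs) (by linarith)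
    rw [mi, if_neg hn0.ne']
    refine (min_le_right _ _).trans ?_
    rw [hnn]
    rcases min_cases f (1 - f) with ⟨h, -⟩ | ⟨h, -⟩ <;> rw [h]
    · refine le_trans ?_ (le_add_of_nonneg_right (by positivity))
      rw [div_le_iff₀ (by positivity)] at hfs
      rw [mul_one_div, div_le_div_iff₀ (by first | linarith | (rw [← h, ← hnn]; exact hn0)) (by assumption)]
      linarith
    · refine le_trans ?_ (le_add_of_nonneg_left (by positivity))
      rw [div_le_iff₀ (by positivity)] at hfs'
      rw [mul_one_div, div_le_div_iff₀ (by first | linarith | (rw [← h, ← hnn]; exact hn0)) (by assumption)]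
      linarith
  have hinj : Set.InjOn G (Finset.range J) := by
    intro i hi j hj hij
    by_contra hne
    simp only [Finset.coe_range, Set.mem_Iio] at hi hj
    have h1 := hGfloor i
    have h2 := hGfloor j
    rw [hij] at h1
    have h3 := sep hq hc hθ (d := (i : ℤ) - j) (by omega) (by have := abs_lt.2 (⟨by omega, by omega⟩ : -(J : ℤ) < (i : ℤ) - j ∧ (i : ℤ) - j < J); omega)
    have h4 : nn (((i : ℤ) - j : ℤ) * θ) ≤ |Int.fract ((t + i : ℕ) * θ) - Int.fract ((t + j : ℕ) * θ)| := by
      have := nn_le (((i : ℤ) - j : ℤ) * θ) (⌊((t + i : ℕ) : ℝ) * θ⌋ - ⌊((t + j : ℕ) : ℝ) * θ⌋)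
      refine this.trans_eq ?_
      congr 1
      rw [Int.fract, Int.fract]; push_cast; ring
    have h5 : |Int.fract ((t + i : ℕ) * θ) - Int.fract ((t + j : ℕ) * θ)| < 1 / (2 * q) := by
      rw [abs_lt, lt_div_iff₀ (by positivity), neg_lt, lt_div_iff₀ (by positivity)]
      constructor <;> nlinarith
    linarith
  calc ∑ j ∈ Finset.range J, mi D ((t + j : ℕ) * θ) ≤ ∑ j ∈ Finset.range J, B (G j) := Finset.sum_le_sum fun j _ => hle j
    _ = ∑ s ∈ (Finset.range J).image G, B s := (Finset.sum_image hinj).symm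
    _ ≤ ∑ s ∈ Finset.range (2 * q), B s := by
      refine Finset.sum_le_sum_of_subset_of_nonneg (fun s hs => ?_) fun s _ _ => hB0 s
      obtain ⟨j, -, rfl⟩ := Finset.mem_image.1 hs
      exact Finset.mem_range.2 (hGlt j)
    _ ≤ _ := by
      have e : ∑ s ∈ Finset.range (2 * q), (if s = 0 then D else 2 * q * (1 / (s : ℝ))) ≤ D + 2 * q * HH (2 * q) := by
        rw [← Finset.add_sum_erase _ _ (Finset.mem_range.2 (by omega : 0 < 2 * q)), if_pos rfl, HH, Finset.mul_sum]
        gcongr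
        rw [Finset.sum_congr rfl fun s hs => if_neg (by simp at hs; tauto)]
        refine Finset.sum_le_sum_of_subset_of_nonneg (fun s hs => ?_) fun s _ _ => by positivity
        simp at hs ⊢; omega
      simp only [hB]
      rw [Finset.sum_add_distrib]
      have e2 : ∑ s ∈ Finset.range (2 * q), (if s = 2 * q - 1 then D else 2 * q * (1 / ((2 * q - 1 - s : ℕ) : ℝ))) =
          ∑ s ∈ Finset.range (2 * q), (if s = 0 then D else 2 * q * (1 / (s : ℝ))) := by
        rw [← Finset.sum_range_reflect]
        refine Finset.sum_congr rfl fun s hs => ?_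
        have := Finset.mem_range.1 hs
        by_cases h : s = 0
        · simp [h]
        · rw [if_neg h, if_neg (by omega), show 2 * q - 1 - (2 * q - 1 - s) = s by omega]
      rw [e2]; linarith

lemma blocks {θ : ℝ} {a : ℤ} {q : ℕ} (hq : 2 ≤ q) (hc : IsCoprime a (q : ℤ)) (hθ : |θ - a / q| ≤ 1 / (q : ℝ) ^ 2) {D : ℝ} (hD : 0 ≤ D)
    (k : ℕ) : ∑ j ∈ Finset.range k, mi D (j * θ) ≤ (3 * k / q + 1) * (2 * D + 4 * q * HH (2 * q)) := by
  set J := q / 2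
  have hJ : 0 < J := by omega
  set E := 2 * D + 4 * q * HH (2 * q) with hE
  have hE0 : 0 ≤ E := by have := HH_nonneg (2 * q); positivity
  have h1 : ∀ M : ℕ, ∑ j ∈ Finset.range (M * J), mi D (j * θ) ≤ M * E := by
    intro M
    induction M with
    | zero => simp
    | succ M ih =>
      rw [Nat.succ_mul, Finset.sum_range_add]
      have := block (by omega) hc hθ hD (M * J) J (by omega)
      push_cast at this ih ⊢; linarith
  have hmi : ∀ t, 0 ≤ mi D t := fun t => by
    unfold mi; split_ifs
    · exact hD
    · exact le_min hD (one_div_nonneg.2 (nn_nonneg t))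
  have h2 : k ≤ (k / J + 1) * J := by
    have := Nat.lt_mul_div_succ k hJ; rw [mul_comm]; omega
  refine (Finset.sum_le_sum_of_subset_of_nonneg (Finset.range_mono h2) fun _ _ _ => hmi _).trans ((h1 _).trans ?_)
  gcongr
  push_cast
  gcongr
  have h3 : ((k / J : ℕ) : ℝ) ≤ k / J := Nat.cast_div_le
  refine h3.trans ?_
  have hJ' : (0 : ℝ) < J := by exact_mod_cast hJ
  have : (q : ℝ) ≤ 3 * J := by exact_mod_cast (by omega : q ≤ 3 * J)
  rw [div_le_div_iff₀ hJ' (by positivity)]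
  have : (0 : ℝ) ≤ k := by positivity
  nlinarith

end

section
open Complex Metric Set Filter Topology MeasureTheory

lemma nn_neg (t : ℝ) : nn (-t) = nn t := by
  refine le_antisymm ?_ ?_
  · refine (nn_le _ (-round t)).trans_eq ?_
    rw [nn, ← abs_neg]; congr 1; push_cast; ring
  · refine (nn_le _ (-round (-t))).trans_eq ?_
    rw [nn, ← abs_neg]; congr 1; push_cast; ring

lemma mi_nonneg {D : ℝ} (hD : 0 ≤ D) (t : ℝ) : 0 ≤ mi D t := by
  unfold mi; split_ifs
  · exact hD
  · exact le_min hD (one_div_nonneg.2 (nn_nonneg t))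

lemma lin_mi (t : ℝ) (U Y : ℕ) : ‖∑ d ∈ Finset.Ioc U Y, (d : ℂ) * ee (d * t)‖ ≤ 2 * Y * mi Y t := by
  have triv : ‖∑ d ∈ Finset.Ioc U Y, (d : ℂ) * ee (d * t)‖ ≤ 2 * Y * Y := by
    refine (norm_sum_le_of_le (n := fun _ => (Y : ℝ)) _ fun d hd => ?_).trans ?_
    · rw [norm_mul, ee_norm, mul_one, norm_natCast]; exact_mod_cast (Finset.mem_Ioc.1 hd).2
    · rw [Finset.sum_const, Nat.card_Ioc, nsmul_eq_mul]
      have : ((Y - U : ℕ) : ℝ) ≤ Y := by exact_mod_cast Nat.sub_le _ _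
      nlinarith [(Nat.cast_nonneg Y : (0 : ℝ) ≤ Y)]
  unfold mi
  split_ifs with h
  · exact triv
  · have h0 : 0 < nn t := lt_of_le_of_ne (nn_nonneg t) (Ne.symm h)
    rw [mul_min_of_nonneg _ _ (by positivity)]
    refine le_min triv ((lin_ee t h0 U Y).trans_eq ?_)
    ring

lemma quad_form (x U : ℕ) (hU : 0 < U) (θ : ℝ) (β : ℕ → ℝ) {L : ℝ} (hβ : ∀ k, k ≤ x → |β k| ≤ L) :
    ∑ d ∈ Finset.Ioc U x, (d : ℝ) * ‖∑ k ∈ Finset.Ioc U (x / d), (β k : ℂ) * ee (d * k * θ)‖ ^ 2 ≤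
      L ^ 2 * ∑ k ∈ Finset.Ioc U (x / U), 2 * ∑ j ∈ Finset.range k, 2 * ((x / k : ℕ) : ℝ) * mi ((x / k : ℕ) : ℝ) (j * θ) := by
  set K := x / U with hK
  set w : ℕ → ℕ → ℝ := fun k j => 2 * ((x / k : ℕ) : ℝ) * mi ((x / k : ℕ) : ℝ) (j * θ) with hw
  have hw0 : ∀ k j, 0 ≤ w k j := fun k j => mul_nonneg (by positivity) (mi_nonneg (by positivity) _)
  set V : ℕ → ℕ → ℂ := fun k k' => ∑ d ∈ Finset.Ioc U (min (x / k) (x / k')), (d : ℂ) * ee (d * (((k : ℝ) - k') * θ)) with hV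
  have hV1 : ∀ k k', k' ≤ k → 0 < k' → ‖V k k'‖ ≤ w k (k - k') := by
    intro k k' h h0
    simp only [hV, hw]
    rw [min_eq_left (Nat.div_le_div_left h h0), Nat.cast_sub h]
    exact lin_mi _ _ _
  have hV2 : ∀ k k', k ≤ k' → 0 < k → ‖V k k'‖ ≤ w k' (k' - k) := by
    intro k k' h h0
    simp only [hV, hw]
    rw [min_eq_right (Nat.div_le_div_left h h0), Nat.cast_sub h]
    have e : mi ((x / k' : ℕ) : ℝ) (((k' : ℝ) - k) * θ) = mi ((x / k' : ℕ) : ℝ) (((k : ℝ) - k') * θ) := by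
      unfold mi; rw [← nn_neg]; congr 3 <;> (try rw [← neg_mul, neg_sub])
    rw [e]
    exact lin_mi _ _ _
  have hid : ((∑ d ∈ Finset.Ioc U x, (d : ℝ) * ‖∑ k ∈ Finset.Ioc U (x / d), (β k : ℂ) * ee (d * k * θ)‖ ^ 2 : ℝ) : ℂ) =
      ∑ k ∈ Finset.Ioc U K, ∑ k' ∈ Finset.Ioc U K, (β k : ℂ) * β k' * V k k' := by
    have h1 : ∀ d ∈ Finset.Ioc U x, (((d : ℝ) * ‖∑ k ∈ Finset.Ioc U (x / d), (β k : ℂ) * ee (d * k * θ)‖ ^ 2 : ℝ) : ℂ) =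
        ∑ k ∈ Finset.Ioc U K, ∑ k' ∈ Finset.Ioc U K, if d ≤ min (x / k) (x / k') then (β k : ℂ) * β k' * (d * ee (d * (((k : ℝ) - k') * θ))) else 0 := by
      intro d hd
      rw [Finset.mem_Ioc] at hd
      have hs : ∑ k ∈ Finset.Ioc U (x / d), (β k : ℂ) * ee (d * k * θ) = ∑ k ∈ Finset.Ioc U K, if d ≤ x / k then (β k : ℂ) * ee (d * k * θ) else 0 := by
        rw [← Finset.sum_filter]
        refine Finset.sum_congr ?_ fun _ _ => rfl
        ext k
        simp only [Finset.mem_Ioc, Finset.mem_filter]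
        constructor
        · rintro ⟨h1, h2⟩
          refine ⟨⟨h1, h2.trans (Nat.div_le_div_left hd.1.le hU)⟩, ?_⟩
          rw [Nat.le_div_iff_mul_le (by omega)] at h2 ⊢; rw [mul_comm]; exact h2
        · rintro ⟨⟨h1, -⟩, h2⟩
          refine ⟨h1, ?_⟩
          rw [Nat.le_div_iff_mul_le (by omega)] at h2 ⊢; rw [mul_comm]; exact h2
      rw [hs]
      push_cast
      rw [← Complex.mul_conj', map_sum, Finset.sum_mul_sum, Finset.mul_sum]
      refine Finset.sum_congr rfl fun k _ => ?_
      rw [Finset.mul_sum]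
      refine Finset.sum_congr rfl fun k' _ => ?_
      rw [apply_ite (starRingEnd ℂ), map_zero, map_mul, conj_ofReal, ee_conj]
      by_cases h1 : d ≤ x / k <;> by_cases h2 : d ≤ x / k' <;> simp only [h1, h2, le_min_iff, if_true, if_false, true_and, and_true, false_and, and_false, mul_zero, zero_mul]
      rw [show (d : ℝ) * (((k : ℝ) - k') * θ) = d * k * θ + -(d * k' * θ) by ring, ee_add]
      ring
    rw [Complex.ofReal_sum, Finset.sum_congr rfl h1, Finset.sum_comm]
    refine Finset.sum_congr rfl fun k hk => ?_
    rw [Finset.sum_comm]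
    refine Finset.sum_congr rfl fun k' _ => ?_
    rw [hV, Finset.mul_sum, ← Finset.sum_filter]
    refine Finset.sum_congr ?_ fun _ _ => rfl
    ext d
    simp only [Finset.mem_Ioc, Finset.mem_filter]
    constructor
    · rintro ⟨⟨h1, -⟩, h2⟩; exact ⟨h1, h2⟩
    · rintro ⟨h1, h2⟩
      exact ⟨⟨h1, (h2.trans (min_le_left _ _)).trans (Nat.div_le_self _ _)⟩, h2⟩
  have h0 : (0 : ℝ) ≤ ∑ d ∈ Finset.Ioc U x, (d : ℝ) * ‖∑ k ∈ Finset.Ioc U (x / d), (β k : ℂ) * ee (d * k * θ)‖ ^ 2 :=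
    Finset.sum_nonneg fun d _ => by positivity
  rw [← abs_of_nonneg h0, ← Real.norm_eq_abs, ← Complex.norm_real, hid]
  have hKx : K ≤ x := Nat.div_le_self _ _
  have hkpos : ∀ k ∈ Finset.Ioc U K, 0 < k := fun k hk => by have := Finset.mem_Ioc.1 hk; omega
  have hL : 0 ≤ L := (abs_nonneg _).trans (hβ 0 (by omega))
  have s1 : ‖∑ k ∈ Finset.Ioc U K, ∑ k' ∈ Finset.Ioc U K, (β k : ℂ) * β k' * V k k'‖ ≤
      ∑ k ∈ Finset.Ioc U K, ∑ k' ∈ Finset.Ioc U K, L ^ 2 * ((if k' ≤ k then w k (k - k') else 0) + if k ≤ k' then w k' (k' - k) else 0) := by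
    refine norm_sum_le_of_le _ fun k hk => norm_sum_le_of_le _ fun k' hk' => ?_
    have b1 := hβ k ((Finset.mem_Ioc.1 hk).2.trans hKx)
    have b2 := hβ k' ((Finset.mem_Ioc.1 hk').2.trans hKx)
    rw [norm_mul, norm_mul, Complex.norm_real, Complex.norm_real, Real.norm_eq_abs, Real.norm_eq_abs, pow_two]
    refine mul_le_mul (mul_le_mul b1 b2 (abs_nonneg _) hL) ?_ (norm_nonneg _) (by positivity)
    rcases le_total k' k with h | h
    · rw [if_pos h]
      exact (hV1 k k' h (hkpos _ hk')).trans (le_add_of_nonneg_right (by split_ifs; exacts [hw0 _ _, le_rfl]))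
    · rw [if_pos h]
      exact (hV2 k k' h (hkpos _ hk)).trans (le_add_of_nonneg_left (by split_ifs; exacts [hw0 _ _, le_rfl]))
  refine s1.trans ?_
  simp only [mul_add, Finset.sum_add_distrib, ← Finset.mul_sum]
  rw [Finset.sum_comm (f := fun k k' => if k ≤ k' then w k' (k' - k) else 0), ← mul_add]
  refine mul_le_mul_of_nonneg_left ?_ (by positivity)
  rw [← two_mul]
  refine mul_le_mul_of_nonneg_left ?_ (by positivity)
  refine Finset.sum_le_sum fun k hk => ?_
  rw [← Finset.sum_filter, ← Finset.sum_image (f := fun j => w k j) (g := fun k' => k - k')]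
  · rw [Finset.mul_sum]
    refine Finset.sum_le_sum_of_subset_of_nonneg (f := fun j => w k j) (fun j hj => ?_) fun j _ _ => hw0 _ _
    obtain ⟨k', h1, rfl⟩ := Finset.mem_image.1 hj
    rw [Finset.mem_filter, Finset.mem_Ioc] at h1
    exact Finset.mem_range.2 (by omega)
  · intro i hi j hj hij
    simp only [Finset.coe_filter, Set.mem_setOf_eq] at hi hj hij
    omega

lemma HH_mono {a b : ℕ} (h : a ≤ b) : HH a ≤ HH b :=
  Finset.sum_le_sum_of_subset_of_nonneg (Finset.Icc_subset_Icc_right h) fun _ _ _ => by positivity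

lemma HH_le (n : ℕ) : HH n ≤ 1 + Real.log n := by
  refine le_trans (le_of_eq ?_) (harmonic_le_one_add_log n)
  rw [harmonic_eq_sum_Icc, HH]; push_cast; simp

lemma typeII {θ : ℝ} {a : ℤ} {q : ℕ} (hq : 2 ≤ q) (hc : IsCoprime a (q : ℤ)) (hθ : |θ - a / q| ≤ 1 / (q : ℝ) ^ 2) (x U : ℕ) (hU : 0 < U)
    (α β : ℕ → ℝ) (hα : ∀ d, |α d| ≤ 1) {L H : ℝ} (hβ : ∀ k, k ≤ x → |β k| ≤ L) (h1H : 1 ≤ H) (hH1 : HH x ≤ H) (hH2 : HH (2 * q) ≤ H) :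
    ‖∑ d ∈ Finset.Ioc U x, ∑ k ∈ Finset.Ioc U (x / d), (α d : ℂ) * β k * ee (d * k * θ)‖ ^ 2 ≤
      56 * L ^ 2 * H ^ 3 * ((x : ℝ) ^ 2 / q + (x : ℝ) ^ 2 / U + x * q) := by
  have hH0 : 0 ≤ H := (HH_nonneg x).trans hH1
  have hq' : (0 : ℝ) < q := by exact_mod_cast (by omega : 0 < q)
  have hU' : (0 : ℝ) < U := by exact_mod_cast hU
  set T : ℕ → ℝ := fun d => ‖∑ k ∈ Finset.Ioc U (x / d), (β k : ℂ) * ee (d * k * θ)‖ with hT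
  have s1 : ‖∑ d ∈ Finset.Ioc U x, ∑ k ∈ Finset.Ioc U (x / d), (α d : ℂ) * β k * ee (d * k * θ)‖ ≤ ∑ d ∈ Finset.Ioc U x, T d := by
    refine norm_sum_le_of_le _ fun d _ => ?_
    simp only [mul_assoc]
    rw [← Finset.mul_sum, norm_mul, Complex.norm_real, Real.norm_eq_abs, hT]
    simp only [mul_assoc]
    exact mul_le_of_le_one_left (norm_nonneg _) (hα d)
  have s2 : (∑ d ∈ Finset.Ioc U x, T d) ^ 2 ≤ (∑ d ∈ Finset.Ioc U x, 1 / (d : ℝ)) * ∑ d ∈ Finset.Ioc U x, (d : ℝ) * T d ^ 2 := by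
    refine Finset.sum_sq_le_sum_mul_sum_of_sq_eq_mul _ (fun d _ => by positivity) (fun d _ => by positivity) fun d hd => ?_
    have : (d : ℝ) ≠ 0 := by have := Finset.mem_Ioc.1 hd; exact_mod_cast (by omega : d ≠ 0)
    field_simp
  have s3 : ∑ d ∈ Finset.Ioc U x, 1 / (d : ℝ) ≤ H := by
    refine le_trans ?_ hH1
    refine Finset.sum_le_sum_of_subset_of_nonneg (fun d hd => ?_) fun _ _ _ => by positivity
    simp at hd ⊢; omega
  have s4 := quad_form x U hU θ β hβ
  have s5 : ∀ k ∈ Finset.Ioc U (x / U), 2 * ∑ j ∈ Finset.range k, 2 * ((x / k : ℕ) : ℝ) * mi ((x / k : ℕ) : ℝ) (j * θ) ≤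
      24 * ((x : ℝ) ^ 2 / q) * (1 / k) + 48 * x * H + 8 * ((x : ℝ) ^ 2 / U) * (1 / k) + 16 * (x * q * H) * (1 / k) := by
    intro k hk
    rw [Finset.mem_Ioc] at hk
    have hk' : (U : ℝ) ≤ k := by exact_mod_cast hk.1.le
    have hk0 : (0 : ℝ) < k := by linarith
    rw [← Finset.mul_sum]
    have h1 := blocks hq hc hθ (D := ((x / k : ℕ) : ℝ)) (by positivity) k
    set y := ((x / k : ℕ) : ℝ) with hy
    have hyx : y ≤ x / k := Nat.cast_div_le
    have hy0 : 0 ≤ y := by positivity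
    calc _ ≤ 2 * (2 * y * ((3 * k / q + 1) * (2 * y + 4 * q * HH (2 * q)))) := by gcongr
      _ ≤ 2 * (2 * (x / k) * ((3 * k / q + 1) * (2 * (x / k) + 4 * q * H))) := by
        have := HH_nonneg (2 * q)
        gcongr
      _ = 24 * ((x : ℝ) ^ 2 / q) * (1 / k) + 48 * x * H + 8 * ((x : ℝ) ^ 2 / k) * (1 / k) + 16 * (x * q * H) * (1 / k) := by
        field_simp; ring
      _ ≤ _ := by gcongr
  have s6 : ∑ k ∈ Finset.Ioc U (x / U), 1 / (k : ℝ) ≤ H := by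
    refine le_trans ?_ hH1
    refine Finset.sum_le_sum_of_subset_of_nonneg (fun d hd => ?_) fun _ _ _ => by positivity
    have := Nat.div_le_self x U
    simp at hd ⊢; omega
  have s7 : ∑ k ∈ Finset.Ioc U (x / U), 48 * (x : ℝ) * H ≤ 48 * ((x : ℝ) ^ 2 / U) * H := by
    rw [Finset.sum_const, Nat.card_Ioc, nsmul_eq_mul]
    have : ((x / U - U : ℕ) : ℝ) ≤ x / U := le_trans (by exact_mod_cast Nat.sub_le _ _) Nat.cast_div_le
    calc _ ≤ (x / U : ℝ) * (48 * x * H) := by gcongr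
      _ = _ := by field_simp
  have s8 := Finset.sum_le_sum s5
  rw [Finset.sum_add_distrib, Finset.sum_add_distrib, Finset.sum_add_distrib, ← Finset.mul_sum _ _ (24 * ((x : ℝ) ^ 2 / q)), ← Finset.mul_sum _ _ (8 * ((x : ℝ) ^ 2 / U)), ← Finset.mul_sum _ _ (16 * (x * q * H))] at s8
  have hL2 : 0 ≤ L ^ 2 := sq_nonneg L
  have s9 : ∑ d ∈ Finset.Ioc U x, (d : ℝ) * T d ^ 2 ≤ L ^ 2 * (24 * ((x : ℝ) ^ 2 / q) * H + 48 * ((x : ℝ) ^ 2 / U) * H + 8 * ((x : ℝ) ^ 2 / U) * H + 16 * (x * q * H) * H) := by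
    refine s4.trans (mul_le_mul_of_nonneg_left (s8.trans ?_) hL2)
    gcongr
  calc _ ≤ (∑ d ∈ Finset.Ioc U x, T d) ^ 2 := by gcongr
    _ ≤ _ := s2
    _ ≤ H * (L ^ 2 * (24 * ((x : ℝ) ^ 2 / q) * H + 48 * ((x : ℝ) ^ 2 / U) * H + 8 * ((x : ℝ) ^ 2 / U) * H + 16 * (x * q * H) * H)) := by gcongr
    _ ≤ _ := by
      have a1 : (0 : ℝ) ≤ L ^ 2 * H ^ 2 * ((x : ℝ) ^ 2 / q) := by positivity
      have a2 : (0 : ℝ) ≤ L ^ 2 * H ^ 2 * ((x : ℝ) ^ 2 / U) := by positivity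
      have a3 : (0 : ℝ) ≤ L ^ 2 * H ^ 3 * (x * q) := by positivity
      have b1 := le_mul_of_one_le_left a1 h1H
      have b2 := le_mul_of_one_le_left a2 h1H
      nlinarith

end

section
open Complex Metric Set Filter Topology MeasureTheory
open ArithmeticFunction in
noncomputable def trc (U : ℕ) (f : ArithmeticFunction ℝ) : ArithmeticFunction ℝ := ⟨fun n => if n ≤ U then f n else 0, by simp⟩

lemma trc_apply (U : ℕ) (f : ArithmeticFunction ℝ) (n : ℕ) : trc U f n = if n ≤ U then f n else 0 := rfl

lemma sub_trc_apply (U : ℕ) (f : ArithmeticFunction ℝ) (n : ℕ) : (f - trc U f) n = if n ≤ U then 0 else f n := by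
  rw [sub_eq_add_neg, ArithmeticFunction.add_apply, ArithmeticFunction.neg_apply, trc_apply]
  split_ifs <;> simp

lemma conv_ee (f g : ArithmeticFunction ℝ) (x : ℕ) (θ : ℝ) :
    ∑ n ∈ Finset.Ioc 0 x, ((f * g) n : ℂ) * ee (n * θ) = ∑ d ∈ Finset.Ioc 0 x, ∑ k ∈ Finset.Ioc 0 (x / d), (f d : ℂ) * g k * ee (d * k * θ) := by
  have h1 : ∀ n ∈ Finset.Ioc 0 x, ((f * g) n : ℂ) * ee (n * θ) =
      ∑ p ∈ Finset.Ioc 0 x ×ˢ Finset.Ioc 0 x, if p.1 * p.2 = n then (f p.1 : ℂ) * g p.2 * ee (p.1 * p.2 * θ) else 0 := by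
    intro n hn
    rw [Finset.mem_Ioc] at hn
    rw [ArithmeticFunction.mul_apply, Nat.divisorsAntidiagonal_eq_prod_filter_of_le hn.1.ne' hn.2]
    push_cast
    rw [Finset.sum_mul, ← Finset.sum_filter]
    refine Finset.sum_congr rfl fun p hp => ?_
    rw [← (Finset.mem_filter.1 hp).2]; push_cast; rfl
  rw [Finset.sum_congr rfl h1, Finset.sum_comm, Finset.sum_product]
  refine Finset.sum_congr rfl fun d hd => ?_
  have h2 : ∀ k ∈ Finset.Ioc 0 x, (∑ n ∈ Finset.Ioc 0 x, if d * k = n then (f d : ℂ) * g k * ee (d * k * θ) else 0) =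
      if k ≤ x / d then (f d : ℂ) * g k * ee (d * k * θ) else 0 := by
    intro k hk
    rw [Finset.mem_Ioc] at hd hk
    rw [Finset.sum_ite_eq]
    refine if_congr ?_ rfl rfl
    rw [Nat.le_div_iff_mul_le hd.1, Finset.mem_Ioc, mul_comm d k]
    have : 0 < k * d := Nat.mul_pos hk.1 hd.1
    tauto
  rw [Finset.sum_congr rfl h2, ← Finset.sum_filter]
  refine Finset.sum_congr ?_ fun _ _ => rfl
  ext k
  have := Nat.div_le_self x d
  simp only [Finset.mem_filter, Finset.mem_Ioc]; omega

lemma typeI (f g : ArithmeticFunction ℝ) (x : ℕ) (θ : ℝ) (V : ℕ) {F G : ℝ} (hF0 : 0 ≤ F) (hG0 : 0 ≤ G) (hf : ∀ d, V < d → f d = 0) (hF : ∀ d, d ≤ x → |f d| ≤ F)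
    (hG : ∀ d, 0 < d → d ≤ V → ‖∑ k ∈ Finset.Ioc 0 (x / d), (g k : ℂ) * ee (k * (d * θ))‖ ≤ G) :
    ‖∑ n ∈ Finset.Ioc 0 x, ((f * g) n : ℂ) * ee (n * θ)‖ ≤ V * F * G := by
  rw [conv_ee]
  have h1 : ‖∑ d ∈ Finset.Ioc 0 x, ∑ k ∈ Finset.Ioc 0 (x / d), (f d : ℂ) * g k * ee (d * k * θ)‖ ≤ ∑ d ∈ Finset.Ioc 0 x, if d ≤ V then F * G else 0 := by
    refine norm_sum_le_of_le _ fun d hd => ?_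
    rw [Finset.mem_Ioc] at hd
    split_ifs with h
    · have e : ∑ k ∈ Finset.Ioc 0 (x / d), (f d : ℂ) * g k * ee (d * k * θ) = f d * ∑ k ∈ Finset.Ioc 0 (x / d), (g k : ℂ) * ee (k * (d * θ)) := by
        rw [Finset.mul_sum]
        refine Finset.sum_congr rfl fun k _ => ?_
        rw [mul_assoc, show (d : ℝ) * k * θ = k * (d * θ) by ring]
      rw [e, norm_mul, Complex.norm_real, Real.norm_eq_abs]
      exact mul_le_mul (hF d hd.2) (hG d hd.1 h) (norm_nonneg _) hF0
    · rw [hf d (by omega)]; simp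
  refine h1.trans ?_
  rw [← Finset.sum_filter, Finset.sum_const, nsmul_eq_mul, mul_assoc]
  refine mul_le_mul_of_nonneg_right ?_ (by positivity)
  have : ((Finset.Ioc 0 x).filter (· ≤ V)).card ≤ (Finset.Ioc 0 V).card := Finset.card_le_card fun d hd => by simp at hd ⊢; omega
  rw [Nat.card_Ioc] at this
  exact_mod_cast this

lemma sum_Ioc0 (Y : ℕ) (f : ℕ → ℂ) : ∑ k ∈ Finset.Ioc 0 Y, f k = ∑ k ∈ Finset.range (Y + 1), f k - f 0 := by
  have : Finset.range (Y + 1) = insert 0 (Finset.Ioc 0 Y) := by ext; simp only [Finset.mem_range, Finset.mem_insert, Finset.mem_Ioc]; omega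
  rw [this, Finset.sum_insert (by simp)]; ring

lemma inner_one {t : ℝ} (ht : 0 < nn t) (Y : ℕ) : ‖∑ k ∈ Finset.Ioc 0 Y, ee (k * t)‖ ≤ 1 / (2 * nn t) + 1 := by
  rw [sum_Ioc0]
  refine (norm_sub_le _ _).trans (add_le_add (geo_ee t ht _) ?_)
  rw [ee_norm]

lemma inner_log {t : ℝ} (ht : 0 < nn t) (Y : ℕ) : ‖∑ k ∈ Finset.Ioc 0 Y, (Real.log k : ℂ) * ee (k * t)‖ ≤ 1 / (2 * nn t) * (2 * Real.log Y) := by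
  rw [sum_Ioc0]
  have := abel_var (geo_ee t ht) (g := fun n => (Real.log n : ℂ)) (Y + 1)
  simp only [Nat.cast_zero, Real.log_zero, ofReal_zero, zero_mul, sub_zero, mul_comm (Real.log _ : ℂ)] at this ⊢
  refine this.trans_eq ?_
  have h1 : ∀ n ∈ Finset.range Y, ‖(Real.log (n + 1 : ℕ) : ℂ) - Real.log n‖ = Real.log (n + 1 : ℕ) - Real.log n := by
    intro n _
    rw [← ofReal_sub, Complex.norm_real, Real.norm_of_nonneg]
    rcases Nat.eq_zero_or_pos n with rfl | h
    · simp
    · have : (0 : ℝ) < n := by exact_mod_cast h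
      have := Real.log_le_log this (by push_cast; linarith : (n : ℝ) ≤ (n + 1 : ℕ))
      linarith
  rw [Nat.add_sub_cancel, Finset.sum_congr rfl h1, Finset.sum_range_sub (fun n : ℕ => Real.log n), Complex.norm_real, Real.norm_of_nonneg (Real.log_natCast_nonneg _)]
  simp; left; ring

open ArithmeticFunction in
lemma vaughan_raw {θ : ℝ} {a : ℤ} {q : ℕ} (hq : 2 ≤ q) (hc : IsCoprime a (q : ℤ)) (hθ : |θ - a / q| ≤ 1 / (q : ℝ) ^ 2) (x U : ℕ) (hU : 0 < U) (hx : 0 < x) (hUq : 2 * U ^ 2 ≤ q)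
    {L : ℝ} (hL : Real.log x ≤ L) (h1H : 1 ≤ L) (hH1 : HH x ≤ L) (hH2 : HH (2 * q) ≤ L) :
    ‖∑ n ∈ Finset.Ioc 0 x, (vonMangoldt n : ℂ) * ee (n * θ)‖ ≤
      5 * U ^ 2 * q * L + √(56 * L ^ 5 * ((x : ℝ) ^ 2 / q + (x : ℝ) ^ 2 / U + x * q)) := by
  have hq' : (0 : ℝ) < q := by exact_mod_cast (by omega : 0 < q)
  have hq1 : (1 : ℝ) ≤ q := by exact_mod_cast (by omega : 1 ≤ q)
  have hU' : (1 : ℝ) ≤ U := by exact_mod_cast hU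
  have hlog : ∀ n, n ≤ x → Real.log n ≤ L := by
    intro n hn
    rcases Nat.eq_zero_or_pos n with rfl | h
    · simp; linarith
    · exact (Real.log_le_log (by exact_mod_cast h) (by exact_mod_cast hn)).trans hL
  set Λ' : ArithmeticFunction ℝ := vonMangoldt
  set μ' : ArithmeticFunction ℝ := (moebius : ArithmeticFunction ℝ)
  set z : ArithmeticFunction ℝ := (zeta : ArithmeticFunction ℝ)
  set av := trc U Λ' with hav
  set m := trc U μ' with hm
  have hμ : ∀ n, |μ' n| ≤ 1 := fun n => by
    change |((moebius n : ℤ) : ℝ)| ≤ 1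
    exact_mod_cast abs_moebius_le_one (n := n)
  have hz : ∀ n, z n = if n = 0 then 0 else 1 := fun n => by
    change ((zeta n : ℕ) : ℝ) = _; rw [zeta_apply]; split_ifs <;> simp
  have hd : ∀ d : ℕ, 0 < d → d ≤ U ^ 2 → 1 / (2 * (q : ℝ)) ≤ nn (d * θ) := by
    intro d h1 h2
    have := sep (by omega) hc hθ (d := d) (by exact_mod_cast h1.ne') (by rw [abs_of_nonneg (by positivity)]; exact_mod_cast (by omega : 2 * d ≤ q))
    exact_mod_cast this
  have hd' : ∀ d : ℕ, 0 < d → d ≤ U ^ 2 → 0 < nn (d * θ) ∧ 1 / (2 * nn (d * θ)) ≤ q := by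
    intro d h1 h2
    have h3 := hd d h1 h2
    have h4 : 0 < nn (d * θ) := lt_of_lt_of_le (by positivity) h3
    refine ⟨h4, ?_⟩
    rw [div_le_iff₀ (by positivity)] at h3 ⊢
    linarith
  have id : Λ' = av + m * ArithmeticFunction.log - av * m * z + (μ' - m) * ((Λ' - av) * z) := by
    have e1 : Λ' * z = ArithmeticFunction.log := vonMangoldt_mul_zeta
    have e2 : μ' * z = 1 := coe_moebius_mul_coe_zeta
    linear_combination (Λ' - av) * (-e2) + m * e1
  have hΛ : ∀ n, n ≤ x → |Λ' n| ≤ L := fun n hn => by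
    rw [abs_of_nonneg vonMangoldt_nonneg]; exact vonMangoldt_le_log.trans (hlog n hn)
  -- S1
  have S1 : ‖∑ n ∈ Finset.Ioc 0 x, (av n : ℂ) * ee (n * θ)‖ ≤ U * L := by
    have := typeI av 1 x θ U (F := L) (G := 1) (by linarith) (by norm_num) (fun d hd => by rw [hav, trc_apply, if_neg (by omega)])
      (fun d hd => by
        rw [hav, trc_apply]; split_ifs
        · exact hΛ d hd
        · simp; linarith) (fun d h1 h2 => by
          refine (norm_sum_le_of_le (n := fun k => if k = 1 then 1 else 0) _ fun k _ => ?_).trans ?_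
          · rw [norm_mul, ee_norm, one_apply]; split_ifs <;> simp
          · rw [Finset.sum_ite_eq']; split_ifs <;> norm_num)
    rwa [mul_one, mul_one] at this
  have S2 : ‖∑ n ∈ Finset.Ioc 0 x, ((m * ArithmeticFunction.log) n : ℂ) * ee (n * θ)‖ ≤ U * 1 * (q * (2 * L)) := by
    refine typeI m ArithmeticFunction.log x θ U (F := 1) (by norm_num) (mul_nonneg hq'.le (by linarith)) (fun d hd => by rw [hm, trc_apply, if_neg (by omega)])
      (fun d hd => by
        rw [hm, trc_apply]; split_ifs
        · exact hμ d
        · simp) fun d h1 h2 => ?_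
    have h3 := hd' d h1 (by nlinarith)
    simp only [log_apply]
    refine (inner_log h3.1 _).trans (mul_le_mul h3.2 ?_ (by have := Real.log_natCast_nonneg (x / d); positivity) (by positivity))
    have := hlog (x / d) (Nat.div_le_self _ _)
    linarith
  have hmnorm : ∀ d, |m d| ≤ 1 := fun d => by
    rw [hm, trc_apply]; split_ifs
    · exact hμ d
    · simp
  have hav0 : ∀ d, 0 ≤ av d ∧ av d ≤ Λ' d := fun d => by
    rw [hav, trc_apply]; split_ifs
    · exact ⟨vonMangoldt_nonneg, le_rfl⟩
    · exact ⟨le_rfl, vonMangoldt_nonneg⟩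
  have hconv : ∀ d : ℕ, ∑ p ∈ d.divisorsAntidiagonal, Λ' p.1 = Real.log d := fun d => by
    rw [Nat.sum_divisorsAntidiagonal (f := fun i _ => Λ' i)]; exact vonMangoldt_sum
  have S3 : ‖∑ n ∈ Finset.Ioc 0 x, ((av * m * z) n : ℂ) * ee (n * θ)‖ ≤ (U ^ 2 : ℕ) * L * (2 * q) := by
    refine typeI (av * m) z x θ (U ^ 2) (F := L) (by linarith) (by positivity) (fun d hd => ?_) (fun d hd => ?_) fun d h1 h2 => ?_
    · rw [mul_apply]
      refine Finset.sum_eq_zero fun p hp => ?_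
      rw [Nat.mem_divisorsAntidiagonal] at hp
      rw [hav, hm, trc_apply, trc_apply]
      split_ifs with h1 h2 <;> simp
      exfalso; nlinarith
    · rw [mul_apply]
      refine (Finset.abs_sum_le_sum_abs _ _).trans (le_trans ?_ (hlog d hd))
      rw [← hconv d]
      refine Finset.sum_le_sum fun p _ => ?_
      rw [abs_mul, abs_of_nonneg (hav0 _).1]
      have := hmnorm p.2
      nlinarith [(hav0 p.1).1, (hav0 p.1).2, abs_nonneg (m p.2)]
    · have h3 := hd' d h1 h2
      have : ∑ k ∈ Finset.Ioc 0 (x / d), (z k : ℂ) * ee (k * (d * θ)) = ∑ k ∈ Finset.Ioc 0 (x / d), ee (k * (d * θ)) := by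
        refine Finset.sum_congr rfl fun k hk => ?_
        rw [hz, if_neg (Finset.mem_Ioc.1 hk).1.ne']; simp
      rw [this]
      refine (inner_one h3.1 _).trans ?_
      linarith [h3.2]
  have hβ : ∀ k, 0 ≤ ((Λ' - av) * z) k ∧ ((Λ' - av) * z) k ≤ Real.log k := by
    intro k
    rw [mul_apply, ← hconv k]
    have hh : ∀ d, 0 ≤ (Λ' - av) d ∧ (Λ' - av) d ≤ Λ' d := fun d => by
      rw [hav, sub_trc_apply]; split_ifs
      · exact ⟨le_rfl, vonMangoldt_nonneg⟩
      · exact ⟨vonMangoldt_nonneg, le_rfl⟩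
    have hz2 : ∀ d, 0 ≤ z d ∧ z d ≤ 1 := fun d => by rw [hz]; split_ifs <;> norm_num
    constructor
    · exact Finset.sum_nonneg fun p _ => mul_nonneg (hh _).1 (hz2 _).1
    · exact Finset.sum_le_sum fun p _ => (mul_le_of_le_one_right (hh _).1 (hz2 _).2).trans (hh _).2
  have hβ0 : ∀ k, k ≤ U → ((Λ' - av) * z) k = 0 := by
    intro k hk
    rw [mul_apply]
    refine Finset.sum_eq_zero fun p hp => ?_
    rw [hav, sub_trc_apply, if_pos ((Nat.le_of_dvd (by have := Nat.mem_divisorsAntidiagonal.1 hp; omega) ⟨p.2, (Nat.mem_divisorsAntidiagonal.1 hp).1.symm⟩).trans hk), zero_mul]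
  have S4 : ‖∑ n ∈ Finset.Ioc 0 x, (((μ' - m) * ((Λ' - av) * z)) n : ℂ) * ee (n * θ)‖ ≤ √(56 * L ^ 5 * ((x : ℝ) ^ 2 / q + (x : ℝ) ^ 2 / U + x * q)) := by
    rw [conv_ee]
    refine Real.le_sqrt_of_sq_le ?_
    have := typeII hq hc hθ x U hU (fun d => (μ' - m) d) (fun k => ((Λ' - av) * z) k) (L := L) (H := L) (fun d => by
        rw [hm, sub_trc_apply]; split_ifs
        · simp
        · exact hμ d) (fun k hk => by
        rw [abs_of_nonneg (hβ k).1]; exact (hβ k).2.trans (hlog k hk)) h1H hH1 hH2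
    rw [show 56 * L ^ 5 = 56 * L ^ 2 * L ^ 3 by ring]
    convert this using 3
    · rw [← Finset.sum_subset (s₁ := Finset.Ioc U x) (fun d hd => by simp at hd ⊢; omega)]
      · refine Finset.sum_congr rfl fun d _ => ?_
        rw [← Finset.sum_subset (s₁ := Finset.Ioc U (x / d)) (fun d hd => by simp at hd ⊢; omega)]
        intro k h1 h2
        rw [hβ0 k (by simp at h1 h2; omega)]; simp
      · intro d h1 h2
        refine Finset.sum_eq_zero fun k _ => ?_
        rw [hm, sub_trc_apply, if_pos (by simp at h1 h2; omega)]; simp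
  have e : ∑ n ∈ Finset.Ioc 0 x, (Λ' n : ℂ) * ee (n * θ) = ∑ n ∈ Finset.Ioc 0 x, (av n : ℂ) * ee (n * θ) + ∑ n ∈ Finset.Ioc 0 x, ((m * ArithmeticFunction.log) n : ℂ) * ee (n * θ)
      - ∑ n ∈ Finset.Ioc 0 x, ((av * m * z) n : ℂ) * ee (n * θ) + ∑ n ∈ Finset.Ioc 0 x, (((μ' - m) * ((Λ' - av) * z)) n : ℂ) * ee (n * θ) := by
    rw [← Finset.sum_add_distrib, ← Finset.sum_sub_distrib, ← Finset.sum_add_distrib]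
    refine Finset.sum_congr rfl fun n _ => ?_
    have := DFunLike.congr_fun id n
    rw [ArithmeticFunction.add_apply, sub_eq_add_neg, ArithmeticFunction.add_apply, ArithmeticFunction.add_apply, ArithmeticFunction.neg_apply] at this
    rw [this]; push_cast; ring
  rw [e]
  refine (norm_add_le _ _).trans (add_le_add ?_ S4)
  refine (norm_sub_le _ _).trans ((add_le_add ((norm_add_le _ _).trans (add_le_add S1 S2)) S3).trans ?_)
  push_cast
  have a1 : (U : ℝ) * L ≤ U ^ 2 * q * L := by
    have : (U : ℝ) ≤ U ^ 2 * q := by nlinarith [mul_le_mul hU' hq1 zero_le_one (by positivity)]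
    nlinarith
  have a2 : (U : ℝ) * q * L ≤ U ^ 2 * q * L := by
    have : (U : ℝ) ≤ U ^ 2 := by nlinarith
    gcongr
  nlinarith

lemma vaughan (k : ℕ) : ∀ᶠ Q : ℝ in atTop, ∀ N : ℕ, Real.log N = Real.log Q ^ 3 → ∀ (θ : ℝ) (a : ℤ) (q : ℕ), IsCoprime a (q : ℤ) → |θ - a / q| ≤ 1 / (q : ℝ) ^ 2 →
    Q ^ (5 * k + 8) ≤ q → q * Q ^ (5 * k + 8) ≤ N → ∀ x : ℕ, x ≤ 2 * N → ‖∑ n ∈ Finset.Ioc 0 x, (ArithmeticFunction.vonMangoldt n : ℂ) * ee (n * θ)‖ ≤ N / Q ^ k := by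
  filter_upwards [ev_log (10 ^ 10) 15, ev_const 10, ev_llog 3] with Q h1 h2 h3 N hN θ a q hc hθ hq1 hq2 x hx
  have hQ0 : 0 < Q := by linarith
  have hN0 : (0 : ℝ) < N := by
    rcases Nat.eq_zero_or_pos N with rfl | h
    · simp at hN; have := pow_pos (by linarith : 0 < Real.log Q) 3; linarith
    · exact_mod_cast h
  rcases Nat.eq_zero_or_pos x with rfl | hx0
  · simp; positivity
  set i := 2 * k + 3
  set U := ⌊Q ^ i⌋₊
  have hQi : Q ≤ Q ^ i := le_self_pow₀ (by linarith) (by omega)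
  have hU1 : (U : ℝ) ≤ Q ^ i := Nat.floor_le (by positivity)
  have hU2 : Q ^ i / 2 ≤ U := by have := Nat.lt_floor_add_one (Q ^ i); change Q ^ i < U + 1 at this; linarith
  have hU0 : 0 < U := Nat.floor_pos.2 (by linarith)
  have hUr : (0 : ℝ) < U := by exact_mod_cast hU0
  set L := 2 * Real.log Q ^ 3 with hL
  have hl3 : 27 ≤ Real.log Q ^ 3 := by nlinarith [pow_le_pow_left₀ (by norm_num) h3 3]
  have hxN : (x : ℝ) ≤ 2 * N := by exact_mod_cast hx
  have hx0' : (0 : ℝ) < x := by exact_mod_cast hx0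
  have hQj : Q ≤ Q ^ (5 * k + 8) := le_self_pow₀ (by linarith) (by omega)
  have hqN : (q : ℝ) ≤ N := by nlinarith [(Nat.cast_nonneg q : (0 : ℝ) ≤ q)]
  have hq0 : (0 : ℝ) < q := by linarith
  have hlog2 : Real.log 2 ≤ 1 := by have := Real.log_two_lt_d9; linarith
  have hlx : ∀ y : ℕ, 0 < y → (y : ℝ) ≤ 2 * N → 1 + Real.log y ≤ L := by
    intro y hy0 hy
    have := Real.log_le_log (by exact_mod_cast hy0) hy
    rw [Real.log_mul (by norm_num) hN0.ne', hN] at this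
    linarith
  have hUU : (U : ℝ) ^ 2 ≤ Q ^ (4 * k + 6) := by
    calc (U : ℝ) ^ 2 ≤ (Q ^ i) ^ 2 := by gcongr
      _ = _ := by rw [← pow_mul]; congr 1; simp only [i]; ring
  have hq2' : 2 ≤ q := by have : (2 : ℝ) ≤ q := by linarith
                          exact_mod_cast this
  have key := vaughan_raw hq2' hc hθ x U hU0 hx0 (by
      have : (2 : ℝ) * U ^ 2 ≤ q := by
        refine le_trans ?_ hq1
        calc (2 : ℝ) * U ^ 2 ≤ Q * Q ^ (4 * k + 6) := by gcongr; linarith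
          _ = Q ^ (4 * k + 7) := by ring
          _ ≤ _ := pow_le_pow_right₀ (by linarith) (by omega)
      exact_mod_cast this) (L := L) (by have := hlx x hx0 hxN; linarith) (by linarith) ((HH_le x).trans (hlx x hx0 hxN))
      ((HH_le _).trans (hlx _ (by omega) (by push_cast; linarith)))
  refine key.trans ?_
  have hLQ : 10 ^ 8 * L ^ 5 ≤ Q := by
    have : L ^ 5 = 32 * Real.log Q ^ 15 := by rw [hL]; ring
    rw [this]; linarith [pow_pos (by linarith : 0 < Real.log Q) 15]
  have hL1 : 1 ≤ L := by linarith
  have hLL : L ≤ L ^ 5 := le_self_pow₀ hL1 (by norm_num)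
  have p1 : 5 * (U : ℝ) ^ 2 * q * L ≤ N / Q ^ k / 2 := by
    rw [div_div, le_div_iff₀ (by positivity)]
    calc 5 * (U : ℝ) ^ 2 * q * L * (Q ^ k * 2) ≤ 5 * Q ^ (4 * k + 6) * q * L * (Q ^ k * 2) := by gcongr
      _ = q * Q ^ (5 * k + 6) * (10 * L) := by ring
      _ ≤ q * Q ^ (5 * k + 6) * Q ^ 2 := by gcongr; nlinarith
      _ = q * Q ^ (5 * k + 8) := by ring
      _ ≤ N := hq2
  have p2 : √(56 * L ^ 5 * ((x : ℝ) ^ 2 / q + (x : ℝ) ^ 2 / U + x * q)) ≤ N / Q ^ k / 2 := by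
    refine Real.sqrt_le_iff.2 ⟨by positivity, ?_⟩
    have hj : Q ^ i ≤ Q ^ (5 * k + 8) := pow_le_pow_right₀ (by linarith) (by omega)
    have t1 : (x : ℝ) ^ 2 / q ≤ 4 * N ^ 2 / Q ^ i := by
      rw [show (4 : ℝ) * N ^ 2 = (2 * N) ^ 2 by ring]; gcongr; linarith
    have t2 : (x : ℝ) ^ 2 / U ≤ 8 * N ^ 2 / Q ^ i := by
      calc (x : ℝ) ^ 2 / U ≤ (2 * N) ^ 2 / (Q ^ i / 2) := by gcongr
        _ = _ := by field_simp; ring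
    have t3 : (x : ℝ) * q ≤ 2 * N ^ 2 / Q ^ i := by
      rw [le_div_iff₀ (by positivity)]
      calc (x : ℝ) * q * Q ^ i ≤ (2 * N) * (q * Q ^ (5 * k + 8)) := by rw [mul_assoc]; gcongr
        _ ≤ (2 * N) * N := by gcongr
        _ = _ := by ring
    calc 56 * L ^ 5 * ((x : ℝ) ^ 2 / q + (x : ℝ) ^ 2 / U + x * q) ≤ 56 * L ^ 5 * (4 * N ^ 2 / Q ^ i + 8 * N ^ 2 / Q ^ i + 2 * N ^ 2 / Q ^ i) := by gcongr
      _ = (784 * L ^ 5) * (N ^ 2 / Q ^ i) := by ring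
      _ ≤ Q * (N ^ 2 / Q ^ i) := by
        have : 0 ≤ L ^ 5 := by positivity
        gcongr; linarith
      _ = N ^ 2 / Q ^ (2 * k + 2) := by
        rw [show Q ^ i = Q * Q ^ (2 * k + 2) by rw [← pow_succ']]; field_simp
      _ ≤ (N / Q ^ k / 2) ^ 2 := by
        rw [div_div, div_pow, show Q ^ (2 * k + 2) = (Q ^ k) ^ 2 * Q ^ 2 by ring, mul_pow]
        gcongr
        linarith
  linarith

end

section
open Complex Metric Set Filter Topology MeasureTheory

lemma ee_eq_one {t : ℝ} (h : ee t = 1) : ∃ k : ℤ, t = k := by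
  unfold ee at h
  rw [Complex.exp_eq_one_iff] at h
  obtain ⟨k, hk⟩ := h
  refine ⟨k, ?_⟩
  have h2 : ((2 * Real.pi * t : ℝ) : ℂ) = ((2 * Real.pi * k : ℝ) : ℂ) := by
    have hI := Complex.I_ne_zero
    apply mul_right_cancel₀ hI; rw [hk]; push_cast; ring
  have h3 := Complex.ofReal_injective h2
  have := Real.pi_pos
  exact mul_left_cancel₀ (by positivity) h3

lemma orth {m : ℕ} (hm : 0 < m) (t : ℤ) : ∑ j ∈ Finset.range m, ee (j * (t / m)) = if (m : ℤ) ∣ t then (m : ℂ) else 0 := by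
  have hm' : (m : ℝ) ≠ 0 := by exact_mod_cast hm.ne'
  simp only [ee_nmul]
  split_ifs with h
  · obtain ⟨s, rfl⟩ := h
    have : ((m * s : ℤ) : ℝ) / m = (s : ℤ) := by push_cast; field_simp
    rw [this, ee_int]; simp
  · have hne : ee (t / m) ≠ 1 := by
      intro h1
      obtain ⟨k, hk⟩ := ee_eq_one h1
      rw [div_eq_iff hm'] at hk
      exact h ⟨k, by rw [mul_comm]; exact_mod_cast hk⟩
    rw [geom_sum_eq hne, ← ee_nmul, mul_div_cancel₀ _ hm', ee_int, sub_self, zero_div]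

lemma fourier_bd {m : ℕ} (hm : 0 < m) (Φ : ℕ → ℂ) {C : ℝ} (hper : ∀ n, Φ (n + m) = Φ n) (hC : ∀ n, ‖Φ n‖ ≤ C) (s : Finset ℕ) (u : ℕ → ℂ) {E : ℝ}
    (hE : ∀ j ∈ Finset.range m, ‖∑ n ∈ s, u n * ee (n * (j / m))‖ ≤ E) : ‖∑ n ∈ s, u n * Φ n‖ ≤ m * C * E := by
  have hm' : (m : ℂ) ≠ 0 := by exact_mod_cast hm.ne'
  set c : ℕ → ℂ := fun j => (∑ b ∈ Finset.range m, Φ b * ee (-(b * (j / m)))) / m with hc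
  have hcn : ∀ j, ‖c j‖ ≤ C := by
    intro j
    simp only [hc]
    rw [norm_div, norm_natCast, div_le_iff₀ (by exact_mod_cast hm)]
    refine (norm_sum_le_of_le (n := fun _ => C) _ fun b _ => ?_).trans ?_
    · rw [norm_mul, ee_norm, mul_one]; exact hC b
    · rw [Finset.sum_const, Finset.card_range, nsmul_eq_mul, mul_comm]
  have hinv : ∀ n, Φ n = ∑ j ∈ Finset.range m, c j * ee (n * (j / m)) := by
    intro n
    have h1 : ∑ j ∈ Finset.range m, c j * ee (n * (j / m)) = ∑ b ∈ Finset.range m, Φ b / m * ∑ j ∈ Finset.range m, ee (j * (((n : ℤ) - b : ℤ) / m)) := by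
      simp only [hc, Finset.mul_sum, Finset.sum_div, Finset.sum_mul]
      rw [Finset.sum_comm]
      refine Finset.sum_congr rfl fun b _ => Finset.sum_congr rfl fun j _ => ?_
      rw [show (j : ℝ) * (((n : ℤ) - b : ℤ) / m) = -(b * (j / m)) + n * (j / m) by push_cast; ring, ee_add]
      ring
    rw [h1]
    simp only [orth hm]
    rw [Finset.sum_eq_single (n % m)]
    · rw [if_pos]
      · rw [div_mul_cancel₀ _ hm']
        have : Function.Periodic Φ m := hper
        exact (this.map_mod_nat n).symm
      · rw [Int.natCast_mod]; exact Int.dvd_self_sub_emod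
    · intro b hb hne
      rw [if_neg, mul_zero]
      intro h
      apply hne
      have h2 : (b : ℤ) ≡ n [ZMOD m] := (Int.modEq_iff_dvd).2 h
      have h3 := (Int.natCast_modEq_iff).1 h2
      rw [Nat.ModEq, Nat.mod_eq_of_lt (Finset.mem_range.1 hb)] at h3
      exact h3
    · intro h; exact absurd (Finset.mem_range.2 (Nat.mod_lt _ hm)) h
  have e : ∑ n ∈ s, u n * Φ n = ∑ j ∈ Finset.range m, c j * ∑ n ∈ s, u n * ee (n * (j / m)) := by
    simp only [Finset.mul_sum]
    rw [Finset.sum_comm]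
    refine Finset.sum_congr rfl fun n _ => ?_
    rw [hinv n, Finset.mul_sum]
    refine Finset.sum_congr rfl fun j _ => by ring
  rw [e]
  refine (norm_sum_le_of_le (n := fun _ => C * E) _ fun j hj => ?_).trans ?_
  · rw [norm_mul]
    exact mul_le_mul (hcn j) (hE j hj) (norm_nonneg _) ((norm_nonneg _).trans (hC 0))
  · rw [Finset.sum_const, Finset.card_range, nsmul_eq_mul, mul_assoc]

lemma lam_to_primes {W r : ℕ} (hW : 0 < W) (hr : 0 < r) (F : ℕ → ℂ) (hF : ∀ n, F (n + r) = F n) (θ : ℝ) (x : ℕ) :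
    ‖∑ n ∈ Finset.range x, (lam W n : ℂ) * F n * ee (n * θ)‖ ≤
    ‖∑ p ∈ Finset.Ioc 0 (W * x), ((if p.Prime then (Real.log p : ℂ) else 0) * ee (p * (θ / W))) * (if W ∣ p + (r * W - 1) then F ((p + (r * W - 1)) / W) else 0)‖ := by
  have hW' : (W : ℝ) ≠ 0 := by exact_mod_cast hW.ne'
  have hrW : 0 < r * W := Nat.mul_pos hr hW
  have hinj : Set.InjOn (fun n => W * n + 1) (Finset.range x) := fun i _ j _ h => by
    have : W * i = W * j := by simpa using h
    exact Nat.eq_of_mul_eq_mul_left hW this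
  have e : ∑ p ∈ Finset.Ioc 0 (W * x), ((if p.Prime then (Real.log p : ℂ) else 0) * ee (p * (θ / W))) * (if W ∣ p + (r * W - 1) then F ((p + (r * W - 1)) / W) else 0) =
      ∑ n ∈ Finset.range x, (if (W * n + 1).Prime then (Real.log (W * n + 1 : ℕ) : ℂ) else 0) * F n * ee (n * θ) * ee (θ / W) := by
    have h1 : ∑ n ∈ Finset.range x, (if (W * n + 1).Prime then (Real.log (W * n + 1 : ℕ) : ℂ) else 0) * F n * ee (n * θ) * ee (θ / W) =
        ∑ n ∈ Finset.range x, (fun p : ℕ => ((if p.Prime then (Real.log p : ℂ) else 0) * ee (p * (θ / W))) * (if W ∣ p + (r * W - 1) then F ((p + (r * W - 1)) / W) else 0)) (W * n + 1) := by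
      refine Finset.sum_congr rfl fun n _ => ?_
      have h2 : W * n + 1 + (r * W - 1) = W * (n + r) := by
        rw [add_assoc, show 1 + (r * W - 1) = r * W by omega]; ring
      simp only []
      rw [h2, if_pos (Dvd.intro _ rfl), Nat.mul_div_cancel_left _ hW, hF,
        show ((W * n + 1 : ℕ) : ℝ) * (θ / W) = n * θ + θ / W by push_cast; field_simp, ee_add]
      ring
    rw [h1, ← Finset.sum_image (f := fun p : ℕ => ((if p.Prime then (Real.log p : ℂ) else 0) * ee (p * (θ / W))) * (if W ∣ p + (r * W - 1) then F ((p + (r * W - 1)) / W) else 0)) hinj]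
    symm
    refine Finset.sum_subset ?_ ?_
    · intro p hp
      obtain ⟨n, hn, rfl⟩ := Finset.mem_image.1 hp
      have := Finset.mem_range.1 hn
      rw [Finset.mem_Ioc]
      exact ⟨by omega, by nlinarith⟩
    · intro p hp hp2
      rw [if_neg (c := W ∣ p + (r * W - 1)), mul_zero]
      rintro ⟨s, hs⟩
      apply hp2
      rw [Finset.mem_Ioc] at hp
      have hs1 : r ≤ s := by
        by_contra hlt
        have : W * (s + 1) ≤ W * r := Nat.mul_le_mul_left _ (by omega)
        rw [mul_comm W r] at this
        have : W * (s + 1) = W * s + W := by ring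
        omega
      obtain ⟨n, rfl⟩ := Nat.exists_eq_add_of_le hs1
      have h3 : p = W * n + 1 := by
        have : W * (r + n) = r * W + W * n := by ring
        omega
      refine Finset.mem_image.2 ⟨n, Finset.mem_range.2 ?_, h3.symm⟩
      by_contra hge
      have : W * x ≤ W * n := Nat.mul_le_mul_left _ (by omega)
      omega
  rw [e, ← Finset.sum_mul, norm_mul, ee_norm, mul_one]
  have e2 : ∑ n ∈ Finset.range x, (lam W n : ℂ) * F n * ee (n * θ) =
      ((W.totient / W : ℝ) : ℂ) * ∑ n ∈ Finset.range x, (if (W * n + 1).Prime then (Real.log (W * n + 1 : ℕ) : ℂ) else 0) * F n * ee (n * θ) := by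
    rw [Finset.mul_sum]
    refine Finset.sum_congr rfl fun n _ => ?_
    unfold lam
    split_ifs
    · push_cast; ring
    · simp
  rw [e2, norm_mul, Complex.norm_real, Real.norm_of_nonneg (by positivity)]
  refine mul_le_of_le_one_left (norm_nonneg _) ?_
  rw [div_le_one (by exact_mod_cast hW)]
  exact_mod_cast Nat.totient_le W

def Maj (J : ℕ) (Q : ℝ) (N W : ℕ) (θ : ℝ) : Prop := ∃ (a : ℤ) (q : ℕ), 0 < q ∧ (q : ℝ) ≤ Q ^ (J + 1) ∧ |θ - a / q| ≤ W * Q ^ J / N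

lemma prime_exp {Q : ℝ} {k N : ℕ} (hQ : 10 ≤ Q) (hlQ : 10 * Real.log Q ^ 3 ≤ Q) (h1 : 1 ≤ Real.log Q ^ 3) (hN : Real.log N = Real.log Q ^ 3) (hNQ : Q ^ (2 * k + 4) ≤ N) (θ : ℝ) (y : ℕ) (hy : y ≤ 2 * N) {E : ℝ}
    (hE : ‖∑ n ∈ Finset.Ioc 0 y, (ArithmeticFunction.vonMangoldt n : ℂ) * ee (n * θ)‖ ≤ E) :
    ‖∑ p ∈ Finset.Ioc 0 y, (if p.Prime then (Real.log p : ℂ) else 0) * ee (p * θ)‖ ≤ E + N / Q ^ k := by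
  have hQ0 : 0 < Q := by linarith
  have hN0 : (0 : ℝ) < N := lt_of_lt_of_le (by positivity) hNQ
  have e : ∑ p ∈ Finset.Ioc 0 y, (if p.Prime then (Real.log p : ℂ) else 0) * ee (p * θ) =
      ∑ n ∈ Finset.Ioc 0 y, (ArithmeticFunction.vonMangoldt n : ℂ) * ee (n * θ) - ∑ n ∈ Finset.Ioc 0 y with ¬ n.Prime, (ArithmeticFunction.vonMangoldt n : ℂ) * ee (n * θ) := by
    rw [Finset.sum_filter, ← Finset.sum_sub_distrib]
    refine Finset.sum_congr rfl fun p _ => ?_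
    by_cases hp : p.Prime
    · rw [if_pos hp, if_neg (by simpa using hp), ArithmeticFunction.vonMangoldt_apply_prime hp, sub_zero]
    · rw [if_neg hp, if_pos hp]; simp
  rw [e]
  refine (norm_sub_le _ _).trans (add_le_add hE ?_)
  rcases Nat.eq_zero_or_pos y with rfl | hy0
  · simp; positivity
  have h2 : ‖∑ n ∈ Finset.Ioc 0 y with ¬ n.Prime, (ArithmeticFunction.vonMangoldt n : ℂ) * ee (n * θ)‖ ≤ 2 * √(y : ℝ) * Real.log y := by
    refine le_trans ?_ (Chebyshev.psi_sub_theta_le (by exact_mod_cast hy0))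
    rw [Chebyshev.psi_sub_theta_eq_sum_not_prime, Nat.floor_natCast]
    refine norm_sum_le_of_le _ fun n _ => ?_
    rw [norm_mul, ee_norm, mul_one, Complex.norm_real, Real.norm_of_nonneg ArithmeticFunction.vonMangoldt_nonneg]
  refine h2.trans ?_
  have hyN : (y : ℝ) ≤ 2 * N := by exact_mod_cast hy
  have h3 : Real.log y ≤ Q / 5 := by
    have := Real.log_le_log (by exact_mod_cast hy0) hyN
    rw [Real.log_mul (by norm_num) hN0.ne', hN] at this
    have := Real.log_two_lt_d9
    linarith
  have h4 : √(y : ℝ) ≤ 2 * √N := by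
    rw [show (2 : ℝ) * √N = √(4 * N) by rw [Real.sqrt_mul (by norm_num), show (4 : ℝ) = 2 ^ 2 by norm_num, Real.sqrt_sq (by norm_num)]]
    exact Real.sqrt_le_sqrt (by linarith)
  have h5 : Q ^ (k + 2) ≤ √(N : ℝ) := Real.le_sqrt_of_sq_le (by rw [← pow_mul]; convert hNQ using 2; ring)
  calc 2 * √(y : ℝ) * Real.log y ≤ 2 * (2 * √N) * (Q / 5) := by
        have := Real.log_natCast_nonneg y
        gcongr
    _ ≤ √N * Q := by nlinarith [mul_pos (lt_of_lt_of_le (by positivity) h5) hQ0]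
    _ ≤ √N * (√N / Q ^ (k + 1)) := by
      gcongr
      rw [le_div_iff₀ (by positivity)]
      exact le_trans (by rw [← pow_succ']) h5
    _ = N / Q ^ (k + 1) := by rw [← mul_div_assoc, Real.mul_self_sqrt hN0.le]
    _ ≤ N / Q ^ k := by
      gcongr
      · linarith
      · omega

theorem minor (k : ℕ) : ∀ᶠ Q : ℝ in atTop, ∀ N : ℕ, Real.log N = Real.log Q ^ 3 → ∀ W, 0 < W → ∀ θ, ¬ Maj (5 * k + 8) Q N W θ →
    ∀ r : ℕ, 0 < r → (r : ℝ) ≤ Q → ∀ (F : ℕ → ℂ) (C : ℝ), (∀ n, F (n + r) = F n) → (∀ n, ‖F n‖ ≤ C) → ∀ x : ℕ, W * x ≤ 2 * N →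
    ‖∑ n ∈ Finset.range x, (lam W n : ℂ) * F n * ee (n * θ)‖ ≤ r * W * C * (2 * (N / Q ^ k)) := by
  filter_upwards [vaughan k, ev_log 10 3, ev_const 10, ev_llog 1, ev_pow (2 * k + 4), ev_pow (5 * k + 8)] with Q hv h1 h2 h3 h4 h5 N hN W hW θ hθ r hr hrQ F C hF hC x hx
  have hQ0 : 0 < Q := by linarith
  have hNQ := h4 N hN
  have hNJ := h5 N hN
  have hN0 : (0 : ℝ) < N := lt_of_lt_of_le (by positivity) hNQ
  have hrW : 0 < r * W := Nat.mul_pos hr hW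
  have hr' : (0 : ℝ) < r := by exact_mod_cast hr
  have hW' : (0 : ℝ) < W := by exact_mod_cast hW
  have hC0 : 0 ≤ C := (norm_nonneg _).trans (hC 0)
  refine (lam_to_primes hW hr F hF θ x).trans ?_
  refine (fourier_bd hrW _ (C := C) (E := N / Q ^ k + N / Q ^ k) ?_ ?_ _ _ ?_).trans_eq ?_
  · intro n
    have e : n + r * W + (r * W - 1) = n + (r * W - 1) + r * W := by omega
    rw [e, Nat.add_mul_div_right _ _ hW, hF]
    exact if_congr (Nat.dvd_add_left (Dvd.intro_left _ rfl)) rfl rfl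
  · intro n; split_ifs
    · exact hC _
    · simpa using hC0
  · intro j _
    have e : ∀ p : ℕ, (if p.Prime then (Real.log p : ℂ) else 0) * ee (p * (θ / W)) * ee (p * (j / (r * W : ℕ))) = (if p.Prime then (Real.log p : ℂ) else 0) * ee (p * (θ / W + j / (r * W : ℕ))) := by
      intro p; rw [mul_assoc, ← ee_add]; congr 2; ring
    simp only [e]
    set β := θ / W + j / (r * W : ℕ) with hβ
    refine prime_exp h2 h1 (one_le_pow₀ h3) hN hNQ β _ hx ?_
    set M := ⌊N / Q ^ (5 * k + 8)⌋₊ with hM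
    have hM0 : 0 < M := Nat.floor_pos.2 (by rw [le_div_iff₀ (by positivity)]; linarith)
    obtain ⟨s, hs1, hs2⟩ := Real.exists_rat_abs_sub_le_and_den_le β hM0
    have hden : (0 : ℝ) < s.den := by exact_mod_cast s.den_pos
    have hM1 : N / Q ^ (5 * k + 8) ≤ M + 1 := (Nat.lt_floor_add_one _).le
    have hM2 : (M : ℝ) ≤ N / Q ^ (5 * k + 8) := Nat.floor_le (by positivity)
    have hsM : (s.den : ℝ) ≤ M := by exact_mod_cast hs2
    have hs : (s : ℝ) = s.num / s.den := by exact_mod_cast (Rat.num_div_den s).symm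
    rw [hs] at hs1
    by_cases hbig : Q ^ (5 * k + 8) ≤ s.den
    · refine hv N hN β s.num s.den (Int.isCoprime_iff_gcd_eq_one.2 s.reduced) (hs1.trans ?_) hbig ?_ _ hx
      · refine one_div_le_one_div_of_le (by positivity) ?_
        rw [pow_two]; gcongr; linarith
      · rw [← le_div_iff₀ (by positivity)]; linarith
    · exfalso
      apply hθ
      push Not at hbig
      refine ⟨s.num * W * r - j * s.den, s.den * r, Nat.mul_pos s.den_pos hr, ?_, ?_⟩
      · push_cast; rw [pow_succ]; gcongr
      · have e2 : θ - ((s.num * W * r - j * s.den : ℤ) : ℝ) / (s.den * r : ℕ) = W * (β - s.num / s.den) := by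
          rw [hβ]; push_cast; field_simp; ring
        rw [e2, abs_mul, abs_of_pos hW', mul_div_assoc]
        refine mul_le_mul_of_nonneg_left (hs1.trans ?_) hW'.le
        rw [div_le_div_iff₀ (by positivity) hN0]
        rw [div_le_iff₀ (by positivity)] at hM1
        have : (1 : ℝ) ≤ s.den := by exact_mod_cast s.den_pos
        have h7 : (0 : ℝ) < Q ^ (5 * k + 8) := by positivity
        nlinarith [mul_le_mul_of_nonneg_left this (by positivity : (0 : ℝ) ≤ (M + 1) * Q ^ (5 * k + 8))]
  · push_cast; ring

end

section
open Complex Metric Set Filter Topology MeasureTheory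

lemma avg_mul {l D : ℕ} (h : l.Coprime D) (φ Φ : ℕ → ℂ) (h1 : ∀ n, φ (n + l) = φ n) (h2 : ∀ n, Φ (n + D) = Φ n) (hl : 0 < l) (hD : 0 < D) :
    avg (l * D) (fun n => φ n * Φ n) = avg l φ * avg D Φ := by
  unfold avg
  have e : ∑ n ∈ Finset.range (l * D), φ n * Φ n = (∑ x ∈ Finset.range l, φ x) * ∑ y ∈ Finset.range D, Φ y := by
    rw [Finset.sum_mul_sum, ← Finset.sum_product']
    refine Finset.sum_nbij' (fun n => (n % l, n % D)) (fun p => (Nat.chineseRemainder h p.1 p.2 : ℕ)) ?_ ?_ ?_ ?_ ?_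
    · intro n _
      simp only [Finset.mem_product, Finset.mem_range]
      exact ⟨Nat.mod_lt _ hl, Nat.mod_lt _ hD⟩
    · intro p _
      exact Finset.mem_range.2 (Nat.chineseRemainder_lt_mul h _ _ hl.ne' hD.ne')
    · intro n hn
      have c := (Nat.chineseRemainder h (n % l) (n % D)).2
      have h3 : (Nat.chineseRemainder h (n % l) (n % D) : ℕ) ≡ n [MOD l * D] :=
        (Nat.modEq_and_modEq_iff_modEq_mul h).1 ⟨c.1.trans (Nat.mod_modEq _ _), c.2.trans (Nat.mod_modEq _ _)⟩
      exact Nat.ModEq.eq_of_lt_of_lt h3 (Nat.chineseRemainder_lt_mul h _ _ hl.ne' hD.ne') (Finset.mem_range.1 hn)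
    · intro p hp
      rw [Finset.mem_product, Finset.mem_range, Finset.mem_range] at hp
      have c := (Nat.chineseRemainder h p.1 p.2).2
      exact Prod.ext ((show _ % l = p.1 % l from c.1).trans (Nat.mod_eq_of_lt hp.1)) ((show _ % D = p.2 % D from c.2).trans (Nat.mod_eq_of_lt hp.2))
    · intro n _
      rw [(show Function.Periodic φ l from h1).map_mod_nat, (show Function.Periodic Φ D from h2).map_mod_nat]
  rw [e]; push_cast; rw [mul_div_mul_comm]

lemma prod_primes_pos {S : Finset ℕ} (hS : ∀ l ∈ S, l.Prime) : 0 < ∏ l ∈ S, l := Finset.prod_pos fun l hl => (hS l hl).pos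

lemma ee_per {D : ℕ} (hD : 0 < D) (a : ℤ) (n : ℕ) : ee ((n + D : ℕ) * (a / D)) = ee (n * (a / D)) := by
  have : (D : ℝ) ≠ 0 := by exact_mod_cast hD.ne'
  rw [← ee_add_int (n * (a / D)) a]; congr 1; push_cast; field_simp

lemma per_dvd {l D : ℕ} (h : l ∣ D) {φ : ℕ → ℂ} (h1 : ∀ n, φ (n + l) = φ n) (n : ℕ) : φ (n + D) = φ n := by
  obtain ⟨k, rfl⟩ := h
  have := (show Function.Periodic φ l from h1).nat_mul k
  rw [mul_comm]; simpa using this n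

lemma crt_avg (S : Finset ℕ) (hS : ∀ l ∈ S, l.Prime) : ∀ a : ℤ, ∃ b : ℕ → ℤ, (∀ l ∈ S, ((l : ℤ) ∣ b l ↔ (l : ℤ) ∣ a)) ∧
    ∀ φ : ℕ → ℕ → ℂ, (∀ l ∈ S, ∀ n, φ l (n + l) = φ l n) →
      avg (∏ l ∈ S, l) (fun n => (∏ l ∈ S, φ l n) * ee (n * (a / (∏ l ∈ S, l : ℕ)))) = ∏ l ∈ S, avg l (fun n => φ l n * ee (n * (b l / l))) := by
  classical
  induction S using Finset.induction_on with
  | empty => intro a; exact ⟨fun _ => 0, by simp, fun φ _ => by simp [avg, ee_zero]⟩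
  | insert l S hl ih =>
    intro a
    have hS' : ∀ p ∈ S, p.Prime := fun p hp => hS p (Finset.mem_insert_of_mem hp)
    have hlp := hS l (Finset.mem_insert_self _ _)
    set D := ∏ p ∈ S, p with hDdef
    have hD := prod_primes_pos hS'
    rw [← hDdef] at hD
    have hco : l.Coprime D := Nat.Coprime.prod_right fun p hp => (Nat.coprime_primes hlp (hS' p hp)).2 fun h => hl (h ▸ hp)
    obtain ⟨u, v, huv⟩ := Nat.isCoprime_iff_coprime.2 hco
    obtain ⟨b, hb1, hb2⟩ := ih hS' (a * u)
    have hD' : (D : ℝ) ≠ 0 := by exact_mod_cast hD.ne'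
    have hl' : (l : ℝ) ≠ 0 := by exact_mod_cast hlp.ne_zero
    refine ⟨fun p => if p = l then a * v else b p, ?_, ?_⟩
    · intro p hp
      rcases Finset.mem_insert.1 hp with rfl | hp
      · dsimp only
        rw [if_pos rfl]
        exact ⟨fun h => IsCoprime.dvd_of_dvd_mul_right (⟨u, D, by linarith⟩ : IsCoprime (p : ℤ) v) h, fun h => h.mul_right _⟩
      · dsimp only
        rw [if_neg (fun h : p = l => hl (h ▸ hp)), hb1 p hp]
        have hpD : (p : ℤ) ∣ D := by exact_mod_cast Finset.dvd_prod_of_mem _ hp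
        obtain ⟨c, hc⟩ := hpD
        exact ⟨fun h => IsCoprime.dvd_of_dvd_mul_right (⟨v * c, l, by rw [hc] at huv; linarith⟩ : IsCoprime (p : ℤ) u) h, fun h => h.mul_right _⟩
    · intro φ hφ
      rw [Finset.prod_insert hl, Finset.prod_insert hl, ← hDdef]
      dsimp only
      rw [if_pos rfl]
      have e : (fun n => (∏ p ∈ insert l S, φ p n) * ee (n * (a / (l * D : ℕ)))) =
          fun n => (φ l n * ee (n * ((a * v : ℤ) / l))) * ((∏ p ∈ S, φ p n) * ee (n * ((a * u : ℤ) / D))) := by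
        funext n
        have : (n : ℝ) * (a / (l * D : ℕ)) = n * ((a * v : ℤ) / l) + n * ((a * u : ℤ) / D) := by
          have h2 : (u : ℝ) * l + v * D = 1 := by exact_mod_cast huv
          push_cast
          field_simp
          linear_combination (- (n : ℝ) * a) * h2
        rw [this, ee_add, Finset.prod_insert hl]; ring
      rw [e, avg_mul hco _ _ _ _ hlp.pos hD, hb2 φ fun p hp => hφ p (Finset.mem_insert_of_mem hp)]
      · congr 1
        refine Finset.prod_congr rfl fun p hp => ?_
        rw [if_neg (fun h : p = l => hl (h ▸ hp))]
      · intro n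
        rw [hφ l (Finset.mem_insert_self _ _), ee_per hlp.pos]
      · intro n
        rw [ee_per hD]
        congr 1
        refine Finset.prod_congr rfl fun p hp => ?_
        exact per_dvd (Finset.dvd_prod_of_mem _ hp) (hφ p (Finset.mem_insert_of_mem hp)) n

lemma sum_shift {m : ℕ} {Z : ℕ → ℂ} (hZ : ∀ n, Z (n + m) = Z n) (D : ℕ) : ∑ n ∈ Finset.range m, Z (n + D) = ∑ n ∈ Finset.range m, Z n := by
  induction D with
  | zero => simp
  | succ D ih =>
    rw [← ih]
    have h1 := Finset.sum_range_succ (fun n => Z (n + D)) m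
    have h2 := Finset.sum_range_succ' (fun n => Z (n + D)) m
    have h3 := hZ D
    rw [zero_add] at h2
    rw [add_comm m D, h3] at h1
    have h4 : ∑ n ∈ Finset.range m, Z (n + 1 + D) = ∑ n ∈ Finset.range m, Z (n + D) := add_right_cancel (h2.symm.trans h1)
    rw [← h4]
    refine Finset.sum_congr rfl fun n _ => ?_
    congr 1; ring

lemma avg_dvd {D m : ℕ} (hm : 0 < m) (h : D ∣ m) {Z : ℕ → ℂ} (hZ : ∀ n, Z (n + D) = Z n) : avg m Z = avg D Z := by
  obtain ⟨k, rfl⟩ := h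
  have hD : (D : ℂ) ≠ 0 := by exact_mod_cast (Nat.pos_of_mul_pos_right hm).ne'
  have hk : (k : ℂ) ≠ 0 := by exact_mod_cast (Nat.pos_of_mul_pos_left hm).ne'
  have e : ∀ k : ℕ, ∑ n ∈ Finset.range (D * k), Z n = k * ∑ n ∈ Finset.range D, Z n := by
    intro k
    induction k with
    | zero => simp
    | succ k ih =>
      rw [Nat.mul_succ, Finset.sum_range_add, ih]
      have : ∑ x ∈ Finset.range D, Z (D * k + x) = ∑ x ∈ Finset.range D, Z x := by
        refine Finset.sum_congr rfl fun x _ => ?_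
        rw [add_comm]; exact per_dvd (Dvd.intro _ rfl) hZ x
      rw [this]; push_cast; ring
  unfold avg
  rw [e]; push_cast; field_simp

lemma avg_zero {D m q : ℕ} (hm : 0 < m) (hDm : D ∣ m) (hqm : q ∣ m) {a : ℤ} (hq : 0 < q) (hc : IsCoprime a (q : ℤ)) (hqD : ¬ q ∣ D) {Ψ : ℕ → ℂ} (hΨ : ∀ n, Ψ (n + D) = Ψ n) :
    avg m (fun n => Ψ n * ee (n * (a / q))) = 0 := by
  have hq' : (q : ℝ) ≠ 0 := by exact_mod_cast hq.ne'
  have hs := sum_shift (m := m) (Z := fun n => Ψ n * ee (n * (a / q))) (fun n => by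
    rw [per_dvd hDm hΨ, per_dvd hqm (φ := fun n => ee (n * (a / q))) (ee_per hq a)]) D
  have e : ∀ n : ℕ, Ψ (n + D) * ee ((n + D : ℕ) * (a / q)) = ee (D * (a / q)) * (Ψ n * ee (n * (a / q))) := by
    intro n
    rw [hΨ, show ((n + D : ℕ) : ℝ) * (a / q) = D * (a / q) + n * (a / q) by push_cast; ring, ee_add]; ring
  simp only [e] at hs
  rw [← Finset.mul_sum] at hs
  have hne : ee (D * (a / q)) ≠ 1 := by
    intro h
    obtain ⟨k, hk⟩ := ee_eq_one h
    apply hqD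
    rw [← mul_div_assoc, div_eq_iff hq'] at hk
    have h2 : (D : ℤ) * a = k * q := by exact_mod_cast hk
    have h3 : (q : ℤ) ∣ D := hc.symm.dvd_of_dvd_mul_right ⟨k, by rw [h2]; ring⟩
    exact_mod_cast h3
  have h0 : ∑ n ∈ Finset.range m, Ψ n * ee (n * (a / q)) = 0 := by
    have : (ee (D * (a / q)) - 1) * ∑ n ∈ Finset.range m, Ψ n * ee (n * (a / q)) = 0 := by rw [sub_mul, one_mul, hs, sub_self]
    exact (mul_eq_zero.1 this).resolve_left (sub_ne_zero.2 hne)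
  unfold avg
  rw [h0, zero_div]

end

section
open Complex Metric Set Filter Topology MeasureTheory

noncomputable def fl (W l n : ℕ) : ℝ := 1 + (if l ∣ n then 2 else 0) - (if l ∣ W * n + 1 then 1 else 0) - (if l ∣ W * n + (l - 1) then 1 else 0)

noncomputable def GG (W l n : ℕ) : ℝ := (l - 1) / l * fl W l n - 1

noncomputable def GT (W r n : ℕ) : ℝ := ∏ l ∈ r.primeFactors, GG W l n

lemma ind_sum {l W : ℕ} (hl : 0 < l) (h : W.Coprime l) (c : ℕ) : ∃ n0 < l, l ∣ W * n0 + c ∧ ∀ g : ℕ → ℂ, ∑ n ∈ Finset.range l, (if l ∣ W * n + c then g n else 0) = g n0 := by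
  obtain ⟨u, v, huv⟩ := Nat.isCoprime_iff_coprime.2 h
  have hl0 : (0 : ℤ) < l := by exact_mod_cast hl
  obtain ⟨n0, hn0⟩ := Int.eq_ofNat_of_zero_le (Int.emod_nonneg (-(u * c)) hl0.ne')
  have hlt : n0 < l := by
    have := Int.emod_lt_of_pos (-(u * c)) hl0
    rw [hn0] at this; exact_mod_cast this
  have hd : (l : ℤ) ∣ W * n0 + c := by
    have h1 : (l : ℤ) ∣ -(u * c) - n0 := by rw [← hn0]; exact Int.dvd_self_sub_emod
    obtain ⟨k, hk⟩ := h1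
    refine ⟨c * v - W * k, ?_⟩
    linear_combination (-(c : ℤ)) * huv - W * hk
  have hd' : l ∣ W * n0 + c := by exact_mod_cast hd
  refine ⟨n0, hlt, hd', fun g => ?_⟩
  have : ∀ n ∈ Finset.range l, (if l ∣ W * n + c then g n else 0) = if n = n0 then g n else 0 := by
    intro n hn
    have hn := Finset.mem_range.1 hn
    refine if_congr ⟨fun h2 => ?_, fun h2 => h2 ▸ hd'⟩ rfl rfl
    have h3 : W * n + c ≡ W * n0 + c [MOD l] := ((Nat.modEq_zero_iff_dvd.2 h2).trans (Nat.modEq_zero_iff_dvd.2 hd').symm)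
    have h4 := Nat.ModEq.cancel_left_of_coprime (Nat.coprime_comm.1 h) (Nat.ModEq.add_right_cancel' _ h3)
    exact Nat.ModEq.eq_of_lt_of_lt h4 hn hlt
  rw [Finset.sum_congr rfl this, Finset.sum_ite_eq' _ _ _, if_pos (Finset.mem_range.2 hlt)]

lemma fl_zero {W l n : ℕ} (h2 : 2 < l) (hp : l.Prime) (h : l ∣ W * n + 1) : fl W l n = 0 := by
  unfold fl
  have h1 : ¬ l ∣ n := fun h' => by
    have := (Nat.dvd_add_right (h'.mul_left W)).1 h
    exact hp.one_lt.not_ge (Nat.le_of_dvd one_pos this)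
  have h3 : ¬ l ∣ W * n + (l - 1) := fun h' => by
    have := Nat.dvd_sub h' h
    rw [show W * n + (l - 1) - (W * n + 1) = l - 2 by omega] at this
    have := Nat.le_of_dvd (by omega) this
    omega
  rw [if_neg h1, if_pos h, if_neg h3]; norm_num

lemma ul_GG {W l : ℕ} (h2 : 2 < l) (hp : l.Prime) (n : ℕ) : ul W l n * GG W l n = fl W l n - ul W l n := by
  unfold ul GG
  split_ifs with h
  · rw [fl_zero h2 hp h]; ring
  · have : (2 : ℝ) < l := by exact_mod_cast h2
    have h3 : (l : ℝ) - 1 ≠ 0 := by linarith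
    have h4 : (l : ℝ) ≠ 0 := by linarith
    field_simp

lemma GG_bd {W l : ℕ} (h2 : 2 < l) (hp : l.Prime) (n : ℕ) : |GG W l n| ≤ 2 := by
  have h2' : (2 : ℝ) < l := by exact_mod_cast h2
  have e1 : 0 ≤ ((l : ℝ) - 1) / l := by apply div_nonneg <;> linarith
  have e2 : ((l : ℝ) - 1) / l ≤ 1 := by rw [div_le_one (by linarith)]; linarith
  have f3 : fl W l n ≤ 3 := by unfold fl; split_ifs <;> norm_num
  have f0 : 0 ≤ fl W l n := by
    by_cases h : l ∣ W * n + 1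
    · rw [fl_zero h2 hp h]
    · unfold fl; rw [if_neg h]; split_ifs <;> norm_num
  unfold GG
  rw [abs_le]
  constructor <;> nlinarith [mul_nonneg e1 f0]

lemma ul_per (W l n : ℕ) : ul W l (n + l) = ul W l n := by
  unfold ul
  rw [show W * (n + l) + 1 = W * n + 1 + l * W by ring]
  simp only [Nat.dvd_add_left (Dvd.intro W rfl)]

lemma GG_per (W l n : ℕ) : GG W l (n + l) = GG W l n := by
  unfold GG fl
  rw [show W * (n + l) + 1 = W * n + 1 + l * W by ring, show W * (n + l) + (l - 1) = W * n + (l - 1) + l * W by ring]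
  simp only [Nat.dvd_add_left (Dvd.intro W rfl), Nat.dvd_add_self_right]

lemma loc {W l : ℕ} (h2 : 2 < l) (hp : l.Prime) (hW : ¬ l ∣ W) (b : ℤ) :
    ((l : ℤ) ∣ b → avg l (fun n => (ul W l n : ℂ) * ee (n * (b / l))) = 1 ∧ avg l (fun n => (fl W l n : ℂ) * ee (n * (b / l))) = 1) ∧
    (¬ (l : ℤ) ∣ b → ‖avg l (fun n => (ul W l n : ℂ) * ee (n * (b / l)))‖ ≤ 2 / l ∧ ∃ t : ℝ, 0 ≤ t ∧ t ≤ 4 / l ∧ avg l (fun n => (fl W l n : ℂ) * ee (n * (b / l))) = t) := by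
  have hl2 : (2 : ℝ) < l := by exact_mod_cast h2
  have hl0 : (l : ℝ) ≠ 0 := by linarith
  have hl0c : (l : ℂ) ≠ 0 := by exact_mod_cast hp.ne_zero
  have hl1c : (l : ℂ) - 1 ≠ 0 := by
    have : (l : ℝ) - 1 ≠ 0 := by linarith
    exact_mod_cast this
  have hco : W.Coprime l := ((Nat.Prime.coprime_iff_not_dvd hp).2 hW).symm
  obtain ⟨n0, hn0, hd0, s0⟩ := ind_sum hp.pos hco 1
  obtain ⟨n1, hn1, hd1, s1⟩ := ind_sum hp.pos hco (l - 1)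
  obtain ⟨n2, hn2, hd2, s2⟩ := ind_sum hp.pos (Nat.coprime_one_left l) 0
  have hn20 : n2 = 0 := by
    rw [one_mul, add_zero] at hd2
    exact Nat.eq_zero_of_dvd_of_lt hd2 hn2
  subst hn20
  have hsum : l ∣ n0 + n1 := by
    have h3 : l ∣ W * (n0 + n1) + l := by
      rw [show W * (n0 + n1) + l = (W * n0 + 1) + (W * n1 + (l - 1)) by rw [mul_add]; omega]; exact dvd_add hd0 hd1
    exact (Nat.Coprime.dvd_mul_left hco.symm).1 ((Nat.dvd_add_self_right).1 h3)
  obtain ⟨k, hk⟩ := hsum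
  have hk' : (n0 : ℝ) + n1 = l * k := by exact_mod_cast hk
  have en1 : ee (n1 * (b / l)) = ee (-(n0 * (b / l))) := by
    rw [← ee_add_int (-(n0 * (b / l))) (k * b)]
    congr 1; push_cast; rw [show (n1 : ℝ) = l * k - n0 by linarith]; field_simp; ring
  have ho := orth hp.pos b
  have Fl : avg l (fun n => (fl W l n : ℂ) * ee (n * (b / l))) = ((if (l : ℤ) ∣ b then (l : ℂ) else 0) + 2 - ee (n0 * (b / l)) - ee (-(n0 * (b / l)))) / l := by
    unfold avg
    congr 1
    have : ∀ n : ℕ, (fl W l n : ℂ) * ee (n * (b / l)) = ee (n * (b / l)) + 2 * (if l ∣ 1 * n + 0 then ee (n * (b / l)) else 0) -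
        (if l ∣ W * n + 1 then ee (n * (b / l)) else 0) - (if l ∣ W * n + (l - 1) then ee (n * (b / l)) else 0) := by
      intro n
      unfold fl
      rw [one_mul, add_zero]
      split_ifs <;> push_cast <;> ring
    simp only [this]
    rw [Finset.sum_sub_distrib, Finset.sum_sub_distrib, Finset.sum_add_distrib, ← Finset.mul_sum, ho, s0, s1, s2, en1]
    simp [ee_zero]
  have Ul : avg l (fun n => (ul W l n : ℂ) * ee (n * (b / l))) = ((if (l : ℤ) ∣ b then (l : ℂ) else 0) - ee (n0 * (b / l))) / (l - 1) := by
    unfold avg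
    have : ∀ n : ℕ, (ul W l n : ℂ) * ee (n * (b / l)) = (l / (l - 1)) * (ee (n * (b / l)) - (if l ∣ W * n + 1 then ee (n * (b / l)) else 0)) := by
      intro n
      unfold ul
      split_ifs <;> push_cast <;> ring
    simp only [this]
    rw [← Finset.mul_sum, Finset.sum_sub_distrib, ho, s0]
    field_simp
  rw [Fl, Ul]
  constructor
  · intro hb
    have e1 : ∀ n : ℤ, ee (n * (b / l)) = 1 := by
      intro n
      obtain ⟨c, hc⟩ := hb
      have hc' : (b : ℝ) = l * c := by exact_mod_cast hc
      rw [hc', mul_div_cancel_left₀ _ hl0, ← ee_int (n * c)]; push_cast; rfl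
    have e2 := e1 n0
    have e3 := e1 (-n0)
    push_cast at e2 e3
    rw [neg_mul] at e3
    rw [if_pos hb, e2, e3]
    constructor
    · rw [div_self hl1c]
    · rw [show (l : ℂ) + 2 - 1 - 1 = l by ring, div_self hl0c]
  · intro hb
    rw [if_neg hb]
    constructor
    · rw [norm_div, zero_sub, norm_neg, ee_norm]
      have : ‖(l : ℂ) - 1‖ = l - 1 := by
        rw [show (l : ℂ) - 1 = ((l - 1 : ℝ) : ℂ) by push_cast; ring, norm_real, Real.norm_of_nonneg (by linarith)]
      rw [this, div_le_div_iff₀ (by linarith) (by linarith)]; linarith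
    · refine ⟨(2 - 2 * (ee (n0 * (b / l))).re) / l, ?_, ?_, ?_⟩
      · rw [ee_re]
        have := Real.cos_le_one (2 * Real.pi * (n0 * (b / l)))
        apply div_nonneg <;> linarith
      · rw [ee_re]
        have := Real.neg_one_le_cos (2 * Real.pi * (n0 * (b / l)))
        apply div_le_div_of_nonneg_right <;> linarith
      · rw [← ee_conj]
        have := Complex.add_conj (ee (n0 * (b / l)))
        push_cast
        push_cast at this
        rw [zero_add, sub_sub, this]

end

section
open Complex Metric Set Filter Topology MeasureTheory

noncomputable def tau (W q : ℕ) (a : ℤ) (r : ℕ) : ℂ := avg (r * q) (fun n => (uu W (r * q) n : ℂ) * ((GT W r n : ℂ) * ee (n * (a / q))))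

def good (W r : ℕ) : Prop := Squarefree r ∧ r.Coprime W

noncomputable def phi (W r l n : ℕ) : ℂ := if l ∣ r then (ul W l n : ℂ) * GG W l n else (ul W l n : ℂ)

lemma phi_per (W r l n : ℕ) : phi W r l (n + l) = phi W r l n := by
  unfold phi; rw [ul_per, GG_per]

lemma two_lt {W l : ℕ} (hW : Even W) (hl : l.Prime) (h : ¬ l ∣ W) : 2 < l :=
  lt_of_le_of_ne hl.two_le fun h2 => h (h2 ▸ hW.two_dvd)

lemma not_dvd_of_good {W r l : ℕ} (h : good W r) (hl : l ∈ r.primeFactors) : ¬ l ∣ W := fun h2 =>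
  Nat.not_coprime_of_dvd_of_dvd (Nat.prime_of_mem_primeFactors hl).one_lt (Nat.dvd_of_mem_primeFactors hl) h2 h.2

lemma uuGT {W r q : ℕ} (hr : good W r) (hq : 0 < q) (n : ℕ) :
    (uu W (r * q) n : ℂ) * (GT W r n : ℂ) = ∏ l ∈ (r * q).primeFactors.filter (¬ · ∣ W), phi W r l n := by
  have hr0 : r ≠ 0 := hr.1.ne_zero
  have e : r.primeFactors = ((r * q).primeFactors.filter (¬ · ∣ W)).filter (· ∣ r) := by
    ext l
    simp only [Finset.mem_filter]
    constructor
    · intro h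
      refine ⟨⟨?_, not_dvd_of_good hr h⟩, Nat.dvd_of_mem_primeFactors h⟩
      rw [Nat.primeFactors_mul hr0 hq.ne']; exact Finset.mem_union_left _ h
    · intro h
      exact Nat.mem_primeFactors.2 ⟨Nat.prime_of_mem_primeFactors h.1.1, h.2, hr0⟩
  unfold uu GT phi
  rw [e, Finset.prod_filter (s := (r * q).primeFactors.filter (¬ · ∣ W)) (p := fun l => l ∣ r)]
  push_cast
  rw [← Finset.prod_mul_distrib]
  refine Finset.prod_congr rfl fun l _ => ?_
  split_ifs <;> simp

lemma tau_zero {W r q : ℕ} {a : ℤ} (hW : Even W) (hr : good W r) (hq : 0 < q) (hc : IsCoprime a (q : ℤ)) (h : ¬ good W q ∨ ¬ r ∣ q) : tau W q a r = 0 := by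
  have hr0 : r ≠ 0 := hr.1.ne_zero
  have hm : 0 < r * q := Nat.mul_pos (Nat.pos_of_ne_zero hr0) hq
  unfold tau
  simp only [← mul_assoc, uuGT hr hq]
  set P := (r * q).primeFactors.filter (¬ · ∣ W) with hP
  have hPp : ∀ l ∈ P, l.Prime := fun l hl => Nat.prime_of_mem_primeFactors (Finset.mem_filter.1 hl).1
  have hPW : ∀ l ∈ P, ¬ l ∣ W := fun l hl => (Finset.mem_filter.1 hl).2
  set D := ∏ l ∈ P, l with hD
  have hDpos : 0 < D := prod_primes_pos hPp
  have hDm : D ∣ r * q := (Finset.prod_dvd_prod_of_subset _ _ _ (Finset.filter_subset _ _)).trans (Nat.prod_primeFactors_dvd _)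
  have hΨ : ∀ n, ∏ l ∈ P, phi W r l (n + D) = ∏ l ∈ P, phi W r l n := fun n =>
    Finset.prod_congr rfl fun l hl => per_dvd (Finset.dvd_prod_of_mem _ hl) (phi_per W r l) n
  by_cases hqD : q ∣ D
  swap
  · exact avg_zero hm hDm (Dvd.intro_left _ rfl) hq hc hqD hΨ
  have hDpf : D.primeFactors = P := Nat.primeFactors_prod hPp
  have hDsq : Squarefree D := by
    refine Finset.squarefree_prod_of_pairwise_isCoprime ?_ fun l hl => (hPp l hl).prime.squarefree
    · intro x hx y hy hxy
      exact Nat.coprime_iff_isRelPrime.1 ((Nat.coprime_primes (hPp x hx) (hPp y hy)).2 hxy)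
  have hDW : D.Coprime W := Nat.Coprime.prod_left fun l hl => (Nat.Prime.coprime_iff_not_dvd (hPp l hl)).2 (hPW l hl)
  have hgq : good W q := ⟨hDsq.squarefree_of_dvd hqD, Nat.Coprime.coprime_dvd_left hqD hDW⟩
  have hrq : ¬ r ∣ q := h.resolve_left (not_not.2 hgq)
  obtain ⟨l, hlr, hlq⟩ : ∃ l ∈ r.primeFactors, ¬ l ∣ q := by
    by_contra hcon
    push Not at hcon
    apply hrq
    rw [← Nat.prod_primeFactors_of_squarefree hr.1]
    exact Finset.prod_primes_dvd _ (fun l hl => (Nat.prime_of_mem_primeFactors hl).prime) hcon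
  have hlP : l ∈ P := by
    refine Finset.mem_filter.2 ⟨?_, not_dvd_of_good hr hlr⟩
    rw [Nat.primeFactors_mul hr0 hq.ne']; exact Finset.mem_union_left _ hlr
  obtain ⟨d, hd⟩ := hqD
  have hd0 : (d : ℝ) ≠ 0 := by
    rintro h0
    have : d = 0 := by exact_mod_cast h0
    rw [this] at hd; omega
  have hq0 : (q : ℝ) ≠ 0 := by exact_mod_cast hq.ne'
  have haq : (a : ℝ) / q = ((a * d : ℤ) : ℝ) / (D : ℕ) := by
    rw [hd]; push_cast; field_simp
  rw [avg_dvd hm hDm (Z := fun n => (∏ l ∈ P, phi W r l n) * ee (n * (a / q))) fun n => by rw [hΨ, haq, ee_per hDpos]]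
  rw [haq]
  obtain ⟨b, hb, hb2⟩ := crt_avg P hPp (a * d)
  have h5 := hb2 (phi W r) fun l _ n => phi_per W r l n
  rw [← hD] at h5
  rw [h5]
  refine Finset.prod_eq_zero hlP ?_
  have hbl : (l : ℤ) ∣ b l := by
    rw [hb l hlP]
    have h6 : l ∣ q * d := hd ▸ Finset.dvd_prod_of_mem _ hlP
    have h7 := ((hPp l hlP).dvd_mul.1 h6).resolve_left hlq
    exact (Int.natCast_dvd_natCast.2 h7).mul_left a
  have h8 := (loc (two_lt hW (hPp l hlP) (hPW l hlP)) (hPp l hlP) (hPW l hlP) (b l)).1 hbl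
  have h9 : ∀ n : ℕ, phi W r l n * ee (n * (b l / l)) = (fl W l n : ℂ) * ee (n * (b l / l)) - (ul W l n : ℂ) * ee (n * (b l / l)) := by
    intro n
    unfold phi
    rw [if_pos (Nat.dvd_of_mem_primeFactors hlr), ← ofReal_mul, ul_GG (two_lt hW (hPp l hlP) (hPW l hlP)) (hPp l hlP)]
    push_cast; ring
  simp only [h9]
  have h10 := h8.1
  have h11 := h8.2
  unfold avg at h10 h11 ⊢
  rw [Finset.sum_sub_distrib, sub_div, h10, h11, sub_self]

lemma tau_eq {W q : ℕ} {a : ℤ} (hW : Even W) (hq : good W q) (hc : IsCoprime a (q : ℤ)) :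
    ∃ F : ℕ → ℝ, ∃ B : ℕ → ℂ, (∀ l ∈ q.primeFactors, 0 ≤ F l ∧ F l ≤ 4 / l ∧ ‖B l‖ ≤ 2 / l) ∧
      ∀ r, good W r → r ∣ q → tau W q a r = ∏ l ∈ q.primeFactors, (if l ∣ r then (F l : ℂ) - B l else B l) := by
  have hq0 : 0 < q := Nat.pos_of_ne_zero hq.1.ne_zero
  have hPp : ∀ l ∈ q.primeFactors, l.Prime := fun l hl => Nat.prime_of_mem_primeFactors hl
  have hPW : ∀ l ∈ q.primeFactors, ¬ l ∣ W := fun l hl => not_dvd_of_good hq hl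
  obtain ⟨b, hb, hb2⟩ := crt_avg q.primeFactors hPp a
  have hD : ∏ l ∈ q.primeFactors, l = q := Nat.prod_primeFactors_of_squarefree hq.1
  rw [hD] at hb2
  have hbl : ∀ l ∈ q.primeFactors, ¬ (l : ℤ) ∣ b l := by
    intro l hl h
    rw [hb l hl] at h
    have h2 : (l : ℤ) ∣ q := Int.natCast_dvd_natCast.2 (Nat.dvd_of_mem_primeFactors hl)
    have h3 := hc.isUnit_of_dvd' h h2
    exact (Nat.prime_iff_prime_int.1 (hPp l hl)).not_unit h3
  have hloc := fun l (hl : l ∈ q.primeFactors) => (loc (two_lt hW (hPp l hl) (hPW l hl)) (hPp l hl) (hPW l hl) (b l)).2 (hbl l hl)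
  have hF : ∀ l, ∃ t : ℝ, l ∈ q.primeFactors → 0 ≤ t ∧ t ≤ 4 / l ∧ avg l (fun n => (fl W l n : ℂ) * ee (n * (b l / l))) = t := by
    intro l
    by_cases hl : l ∈ q.primeFactors
    · obtain ⟨t, ht⟩ := (hloc l hl).2
      exact ⟨t, fun _ => ht⟩
    · exact ⟨0, fun h => absurd h hl⟩
  choose F hF using hF
  refine ⟨F, fun l => avg l (fun n => (ul W l n : ℂ) * ee (n * (b l / l))), fun l hl => ⟨(hF l hl).1, (hF l hl).2.1, (hloc l hl).1⟩, ?_⟩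
  intro r hr hrq
  have hr0 : r ≠ 0 := hr.1.ne_zero
  have hm : 0 < r * q := Nat.mul_pos (Nat.pos_of_ne_zero hr0) hq0
  unfold tau
  simp only [← mul_assoc, uuGT hr hq0]
  have hP : (r * q).primeFactors.filter (¬ · ∣ W) = q.primeFactors := by
    rw [Nat.primeFactors_mul hr0 hq0.ne', Finset.union_eq_right.2 (Nat.primeFactors_mono hrq hq0.ne')]
    exact Finset.filter_true_of_mem hPW
  rw [hP, avg_dvd hm (Dvd.intro_left r rfl) (Z := fun n => (∏ l ∈ q.primeFactors, phi W r l n) * ee (n * (a / q))) fun n => by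
    rw [ee_per hq0]
    congr 1
    exact Finset.prod_congr rfl fun l hl => per_dvd (Nat.dvd_of_mem_primeFactors hl) (phi_per W r l) n]
  rw [hb2 (phi W r) fun l _ n => phi_per W r l n]
  refine Finset.prod_congr rfl fun l hl => ?_
  split_ifs with hlr
  · have h9 : ∀ n : ℕ, phi W r l n * ee (n * (b l / l)) = (fl W l n : ℂ) * ee (n * (b l / l)) - (ul W l n : ℂ) * ee (n * (b l / l)) := by
      intro n
      unfold phi
      rw [if_pos hlr, ← ofReal_mul, ul_GG (two_lt hW (hPp l hl) (hPW l hl)) (hPp l hl)]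
      push_cast; ring
    simp only [h9]
    rw [← (hF l hl).2.2]
    unfold avg
    rw [Finset.sum_sub_distrib, sub_div]
  · have h9 : ∀ n : ℕ, phi W r l n = (ul W l n : ℂ) := by
      intro n
      unfold phi
      rw [if_neg hlr]
    simp only [h9]

lemma sum_div {R : Type*} [CommRing R] {q : ℕ} (hq : Squarefree q) (f g : ℕ → R) :
    ∑ r ∈ q.divisors, ∏ l ∈ q.primeFactors, (if l ∣ r then f l else g l) = ∏ l ∈ q.primeFactors, (f l + g l) := by
  classical
  rw [Finset.prod_add]
  have hq0 := hq.ne_zero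
  refine Finset.sum_nbij' (fun r => r.primeFactors) (fun t => ∏ l ∈ t, l) ?_ ?_ ?_ ?_ ?_
  · intro r hr
    exact Finset.mem_powerset.2 (Nat.primeFactors_mono (Nat.dvd_of_mem_divisors hr) hq0)
  · intro t ht
    have ht := Finset.mem_powerset.1 ht
    rw [Nat.mem_divisors]
    exact ⟨(Finset.prod_dvd_prod_of_subset _ _ _ ht).trans (Nat.prod_primeFactors_dvd _), hq0⟩
  · intro r hr
    exact Nat.prod_primeFactors_of_squarefree (hq.squarefree_of_dvd (Nat.dvd_of_mem_divisors hr))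
  · intro t ht
    have ht := Finset.mem_powerset.1 ht
    exact Nat.primeFactors_prod fun l hl => Nat.prime_of_mem_primeFactors (ht hl)
  · intro r hr
    have hrq := Nat.dvd_of_mem_divisors hr
    have hr0 : r ≠ 0 := fun h => hq0 (Nat.eq_zero_of_zero_dvd (h ▸ hrq))
    have hsub := Nat.primeFactors_mono hrq hq0
    rw [Finset.prod_ite]
    have e1 : q.primeFactors.filter (· ∣ r) = r.primeFactors := by
      ext l
      rw [Finset.mem_filter]
      exact ⟨fun h => Nat.mem_primeFactors.2 ⟨Nat.prime_of_mem_primeFactors h.1, h.2, hr0⟩, fun h => ⟨hsub h, Nat.dvd_of_mem_primeFactors h⟩⟩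
    have e2 : q.primeFactors.filter (¬ · ∣ r) = q.primeFactors \ r.primeFactors := by
      rw [← e1, Finset.filter_not]
    rw [e1, e2]

open Classical in
noncomputable def RR (W R : ℕ) : Finset ℕ := (Finset.Icc 1 R).filter (good W)

lemma prod8 {q : ℕ} (hq : Squarefree q) : ∏ l ∈ q.primeFactors, (8 / l : ℝ) ≤ 8 ^ 64 / Real.sqrt q := by
  have h1 : ∀ l ∈ q.primeFactors, (8 / l : ℝ) ≤ (if l < 64 then 8 else 1) * (1 / Real.sqrt l) := by
    intro l hl
    have hl1 : (1 : ℝ) ≤ l := by exact_mod_cast (Nat.prime_of_mem_primeFactors hl).one_le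
    have hs1 : 1 ≤ Real.sqrt l := Real.one_le_sqrt.2 hl1
    have hs : Real.sqrt l * Real.sqrt l = l := Real.mul_self_sqrt (by linarith)
    split_ifs with h
    · rw [mul_one_div, div_le_div_iff₀ (by linarith) (by linarith)]
      nlinarith
    · have h8 : 8 ≤ Real.sqrt l := by
        apply Real.le_sqrt_of_sq_le
        have : (64 : ℝ) ≤ l := by exact_mod_cast not_lt.1 h
        norm_num; linarith
      rw [one_mul, div_le_div_iff₀ (by linarith) (by linarith)]
      nlinarith
  refine (Finset.prod_le_prod (fun l _ => by positivity) h1).trans ?_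
  rw [Finset.prod_mul_distrib, Finset.prod_ite, Finset.prod_const, Finset.prod_const_one, mul_one]
  have h2 : ∏ l ∈ q.primeFactors, (1 / Real.sqrt l) = 1 / Real.sqrt q := by
    rw [Finset.prod_div_distrib, Finset.prod_const_one]
    congr 1
    conv_rhs => rw [← Nat.prod_primeFactors_of_squarefree hq]
    push_cast
    rw [Real.sqrt_eq_rpow, ← Real.finsetProd_rpow _ _ (fun i _ => by positivity)]
    refine Finset.prod_congr rfl fun l _ => Real.sqrt_eq_rpow _
  rw [h2, mul_one_div]
  apply div_le_div_of_nonneg_right _ (Real.sqrt_nonneg _)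
  apply pow_le_pow_right₀ (by norm_num)
  calc _ ≤ (Finset.range 64).card := Finset.card_le_card fun l hl => Finset.mem_range.2 (Finset.mem_filter.1 hl).2
    _ = 64 := Finset.card_range _

theorem tau_sum {W q R : ℕ} {a : ℤ} {Q : ℝ} (hW : Even W) (hq : 0 < q) (hc : IsCoprime a (q : ℤ)) (hR : R = ⌊Q⌋₊) (hQ : 1 ≤ Q) :
    (∃ t : ℝ, 0 ≤ t ∧ ∑ r ∈ RR W R, tau W q a r = t ∧ (q = 1 → t = 1)) ∨ (q ≠ 1 ∧ ‖∑ r ∈ RR W R, tau W q a r‖ ≤ 8 ^ 64 / Real.sqrt Q) := by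
  classical
  have hRR : ∀ r ∈ RR W R, good W r := fun r hr => (Finset.mem_filter.1 hr).2
  by_cases hg : good W q
  swap
  · left
    refine ⟨0, le_rfl, ?_, ?_⟩
    · rw [Finset.sum_eq_zero fun r hr => tau_zero hW (hRR r hr) hq hc (Or.inl hg)]; simp
    · rintro rfl
      exact absurd ⟨squarefree_one, Nat.coprime_one_left W⟩ hg
  obtain ⟨F, B, hFB, hτ⟩ := tau_eq hW hg hc
  have hdiv : ∀ r ∈ q.divisors, good W r := fun r hr =>
    ⟨hg.1.squarefree_of_dvd (Nat.dvd_of_mem_divisors hr), Nat.Coprime.coprime_dvd_left (Nat.dvd_of_mem_divisors hr) hg.2⟩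
  by_cases hqR : q ≤ R
  · left
    refine ⟨∏ l ∈ q.primeFactors, F l, Finset.prod_nonneg fun l hl => (hFB l hl).1, ?_, ?_⟩
    · have hsub : q.divisors ⊆ RR W R := by
        intro r hr
        refine Finset.mem_filter.2 ⟨Finset.mem_Icc.2 ⟨Nat.pos_of_mem_divisors hr, (Nat.divisor_le hr).trans hqR⟩, hdiv r hr⟩
      rw [← Finset.sum_subset hsub fun r hr h => tau_zero hW (hRR r hr) hq hc (Or.inr fun h2 => h (Nat.mem_divisors.2 ⟨h2, hq.ne'⟩))]
      rw [Finset.sum_congr rfl fun r hr => hτ r (hdiv r hr) (Nat.dvd_of_mem_divisors hr), sum_div hg.1]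
      push_cast
      exact Finset.prod_congr rfl fun l _ => by ring
    · rintro rfl; simp
  · right
    refine ⟨by rintro rfl; exact hqR (hR ▸ Nat.le_floor (by simpa using hQ)), ?_⟩
    have hQq : Q ≤ q := by
      subst hR
      exact ((Nat.floor_lt (by linarith)).1 (not_le.1 hqR)).le
    have h1 : ∑ r ∈ RR W R, tau W q a r = ∑ r ∈ (RR W R).filter (· ∣ q), tau W q a r := by
      rw [Finset.sum_filter]
      refine Finset.sum_congr rfl fun r hr => ?_
      split_ifs with h
      · rfl
      · exact tau_zero hW (hRR r hr) hq hc (Or.inr h)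
    rw [h1]
    calc ‖∑ r ∈ (RR W R).filter (· ∣ q), tau W q a r‖ ≤ ∑ r ∈ (RR W R).filter (· ∣ q), ‖tau W q a r‖ := norm_sum_le _ _
      _ ≤ ∑ r ∈ q.divisors, ‖tau W q a r‖ := Finset.sum_le_sum_of_subset_of_nonneg (fun r hr => Nat.mem_divisors.2 ⟨(Finset.mem_filter.1 hr).2, hq.ne'⟩) fun _ _ _ => norm_nonneg _
      _ ≤ ∑ r ∈ q.divisors, ∏ l ∈ q.primeFactors, (if l ∣ r then (6 / l : ℝ) else 2 / l) := by
        refine Finset.sum_le_sum fun r hr => ?_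
        rw [hτ r (hdiv r hr) (Nat.dvd_of_mem_divisors hr), norm_prod]
        refine Finset.prod_le_prod (fun _ _ => norm_nonneg _) fun l hl => ?_
        obtain ⟨f0, f1, b1⟩ := hFB l hl
        split_ifs
        · calc ‖(F l : ℂ) - B l‖ ≤ ‖(F l : ℂ)‖ + ‖B l‖ := norm_sub_le _ _
            _ ≤ 4 / l + 2 / l := by
              rw [norm_real, Real.norm_of_nonneg f0]; linarith
            _ = 6 / l := by ring
        · exact b1
      _ = ∏ l ∈ q.primeFactors, (8 / l : ℝ) := by
        rw [sum_div hg.1]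
        exact Finset.prod_congr rfl fun l _ => by ring
      _ ≤ 8 ^ 64 / Real.sqrt q := prod8 hg.1
      _ ≤ 8 ^ 64 / Real.sqrt Q := by
        have : 0 < Real.sqrt Q := Real.sqrt_pos.2 (by linarith)
        apply div_le_div_of_nonneg_left (by positivity) this (Real.sqrt_le_sqrt hQq)

end

section
open Complex Metric Set Filter Topology MeasureTheory

lemma GT_bd {W r : ℕ} (hW : Even W) (hr : good W r) (n : ℕ) : ‖(GT W r n : ℂ)‖ ≤ r := by
  rw [norm_real, GT, Real.norm_eq_abs, Finset.abs_prod]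
  have h0 : ∀ l ∈ r.primeFactors, |GG W l n| ≤ l := by
    intro l hl
    have h2 := two_lt hW (Nat.prime_of_mem_primeFactors hl) (not_dvd_of_good hr hl)
    have : (2 : ℝ) < l := by exact_mod_cast h2
    exact (GG_bd h2 (Nat.prime_of_mem_primeFactors hl) n).trans this.le
  refine (Finset.prod_le_prod (fun l _ => abs_nonneg _) h0).trans ?_
  have : (∏ l ∈ r.primeFactors, (l : ℝ)) = r := by rw [← Nat.cast_prod, Nat.prod_primeFactors_of_squarefree hr.1]
  rw [this]

lemma GT_per (W r n : ℕ) : (GT W r (n + r) : ℂ) = GT W r n := by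
  unfold GT
  push_cast
  refine Finset.prod_congr rfl fun l hl => ?_
  exact per_dvd (Nat.dvd_of_mem_primeFactors hl) (φ := fun n => (GG W l n : ℂ)) (fun n => by rw [GG_per]) n

noncomputable def hh (X n : ℕ) : ℝ := max (1 - n / X) 0

lemma hh_anti (X : ℕ) : Antitone (hh X) := by
  intro m n h
  unfold hh
  have : (m : ℝ) / X ≤ n / X := div_le_div_of_nonneg_right (by exact_mod_cast h) (Nat.cast_nonneg _)
  exact max_le_max (by linarith) le_rfl

lemma hh_nonneg (X n : ℕ) : 0 ≤ hh X n := le_max_right _ _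

lemma hh_zero (X : ℕ) : hh X 0 = 1 := by simp [hh]

lemma g_anti (X : ℕ) {ρ : ℕ → ℝ} (hρ : Monotone ρ) (h0 : 0 < ρ 0) : Antitone fun n => hh X n / ρ n := by
  intro m n h
  exact div_le_div₀ (hh_nonneg _ _) (hh_anti X h) (h0.trans_le (hρ (Nat.zero_le _))) (hρ h)

lemma trunc (f : ℕ → ℂ) (X k : ℕ) : ∑ n ∈ Finset.range k, (if n < X then f n else 0) = ∑ n ∈ Finset.range (min k X), f n := by
  rw [← Finset.sum_filter]
  refine Finset.sum_congr ?_ fun _ _ => rfl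
  ext n; simp

lemma trunc_mul (f g : ℕ → ℂ) (X : ℕ) : ∑ n ∈ Finset.range X, (if n < X then f n else 0) * g n = ∑ n ∈ Finset.range X, f n * g n :=
  Finset.sum_congr rfl fun n hn => by rw [if_pos (Finset.mem_range.1 hn)]

lemma fejer (X : ℕ) {z : ℂ} (hz : ‖z‖ = 1) :
    ‖∑ n ∈ Finset.range X, z ^ n‖ ^ 2 = 2 * (∑ n ∈ Finset.range X, ((X : ℂ) - n) * z ^ n).re - X := by
  induction X with
  | zero => simp
  | succ X ih =>
    have e1 : ∑ n ∈ Finset.range (X + 1), z ^ n = z * (∑ n ∈ Finset.range X, z ^ n) + 1 := by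
      rw [Finset.sum_range_succ', Finset.mul_sum, pow_zero]
      congr 1
      exact Finset.sum_congr rfl fun n _ => by ring
    have e2 : ∑ n ∈ Finset.range (X + 1), (((X + 1 : ℕ) : ℂ) - n) * z ^ n = ∑ n ∈ Finset.range X, ((X : ℂ) - n) * z ^ n + ∑ n ∈ Finset.range (X + 1), z ^ n := by
      rw [Finset.sum_range_succ, Finset.sum_range_succ (fun n => z ^ n), ← add_assoc, ← Finset.sum_add_distrib]
      congr 1
      · exact Finset.sum_congr rfl fun n _ => by push_cast; ring
      · push_cast; ring
    rw [e2, e1]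
    have h3 : ‖z * (∑ n ∈ Finset.range X, z ^ n) + 1‖ ^ 2 = 1 + 2 * (z * (∑ n ∈ Finset.range X, z ^ n)).re + ‖∑ n ∈ Finset.range X, z ^ n‖ ^ 2 := by
      rw [Complex.sq_norm, Complex.normSq_add, map_mul, Complex.normSq_eq_norm_sq z, hz, Complex.normSq_eq_norm_sq (∑ n ∈ Finset.range X, z ^ n)]
      simp; ring
    rw [h3, ih, add_re, add_re, one_re]
    push_cast; ring

noncomputable def SS (X : ℕ) (η : ℝ) : ℂ := ∑ n ∈ Finset.range X, (hh X n : ℂ) * ee (n * η)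

lemma SS_eq {X : ℕ} (hX : 0 < X) (η : ℝ) : (X : ℂ) * SS X η = ∑ n ∈ Finset.range X, ((X : ℂ) - n) * ee η ^ n := by
  have hX' : (0 : ℝ) < X := by exact_mod_cast hX
  have hXc : (X : ℂ) ≠ 0 := by exact_mod_cast hX.ne'
  unfold SS
  rw [Finset.mul_sum]
  refine Finset.sum_congr rfl fun n hn => ?_
  have hn : (n : ℝ) < X := by exact_mod_cast Finset.mem_range.1 hn
  have : hh X n = 1 - n / X := max_eq_left (by rw [sub_nonneg, div_le_one hX']; exact hn.le)
  rw [this, ee_nmul]; push_cast; field_simp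

lemma SS_re {X : ℕ} (hX : 0 < X) (η : ℝ) : 0 ≤ (SS X η).re := by
  have hX' : (0 : ℝ) < X := by exact_mod_cast hX
  have h1 := fejer X (ee_norm η)
  rw [← SS_eq hX] at h1
  have h2 : ((X : ℂ) * SS X η).re = X * (SS X η).re := by rw [← ofReal_natCast, re_ofReal_mul]
  rw [h2] at h1
  by_contra h
  push Not at h
  nlinarith [sq_nonneg ‖∑ n ∈ Finset.range X, ee η ^ n‖]

lemma SS_zero {X : ℕ} (hX : 0 < X) : (X : ℝ) / 2 ≤ (SS X 0).re := by
  have hX' : (0 : ℝ) < X := by exact_mod_cast hX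
  have h1 := fejer X (ee_norm 0)
  rw [← SS_eq hX] at h1
  have h2 : ((X : ℂ) * SS X 0).re = X * (SS X 0).re := by rw [← ofReal_natCast, re_ofReal_mul]
  rw [h2] at h1
  simp only [ee_zero, one_pow, Finset.sum_const, Finset.card_range, nsmul_eq_mul, mul_one, norm_natCast] at h1
  by_contra h
  push Not at h
  nlinarith

lemma SS_norm (X : ℕ) (η : ℝ) : ‖SS X η‖ ≤ X := by
  unfold SS
  refine (norm_sum_le_of_le (n := fun _ => (1 : ℝ)) _ fun n _ => ?_).trans (by simp)
  rw [norm_mul, ee_norm, mul_one, norm_real, Real.norm_of_nonneg (hh_nonneg _ _), ← hh_zero X]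
  exact hh_anti X (Nat.zero_le _)

lemma ee_sub_le (t : ℝ) : ‖ee t - 1‖ ≤ 7 * |t| := by
  unfold ee
  rw [mul_comm]
  refine Real.norm_exp_I_mul_ofReal_sub_one_le.trans ?_
  rw [Real.norm_eq_abs, abs_mul, abs_of_pos (by positivity)]
  have := Real.pi_lt_d2
  exact mul_le_mul_of_nonneg_right (by linarith) (abs_nonneg _)

lemma tv {u : ℕ → ℝ} (hu : Antitone u) (h0 : ∀ n, 0 ≤ u n) (η : ℝ) (M : ℕ) :
    ‖(u M : ℂ) * ee (M * η)‖ + ∑ n ∈ Finset.range M, ‖(u (n + 1) : ℂ) * ee ((n + 1 : ℕ) * η) - (u n : ℂ) * ee (n * η)‖ ≤ u 0 * (1 + 7 * M * |η|) := by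
  have h1 : ∀ n, ‖(u (n + 1) : ℂ) * ee ((n + 1 : ℕ) * η) - (u n : ℂ) * ee (n * η)‖ ≤ (u n - u (n + 1)) + u 0 * (7 * |η|) := by
    intro n
    have e : (u (n + 1) : ℂ) * ee ((n + 1 : ℕ) * η) - (u n : ℂ) * ee (n * η) = ee (n * η) * ((u (n + 1) : ℂ) * (ee η - 1) - (u n - u (n + 1) : ℝ)) := by
      rw [show ((n + 1 : ℕ) : ℝ) * η = n * η + η by push_cast; ring, ee_add]; push_cast; ring
    rw [e, norm_mul, ee_norm, one_mul]
    refine (norm_sub_le _ _).trans ?_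
    rw [norm_mul, norm_real, norm_real, Real.norm_of_nonneg (h0 _), Real.norm_of_nonneg (sub_nonneg.2 (hu (Nat.le_succ n))), add_comm]
    exact add_le_add le_rfl (mul_le_mul (hu (Nat.zero_le _)) (ee_sub_le η) (norm_nonneg _) (h0 0))
  have h2 := Finset.sum_le_sum fun n (_ : n ∈ Finset.range M) => h1 n
  rw [Finset.sum_add_distrib, Finset.sum_range_sub', Finset.sum_const, Finset.card_range, nsmul_eq_mul] at h2
  rw [norm_mul, ee_norm, mul_one, norm_real, Real.norm_of_nonneg (h0 _)]
  nlinarith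

noncomputable def TT (W X R : ℕ) (ρ : ℕ → ℝ) (θ : ℝ) : ℂ := ∑ n ∈ Finset.range X, ((lam W n * (hh X n / ρ n) * ∑ r ∈ RR W R, GT W r n : ℝ) : ℂ) * ee (n * θ)

lemma TT_eq (W X R : ℕ) (ρ : ℕ → ℝ) (θ : ℝ) : TT W X R ρ θ = ∑ r ∈ RR W R, ∑ n ∈ Finset.range X, (lam W n * (GT W r n : ℂ)) * (((hh X n / ρ n : ℝ) : ℂ) * ee (n * θ)) := by
  unfold TT
  rw [Finset.sum_comm]
  refine Finset.sum_congr rfl fun n _ => ?_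
  push_cast
  rw [Finset.mul_sum, Finset.sum_mul]
  refine Finset.sum_congr rfl fun r _ => by ring

lemma RR_card {Q : ℝ} (hQ : 1 ≤ Q) (W : ℕ) : ((RR W ⌊Q⌋₊).card : ℝ) ≤ Q := by
  classical
  have h1 : (RR W ⌊Q⌋₊).card ≤ ⌊Q⌋₊ := by
    refine (Finset.card_filter_le _ _).trans ?_
    simp
  exact (Nat.cast_le.2 h1).trans (Nat.floor_le (by linarith))

lemma RR_mem {Q : ℝ} (hQ : 1 ≤ Q) {W r : ℕ} (h : r ∈ RR W ⌊Q⌋₊) : good W r ∧ 0 < r ∧ (r : ℝ) ≤ Q := by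
  classical
  have := Finset.mem_filter.1 h
  have h2 := Finset.mem_Icc.1 this.1
  exact ⟨this.2, h2.1, (Nat.cast_le.2 h2.2).trans (Nat.floor_le (by linarith))⟩

lemma minor_T (w : ℕ) : ∀ᶠ Q : ℝ in atTop, ∀ N : ℕ, Real.log N = Real.log Q ^ 3 → ∀ W X : ℕ, 0 < W → Even W → (W : ℝ) ≤ Q ^ w → N ≤ W * X → W * X ≤ 2 * N →
    ∀ ρ : ℕ → ℝ, Monotone ρ → (Q ^ w)⁻¹ ≤ ρ 0 → ∀ θ, ¬ Maj (5 * (3 * w + 5) + 8) Q N W θ → ‖TT W X ⌊Q⌋₊ ρ θ‖ ≤ X / Q := by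
  filter_upwards [minor (3 * w + 5), ev_const 2] with Q hm hQ N hN W X hW0 hWe hWQ hX1 hX2 ρ hρ hρ0 θ hθ
  have hQ0 : (0 : ℝ) < Q := by linarith
  have hp : 0 < ρ 0 := lt_of_lt_of_le (by positivity) hρ0
  rw [TT_eq]
  have hb : ∀ r ∈ RR W ⌊Q⌋₊, ‖∑ n ∈ Finset.range X, (lam W n * (GT W r n : ℂ)) * (((hh X n / ρ n : ℝ) : ℂ) * ee (n * θ))‖ ≤ Q * W * Q * (2 * (N / Q ^ (3 * w + 5))) * Q ^ w := by
    intro r hr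
    obtain ⟨hg, hr0, hrQ⟩ := RR_mem (by linarith) hr
    have h1 := fun x hx => hm N hN W hW0 θ hθ r hr0 hrQ (fun n => (GT W r n : ℂ)) r (GT_per W r) (GT_bd hWe hg) x hx
    have h2 : ∀ k, ‖∑ n ∈ Finset.range k, (if n < X then (lam W n : ℂ) * (GT W r n : ℂ) * ee (n * θ) else 0)‖ ≤ Q * W * Q * (2 * (N / Q ^ (3 * w + 5))) := by
      intro k
      rw [trunc]
      refine (h1 _ ((Nat.mul_le_mul_left W (min_le_right _ _)).trans hX2)).trans ?_
      gcongr
    have h3 := abel_mono h2 (g_anti X hρ hp) (fun n => div_nonneg (hh_nonneg _ _) (hp.le.trans (hρ (Nat.zero_le _)))) X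
    rw [trunc_mul] at h3
    have e : ∑ n ∈ Finset.range X, (lam W n * (GT W r n : ℂ)) * (((hh X n / ρ n : ℝ) : ℂ) * ee (n * θ)) = ∑ n ∈ Finset.range X, (lam W n : ℂ) * (GT W r n : ℂ) * ee (n * θ) * ((hh X n / ρ n : ℝ) : ℂ) :=
      Finset.sum_congr rfl fun n _ => by ring
    rw [e]
    refine h3.trans ?_
    refine mul_le_mul_of_nonneg_left ?_ (by positivity)
    rw [hh_zero, one_div]
    exact inv_le_of_inv_le₀ (by positivity) hρ0
  refine (norm_sum_le_of_le _ hb).trans ?_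
  rw [Finset.sum_const, nsmul_eq_mul]
  have hNX : (N : ℝ) ≤ Q ^ w * X := by
    have : (N : ℝ) ≤ W * X := by exact_mod_cast hX1
    exact this.trans (mul_le_mul_of_nonneg_right hWQ (Nat.cast_nonneg _))
  calc ((RR W ⌊Q⌋₊).card : ℝ) * (Q * W * Q * (2 * (N / Q ^ (3 * w + 5))) * Q ^ w) ≤ Q * (Q * Q ^ w * Q * (Q * (Q ^ w * X / Q ^ (3 * w + 5))) * Q ^ w) := by
        have := RR_card (show 1 ≤ Q by linarith) W
        gcongr
    _ = X / Q := by
        have : Q ^ (3 * w + 5) = Q ^ w * Q ^ w * Q ^ w * Q ^ 5 := by ring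
        rw [this]; field_simp

lemma major_T (w J : ℕ) : ∀ᶠ Q : ℝ in atTop, ∀ N W X : ℕ, 0 < W → Even W → (W : ℝ) ≤ Q ^ w → 0 < N → N ≤ W * X → W * X ≤ 2 * N →
    ∀ ρ : ℕ → ℝ, Monotone ρ → (Q ^ w)⁻¹ ≤ ρ 0 → APH Q N W ρ (J + 2) (2 * J + 2 * w + 6) → ∀ (a : ℤ) (q : ℕ) (θ : ℝ), 0 < q → (q : ℝ) ≤ Q ^ (J + 1) → |θ - a / q| ≤ W * Q ^ J / N →
    ‖TT W X ⌊Q⌋₊ ρ θ - (∑ r ∈ RR W ⌊Q⌋₊, tau W q a r) * SS X (θ - a / q)‖ ≤ X / Q := by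
  filter_upwards [ev_const 15] with Q hQ N W X hW0 hWe hWQ hN0 hX1 hX2 ρ hρ hρ0 hAP a q θ hq0 hq hθ
  have hQ0 : (0 : ℝ) < Q := by linarith
  have hp : 0 < ρ 0 := lt_of_lt_of_le (by positivity) hρ0
  have hpn : ∀ n, 0 < ρ n := fun n => hp.trans_le (hρ (Nat.zero_le _))
  have hN0' : (0 : ℝ) < N := by exact_mod_cast hN0
  set η := θ - a / q with hη
  rw [TT_eq, Finset.sum_mul, ← Finset.sum_sub_distrib]
  set E : ℝ := Q ^ (J + 2) * Q * (N / Q ^ (2 * J + 2 * w + 6)) with hE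
  have hb : ∀ r ∈ RR W ⌊Q⌋₊, ‖∑ n ∈ Finset.range X, (lam W n * (GT W r n : ℂ)) * (((hh X n / ρ n : ℝ) : ℂ) * ee (n * θ)) - tau W q a r * SS X η‖ ≤ E * (Q ^ w * (15 * Q ^ J)) := by
    intro r hr
    obtain ⟨hg, hr0, hrQ⟩ := RR_mem (by linarith) hr
    have hmQ : ((r * q : ℕ) : ℝ) ≤ Q ^ (J + 2) := by
      push_cast
      calc (r : ℝ) * q ≤ Q * Q ^ (J + 1) := mul_le_mul hrQ hq (by positivity) hQ0.le
        _ = _ := by ring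
    set F : ℕ → ℂ := fun n => (GT W r n : ℂ) * ee (n * (a / q)) with hF
    have hFp : ∀ n, F (n + r * q) = F n := by
      intro n
      simp only [hF]
      rw [per_dvd (Dvd.intro q rfl) (φ := fun n => (GT W r n : ℂ)) (GT_per W r), per_dvd (Dvd.intro_left r rfl) (φ := fun n : ℕ => ee (n * (a / q))) (ee_per hq0 a)]
    have hFb : ∀ n, ‖F n‖ ≤ Q := by
      intro n
      simp only [hF]
      rw [norm_mul, ee_norm, mul_one]; exact (GT_bd hWe hg n).trans hrQ
    have h1 := fun x hx => hAP (r * q) (Nat.mul_pos hr0 hq0) hmQ F Q hFp hFb x hx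
    have htau : avg (r * q) (fun n => (uu W (r * q) n : ℂ) * F n) = tau W q a r := rfl
    rw [htau] at h1
    have h2 : ∀ k, ‖∑ n ∈ Finset.range k, (if n < X then (lam W n : ℂ) * F n - tau W q a r * ρ n else 0)‖ ≤ E := by
      intro k
      rw [trunc, Finset.sum_sub_distrib, ← Finset.mul_sum]
      refine (h1 _ ((Nat.mul_le_mul_left W (min_le_right _ _)).trans hX2)).trans ?_
      rw [hE]
      gcongr
    set u : ℕ → ℝ := fun n => hh X n / ρ n with hu
    have h3 := abel_var h2 (g := fun n => (u n : ℂ) * ee (n * η)) X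
    rw [trunc_mul] at h3
    have e : ∑ n ∈ Finset.range X, (lam W n * (GT W r n : ℂ)) * (((hh X n / ρ n : ℝ) : ℂ) * ee (n * θ)) - tau W q a r * SS X η =
        ∑ n ∈ Finset.range X, ((lam W n : ℂ) * F n - tau W q a r * ρ n) * ((u n : ℂ) * ee (n * η)) := by
      unfold SS
      rw [Finset.mul_sum, ← Finset.sum_sub_distrib]
      refine Finset.sum_congr rfl fun n _ => ?_
      have e1 : ee (n * θ) = ee (n * (a / q)) * ee (n * η) := by rw [← ee_add, hη]; congr 1; ring
      have e2 : (ρ n : ℂ) * u n = hh X n := by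
        rw [← ofReal_mul]; congr 1
        simp only [hu]
        rw [mul_div_cancel₀ _ (hpn n).ne']
      rw [e1, ← e2]
      simp only [hF, hu]; ring
    rw [e]
    refine h3.trans (mul_le_mul_of_nonneg_left ?_ (by positivity))
    refine (tv (g_anti X hρ hp) (fun n => div_nonneg (hh_nonneg _ _) (hpn n).le) η (X - 1)).trans ?_
    rw [hh_zero, one_div]
    refine mul_le_mul (inv_le_of_inv_le₀ (by positivity) hρ0) ?_ (by positivity) (by positivity)
    have h5 : ((X - 1 : ℕ) : ℝ) * |η| ≤ 2 * Q ^ J := by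
      have h6 : (W : ℝ) * X ≤ 2 * N := by exact_mod_cast hX2
      calc ((X - 1 : ℕ) : ℝ) * |η| ≤ X * (W * Q ^ J / N) := mul_le_mul (by exact_mod_cast Nat.sub_le _ _) hθ (abs_nonneg _) (Nat.cast_nonneg _)
        _ = (W * X) / N * Q ^ J := by ring
        _ ≤ 2 * Q ^ J := by
          refine mul_le_mul_of_nonneg_right ?_ (by positivity)
          rw [div_le_iff₀ hN0']; exact h6
    have h7 : 1 ≤ Q ^ J := one_le_pow₀ (by linarith)
    nlinarith
  refine (norm_sum_le_of_le _ hb).trans ?_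
  rw [Finset.sum_const, nsmul_eq_mul]
  have hNX : (N : ℝ) ≤ Q ^ w * X := by
    have : (N : ℝ) ≤ W * X := by exact_mod_cast hX1
    exact this.trans (mul_le_mul_of_nonneg_right hWQ (Nat.cast_nonneg _))
  calc ((RR W ⌊Q⌋₊).card : ℝ) * (E * (Q ^ w * (15 * Q ^ J))) ≤ Q * (Q ^ (J + 2) * Q * (Q ^ w * X / Q ^ (2 * J + 2 * w + 6)) * (Q ^ w * (Q * Q ^ J))) := by
        have := RR_card (show 1 ≤ Q by linarith) W
        rw [hE]
        gcongr
    _ = X / Q := by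
        have : Q ^ (2 * J + 2 * w + 6) = Q ^ J * Q ^ J * Q ^ w * Q ^ w * Q ^ 6 := by ring
        rw [this]; field_simp; ring

end

section
open Complex Metric Set Filter Topology MeasureTheory

lemma delsarte {X : ℕ} (hX : 0 < X) (w : ℕ → ℝ) (A : Finset ℕ) (hA : A ⊆ Finset.range X) (hw : ∀ a ∈ A, ∀ n < X, a + n ∈ A → w n = 0) {δ : ℝ} (hδ : 0 ≤ δ)
    (hT : ∀ θ : ℝ, -δ ≤ (∑ n ∈ Finset.range X, (w n : ℂ) * ee (n * θ)).re) :
    (A.card : ℝ) * (∑ n ∈ Finset.range X, (w n : ℂ) * ee (n * 0)).re ≤ δ * (2 * X) := by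
  set M := 2 * X with hM
  have hM0 : 0 < M := by omega
  have hMr : (M : ℝ) ≠ 0 := by exact_mod_cast hM0.ne'
  set Ah : ℕ → ℂ := fun j => ∑ a ∈ A, ee (a * (j / M)) with hAh
  set T : ℝ → ℂ := fun θ => ∑ n ∈ Finset.range X, (w n : ℂ) * ee (n * θ) with hTdef
  have key : ∀ n : ℕ, ∑ j ∈ Finset.range M, (normSq (Ah j) : ℂ) * ee (n * (j / M)) = ∑ a ∈ A, ∑ b ∈ A, (if (M : ℤ) ∣ (a : ℤ) - b + n then (M : ℂ) else 0) := by
    intro n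
    have e : ∀ j : ℕ, (normSq (Ah j) : ℂ) * ee (n * (j / M)) = ∑ a ∈ A, ∑ b ∈ A, ee (j * (((a : ℤ) - b + n : ℤ) / M)) := by
      intro j
      rw [← mul_conj, hAh]
      simp only [map_sum, ee_conj]
      rw [Finset.sum_mul_sum, Finset.sum_mul]
      refine Finset.sum_congr rfl fun a _ => ?_
      rw [Finset.sum_mul]
      refine Finset.sum_congr rfl fun b _ => ?_
      rw [← ee_add, ← ee_add]
      congr 1; push_cast; ring
    simp only [e]
    rw [Finset.sum_comm]
    refine Finset.sum_congr rfl fun a _ => ?_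
    rw [Finset.sum_comm]
    exact Finset.sum_congr rfl fun b _ => orth hM0 _
  have hlt : ∀ a ∈ A, a < X := fun a ha => Finset.mem_range.1 (hA ha)
  have hM' : (M : ℤ) = 2 * X := by rw [hM]; push_cast; ring
  have k0 : ∑ j ∈ Finset.range M, normSq (Ah j) = M * A.card := by
    have h1 := key 0
    have h2 : ∑ a ∈ A, ∑ b ∈ A, (if (M : ℤ) ∣ (a : ℤ) - b + (0 : ℕ) then (M : ℂ) else 0) = ∑ a ∈ A, (M : ℂ) := by
      refine Finset.sum_congr rfl fun a ha => ?_
      rw [Finset.sum_eq_single a]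
      · rw [if_pos (by simp)]
      · intro b hb hba
        rw [if_neg]
        rintro h
        have ha' := hlt a ha
        have hb' := hlt b hb
        have := Int.eq_zero_of_abs_lt_dvd h (by rw [abs_lt]; constructor <;> (push_cast; omega))
        push_cast at this; omega
      · exact fun h => absurd ha h
    rw [h2] at h1
    simp only [Nat.cast_zero, zero_mul, ee_zero, mul_one, Finset.sum_const, nsmul_eq_mul] at h1
    rw [mul_comm]
    exact_mod_cast h1
  have k1 : ∑ j ∈ Finset.range M, normSq (Ah j) * (T (j / M)).re = 0 := by
    have h1 : ∑ j ∈ Finset.range M, (normSq (Ah j) : ℂ) * T (j / M) = 0 := by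
      simp only [hTdef, Finset.mul_sum]
      rw [Finset.sum_comm]
      refine Finset.sum_eq_zero fun n hn => ?_
      have hn := Finset.mem_range.1 hn
      have e : ∀ j : ℕ, (normSq (Ah j) : ℂ) * ((w n : ℂ) * ee (n * (j / M))) = w n * ((normSq (Ah j) : ℂ) * ee (n * (j / M))) := fun j => by ring
      simp only [e]
      rw [← Finset.mul_sum, key n, Finset.mul_sum]
      refine Finset.sum_eq_zero fun a ha => ?_
      rw [Finset.mul_sum]
      refine Finset.sum_eq_zero fun b hb => ?_
      split_ifs with h
      · have ha' := hlt a ha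
        have hb' := hlt b hb
        have := Int.eq_zero_of_abs_lt_dvd h (by rw [abs_lt]; constructor <;> omega)
        rw [hw a ha n hn (by rw [show a + n = b by omega]; exact hb)]; simp
      · simp
    have h2 := congrArg re h1
    rw [re_sum] at h2
    simpa only [re_ofReal_mul, zero_re] using h2
  have k2 : normSq (Ah 0) * ((T ((0 : ℕ) / M)).re + δ) ≤ ∑ j ∈ Finset.range M, normSq (Ah j) * ((T (j / M)).re + δ) :=
    Finset.single_le_sum (f := fun j : ℕ => normSq (Ah j) * ((T (j / M)).re + δ)) (fun j _ => mul_nonneg (normSq_nonneg _) (by have := hT (j / M); simp only [hTdef]; linarith)) (Finset.mem_range.2 hM0)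
  simp only [mul_add] at k2
  rw [Finset.sum_add_distrib, k1, ← Finset.sum_mul, k0, zero_add] at k2
  have h0 : normSq (Ah 0) = (A.card : ℝ) ^ 2 := by
    simp only [hAh]
    simp [ee_zero, normSq_natCast, sq]
  rw [h0, Nat.cast_zero, zero_div] at k2
  rcases A.eq_empty_or_nonempty with rfl | hne
  · simp; positivity
  have hc : (0 : ℝ) < A.card := by exact_mod_cast hne.card_pos
  have hMX : (M : ℝ) = 2 * X := by rw [hM]; push_cast; ring
  rw [hMX] at k2
  have k3 : (A.card : ℝ) * (A.card * (T 0).re) ≤ A.card * (δ * (2 * X)) := by nlinarith [mul_nonneg (sq_nonneg (A.card : ℝ)) hδ]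
  exact le_of_mul_le_mul_left k3 hc

def Maj_J (w : ℕ) : ℕ := 5 * (3 * w + 5) + 8

theorem main_given (w : ℕ) : ∀ᶠ Q : ℝ in atTop, ∀ N : ℕ, Real.log N = Real.log Q ^ 3 → ∀ W X : ℕ, 0 < W → Even W → (W : ℝ) ≤ Q ^ w → 0 < N → N ≤ W * X → W * X ≤ 2 * N →
    ∀ ρ : ℕ → ℝ, Monotone ρ → (Q ^ w)⁻¹ ≤ ρ 0 → APH Q N W ρ (Maj_J w + 2) (2 * Maj_J w + 2 * w + 6) →
    ∀ A ⊆ Finset.range X, (∀ a ∈ A, ∀ n, a + n ∈ A → ¬ (W * n + 1).Prime) → (A.card : ℝ) ≤ X * (16 * 8 ^ 64 / Real.sqrt Q) := by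
  filter_upwards [minor_T w, major_T w (Maj_J w), ev_const 4] with Q hmi hma hQ N hN W X hW0 hWe hWQ hN0 hX1 hX2 ρ hρ hρ0 hAP A hA hAd
  have hQ0 : (0 : ℝ) < Q := by linarith
  have hX0 : 0 < X := by
    rcases Nat.eq_zero_or_pos X with h | h
    · subst h; omega
    · exact h
  have hXr : (0 : ℝ) < X := by exact_mod_cast hX0
  have hs : 0 < Real.sqrt Q := Real.sqrt_pos.2 hQ0
  have hss : Real.sqrt Q * Real.sqrt Q = Q := Real.mul_self_sqrt hQ0.le
  have hs1 : 1 ≤ Real.sqrt Q := Real.one_le_sqrt.2 (by linarith)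
  have hQs : (X : ℝ) / Q ≤ X / Real.sqrt Q := div_le_div_of_nonneg_left hXr.le hs (by nlinarith)
  set δ : ℝ := X * ((8 ^ 64 + 1) / Real.sqrt Q) with hδ
  have hδ' : δ = X * (8 ^ 64 / Real.sqrt Q) + X / Real.sqrt Q := by rw [hδ]; ring
  have hδ0 : 0 ≤ X * (8 ^ 64 / Real.sqrt Q) := by positivity
  have hT : ∀ θ, -δ ≤ (TT W X ⌊Q⌋₊ ρ θ).re := by
    intro θ
    by_cases hM : Maj (Maj_J w) Q N W θ
    · obtain ⟨a0, q0, hq0, hq0Q, hθ⟩ := hM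
      set x : ℚ := (a0 : ℚ) / q0 with hx
      have hden : x.den ≤ q0 := by
        have : ((x.den : ℤ)) ∣ (q0 : ℤ) := by
          have := Rat.den_dvd a0 q0
          rwa [Rat.divInt_eq_div, Int.cast_natCast] at this
        exact Nat.le_of_dvd hq0 (Int.natCast_dvd_natCast.1 this)
      have hxr : (a0 : ℝ) / q0 = (x.num : ℝ) / x.den := by
        rw [← Rat.cast_def, hx]; push_cast; rfl
      have hco : IsCoprime x.num (x.den : ℤ) := by
        rw [Int.isCoprime_iff_gcd_eq_one]; exact x.reduced
      rw [hxr] at hθ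
      have h1 := hma N W X hW0 hWe hWQ hN0 hX1 hX2 ρ hρ hρ0 hAP x.num x.den θ x.den_pos ((Nat.cast_le.2 hden).trans hq0Q) hθ
      have h2 := (abs_le.1 ((abs_re_le_norm _).trans h1)).1
      rw [sub_re] at h2
      have h3 : -(X * (8 ^ 64 / Real.sqrt Q)) ≤ ((∑ r ∈ RR W ⌊Q⌋₊, tau W x.den x.num r) * SS X (θ - x.num / x.den)).re := by
        rcases tau_sum hWe x.den_pos hco rfl (show 1 ≤ Q by linarith) with ⟨t, ht, hsum, -⟩ | ⟨-, hn⟩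
        · rw [hsum, re_ofReal_mul]
          have := mul_nonneg ht (SS_re hX0 (θ - x.num / x.den))
          linarith
        · refine (abs_le.1 ((abs_re_le_norm _).trans ?_)).1
          rw [norm_mul, mul_comm]
          exact mul_le_mul (SS_norm _ _) hn (norm_nonneg _) hXr.le
      linarith
    · have h1 := hmi N hN W X hW0 hWe hWQ hX1 hX2 ρ hρ hρ0 θ hM
      have h2 := (abs_le.1 ((abs_re_le_norm _).trans h1)).1
      linarith
  have hT0 : (X : ℝ) / 4 ≤ (TT W X ⌊Q⌋₊ ρ 0).re := by
    have h1 := hma N W X hW0 hWe hWQ hN0 hX1 hX2 ρ hρ hρ0 hAP 0 1 0 one_pos (by simpa using one_le_pow₀ (by linarith)) (by simp; positivity)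
    have h2 := (abs_le.1 ((abs_re_le_norm _).trans h1)).1
    rcases tau_sum (a := 0) (q := 1) hWe one_pos (by rw [Nat.cast_one]; exact isCoprime_one_right) rfl (show 1 ≤ Q by linarith) with ⟨t, ht, hsum, ht1⟩ | ⟨h, -⟩
    · rw [hsum, ht1 rfl] at h2
      simp only [ofReal_one, one_mul, Int.cast_zero, zero_div, sub_zero, sub_re] at h2
      have h3 := SS_zero hX0
      have h4 : (X : ℝ) / Q ≤ X / 4 := div_le_div_of_nonneg_left hXr.le (by norm_num) hQ
      linarith
    · exact absurd rfl h
  have hd := delsarte hX0 (fun n => lam W n * (hh X n / ρ n) * ∑ r ∈ RR W ⌊Q⌋₊, GT W r n) A hA (fun a ha n _ h => by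
    have := hAd a ha n h
    simp only [lam]
    rw [if_neg this]; ring) (δ := δ) (by positivity) hT
  have h5 : (A.card : ℝ) * (X / 4) ≤ δ * (2 * X) := (mul_le_mul_of_nonneg_left hT0 (Nat.cast_nonneg _)).trans hd
  have h6 : (A.card : ℝ) ≤ 8 * δ := by
    have : (A.card : ℝ) * X ≤ (8 * δ) * X := by linarith
    exact le_of_mul_le_mul_right this hXr
  refine h6.trans ?_
  rw [hδ]
  have : ((8 : ℝ) ^ 64 + 1) / Real.sqrt Q ≤ (2 * 8 ^ 64) / Real.sqrt Q := div_le_div_of_nonneg_right (by norm_num) hs.le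
  calc 8 * (X * ((8 ^ 64 + 1) / Real.sqrt Q)) ≤ 8 * (X * ((2 * 8 ^ 64) / Real.sqrt Q)) := by gcongr
    _ = _ := by ring

end

section
open Complex Metric Set Filter Topology MeasureTheory

lemma pigeon {W N : ℕ} (hW : 0 < W) {A : Finset ℕ} (hA : A ⊆ Finset.Icc 1 N) (hd : ∀ a ∈ A, ∀ b ∈ A, ¬ Nat.Prime (a - b + 1)) {K : ℝ}
    (h : ∀ B ⊆ Finset.range (N / W + 1), (∀ a ∈ B, ∀ n, a + n ∈ B → ¬ (W * n + 1).Prime) → (B.card : ℝ) ≤ K) : (A.card : ℝ) ≤ W * K := by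
  classical
  have h1 : A.card = ∑ s ∈ Finset.range W, (A.filter fun a => a % W = s).card :=
    Finset.card_eq_sum_card_fiberwise fun a _ => Finset.mem_coe.2 (Finset.mem_range.2 (Nat.mod_lt a hW))
  have h2 : ∀ s ∈ Finset.range W, ((A.filter fun a => a % W = s).card : ℝ) ≤ K := by
    intro s _
    have hinj : Set.InjOn (fun a => a / W) (A.filter fun a => a % W = s) := by
      intro a ha b hb hab
      have ha := (Finset.mem_filter.1 (Finset.mem_coe.1 ha)).2
      have hb := (Finset.mem_filter.1 (Finset.mem_coe.1 hb)).2
      have hab : a / W = b / W := hab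
      rw [← Nat.div_add_mod a W, ← Nat.div_add_mod b W, ha, hb, hab]
    rw [← Finset.card_image_of_injOn hinj]
    refine h _ ?_ ?_
    · intro x hx
      obtain ⟨a, ha, rfl⟩ := Finset.mem_image.1 hx
      have := Finset.mem_Icc.1 (hA (Finset.mem_filter.1 ha).1)
      exact Finset.mem_range.2 (Nat.lt_succ_of_le (Nat.div_le_div_right this.2))
    · intro x hx n hxn
      obtain ⟨a, ha, hax⟩ := Finset.mem_image.1 hx
      obtain ⟨b, hb, hbx⟩ := Finset.mem_image.1 hxn
      rw [Finset.mem_filter] at ha hb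
      have h3 := hd b hb.1 a ha.1
      have ea := Nat.div_add_mod a W
      have eb := Nat.div_add_mod b W
      rw [ha.2] at ea
      rw [hb.2] at eb
      rw [hax] at ea
      rw [hbx, mul_add] at eb
      rwa [show b - a = W * n by omega] at h3
  rw [h1]; push_cast
  refine (Finset.sum_le_sum h2).trans ?_
  rw [Finset.sum_const, Finset.card_range, nsmul_eq_mul]

lemma rho_mono {W : ℕ} {ε β : ℝ} (hε : 0 ≤ ε) (hβ : β ≤ 1) : Monotone (rho W ε β) := by
  intro m n h
  unfold rho dens
  refine div_le_div_of_nonneg_right (Finset.sum_le_sum fun i _ => ?_) (Nat.cast_nonneg _)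
  have h1 : ((W * m + i + 2 : ℕ) : ℝ) ≤ (W * n + i + 2 : ℕ) := by
    have := Nat.mul_le_mul_left W h
    exact_mod_cast (by omega : W * m + i + 2 ≤ W * n + i + 2)
  have h2 := Real.rpow_le_rpow_of_nonpos (z := β - 1) (by positivity) h1 (by linarith)
  have := mul_le_mul_of_nonneg_left h2 hε
  linarith

lemma rho_low {W : ℕ} {β : ℝ} (hW : 0 < W) (h0 : 0 ≤ β) (hβ : β ≤ 1) : (1 - β) / 2 ≤ rho W 1 β 0 := by
  have hW' : (0 : ℝ) < W := by exact_mod_cast hW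
  unfold rho
  rw [le_div_iff₀ hW']
  have : ∀ i ∈ Finset.range W, (1 - β) / 2 ≤ dens 1 β (W * 0 + i + 2) := by
    intro i _
    unfold dens
    have h1 : ((W * 0 + i + 2 : ℕ) : ℝ) ^ (β - 1) ≤ (2 : ℝ) ^ (β - 1) := by
      refine Real.rpow_le_rpow_of_nonpos (by norm_num) ?_ (by linarith)
      push_cast; have : (0 : ℝ) ≤ i := Nat.cast_nonneg _; linarith
    have h2 : (2 : ℝ) ^ (β - 1) = (1 + (-1 / 2)) ^ (1 - β) := by
      rw [show (1 : ℝ) + (-1 / 2) = 2⁻¹ by norm_num, Real.inv_rpow (by norm_num), ← Real.rpow_neg (by norm_num)]; congr 1; ring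
    have h3 := rpow_one_add_le_one_add_mul_self (s := -1 / 2) (p := 1 - β) (by norm_num) (by linarith) (by linarith)
    rw [← h2] at h3
    linarith
  have h2 := Finset.sum_le_sum this
  rw [Finset.sum_const, Finset.card_range, nsmul_eq_mul] at h2
  linarith

lemma rho_zero {W : ℕ} {β : ℝ} (hW : 0 < W) (n : ℕ) : rho W 0 β n = 1 := by
  have hW' : (W : ℝ) ≠ 0 := by exact_mod_cast hW.ne'
  unfold rho dens
  simp [hW']

lemma APH_mono {Q : ℝ} {N W k B B' : ℕ} {ρ : ℕ → ℝ} (hQ : 1 ≤ Q) (hB : B ≤ B') (h : APH Q N W ρ k B') : APH Q N W ρ k B := by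
  intro m hm hmQ F C hF hC x hx
  refine (h m hm hmQ F C hF hC x hx).trans ?_
  have hC0 : 0 ≤ C := (norm_nonneg _).trans (hC 0)
  have := pow_le_pow_right₀ hQ hB
  have h2 : 0 < Q ^ B := by positivity
  gcongr

theorem core : ∀ᶠ Q : ℝ in atTop, ∀ N : ℕ, Real.log N = Real.log Q ^ 3 → 0 < N → ∀ A ⊆ Finset.Icc 1 N, (∀ a ∈ A, ∀ b ∈ A, ¬ Nat.Prime (a - b + 1)) →
    (A.card : ℝ) ≤ 2 * N * (16 * 8 ^ 64 / Real.sqrt Q) := by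
  obtain ⟨kA, hkA⟩ : ∃ k, k = Maj_J 1 + 2 + 1 := ⟨_, rfl⟩
  obtain ⟨w, hw⟩ : ∃ w, w = 2 * kA + 2 := ⟨_, rfl⟩
  obtain ⟨B, hB⟩ : ∃ B, B = 2 * Maj_J w + 2 * w + 6 := ⟨_, rfl⟩
  have hJ : Maj_J 1 ≤ Maj_J w := by unfold Maj_J; omega
  have hBA : 2 * Maj_J 1 + 2 * 1 + 6 ≤ B := by omega
  have hK : kA ≤ Maj_J w + 2 + w := by omega
  filter_upwards [pnt_W (Maj_J w + 2 + w) (B + 1) kA hK, main_given 1, main_given w, ap_fun (k := Maj_J 1 + 2) (w := 1) (B := B), ap_fun (k := Maj_J w + 2) (w := w) (B := B), ev_pow w, ev_const 51200]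
    with Q hP hM1 hMw hA1 hAw hpow hQ N hN hN0 A hA hd
  have hQ0 : (0 : ℝ) < Q := by linarith
  have hQ1 : (1 : ℝ) ≤ Q := by linarith
  have hQwN := hpow N hN
  have fin : ∀ W : ℕ, 0 < W → (W : ℝ) ≤ Q ^ w → N ≤ W * (N / W + 1) ∧ W * (N / W + 1) ≤ 2 * N := by
    intro W hW hWQ
    have h1 : W ≤ N := by exact_mod_cast hWQ.trans hQwN
    have h2 := Nat.div_add_mod N W
    have h3 := Nat.mod_lt N hW
    rw [mul_add, mul_one]
    constructor <;> omega
  have fin2 : ∀ W : ℕ, 0 < W → (W : ℝ) ≤ Q ^ w → (∀ A ⊆ Finset.range (N / W + 1), (∀ a ∈ A, ∀ n, a + n ∈ A → ¬ (W * n + 1).Prime) → (A.card : ℝ) ≤ (N / W + 1 : ℕ) * (16 * 8 ^ 64 / Real.sqrt Q)) →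
      (A.card : ℝ) ≤ 2 * N * (16 * 8 ^ 64 / Real.sqrt Q) := by
    intro W hW hWQ h
    refine (pigeon hW hA hd h).trans ?_
    rw [← mul_assoc]
    refine mul_le_mul_of_nonneg_right ?_ (by positivity)
    exact_mod_cast (fin W hW hWQ).2
  have hw1 : Q ^ 1 ≤ Q ^ w := pow_le_pow_right₀ hQ1 (by omega)
  rcases hP N hN with h | ⟨W, β, hW0, hWe, hWQ, hβ, hβ1, hβ2, h⟩
  · have h2Q : ((2 : ℕ) : ℝ) ≤ Q ^ 1 := by push_cast; linarith
    have hAP := hA1 N hN 2 0 1 two_pos h2Q ⟨le_rfl, zero_le_one⟩ le_rfl (hkA ▸ h)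
    have h3 := fin 2 two_pos (h2Q.trans hw1)
    refine fin2 2 two_pos (h2Q.trans hw1) ?_
    refine hM1 N hN 2 (N / 2 + 1) two_pos even_two h2Q hN0 h3.1 h3.2 (rho 2 0 1) (rho_mono le_rfl le_rfl) ?_ (APH_mono hQ1 hBA hAP)
    rw [rho_zero two_pos]
    exact inv_le_one_of_one_le₀ (one_le_pow₀ hQ1)
  · have hWw : (W : ℝ) ≤ Q ^ w := by
      refine hWQ.trans ?_
      calc 2 * Q ^ kA ≤ Q * Q ^ kA := mul_le_mul_of_nonneg_right (by linarith) (by positivity)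
        _ = Q ^ (kA + 1) := by ring
        _ ≤ Q ^ w := pow_le_pow_right₀ hQ1 (by omega)
    have hAP := hAw N hN W 1 β hW0 hWw ⟨zero_le_one, le_rfl⟩ hβ1.le h
    have h3 := fin W hW0 hWw
    refine fin2 W hW0 hWw ?_
    refine hMw N hN W (N / W + 1) hW0 hWe hWw hN0 h3.1 h3.2 (rho W 1 β) (rho_mono zero_le_one hβ1.le) ?_ (hB ▸ hAP)
    refine le_trans ?_ (rho_low hW0 (by linarith) hβ1.le)
    have h4 : (Q ^ w)⁻¹ ≤ 1 / (25600 * (Q ^ kA) ^ 2) / 2 := by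
      rw [div_div, ← one_div]
      refine one_div_le_one_div_of_le (by positivity) ?_
      calc 25600 * (Q ^ kA) ^ 2 * 2 = 51200 * (Q ^ kA) ^ 2 := by ring
        _ ≤ Q ^ 2 * (Q ^ kA) ^ 2 := mul_le_mul_of_nonneg_right (by nlinarith) (by positivity)
        _ = Q ^ w := by rw [hw]; ring
    linarith

theorem final :
    ∃ c C : ℝ, 0 < c ∧ 0 < C ∧
      ∀ N : ℕ, 0 < N → ∀ A : Finset ℕ, A ⊆ Finset.Icc 1 N →
        (∀ a ∈ A, ∀ b ∈ A, ¬ Nat.Prime (a - b + 1)) →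
        (A.card : ℝ) ≤ C * N * Real.exp (-c * Real.log N ^ ((1 : ℝ) / 3)) := by
  obtain ⟨Q0, hQ0⟩ := eventually_atTop.1 core
  refine ⟨1 / 2, max (2 * (16 * 8 ^ 64)) (|Q0| + 1), by norm_num, lt_max_of_lt_left (by norm_num), ?_⟩
  intro N hN A hA hd
  have hN1 : (1 : ℝ) ≤ N := by exact_mod_cast hN
  have hl : 0 ≤ Real.log N := Real.log_nonneg hN1
  set L := Real.log N ^ ((1 : ℝ) / 3) with hL
  have hL0 : 0 ≤ L := Real.rpow_nonneg hl _
  have hL3 : L ^ 3 = Real.log N := by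
    rw [hL, ← Real.rpow_natCast, ← Real.rpow_mul hl]; norm_num
  set Q := Real.exp L with hQ
  have hs : Real.exp (-(1 / 2) * L) = 1 / Real.sqrt Q := by
    rw [hQ, Real.sqrt_eq_rpow, ← Real.exp_mul, one_div (Real.exp _), ← Real.exp_neg]; congr 1; ring
  have hQ1 : 1 ≤ Q := Real.one_le_exp hL0
  have hsq : 0 < Real.sqrt Q := Real.sqrt_pos.2 (by linarith)
  rw [hs]
  by_cases h : Q0 ≤ Q
  · refine (hQ0 Q h N (by rw [hQ, Real.log_exp, hL3]) hN A hA hd).trans ?_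
    calc 2 * (N : ℝ) * (16 * 8 ^ 64 / Real.sqrt Q) = (2 * (16 * 8 ^ 64)) * N * (1 / Real.sqrt Q) := by ring
      _ ≤ _ := by
        refine mul_le_mul_of_nonneg_right (mul_le_mul_of_nonneg_right (le_max_left _ _) (by linarith)) (by positivity)
  · push Not at h
    have h1 : (A.card : ℝ) ≤ N := by
      have := Finset.card_le_card hA
      rw [Nat.card_Icc] at this
      exact_mod_cast (by omega : A.card ≤ N)
    have h2 : Real.sqrt Q ≤ |Q0| + 1 := by
      have : Real.sqrt Q ≤ Q := by
        rw [Real.sqrt_le_left (by linarith)]; nlinarith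
      linarith [le_abs_self Q0]
    refine h1.trans ?_
    rw [mul_one_div, le_div_iff₀ hsq, mul_comm]
    exact mul_le_mul_of_nonneg_right (h2.trans (le_max_right _ _)) (by linarith)

end

theorem shifted_primes_difference_set :
    ∃ c C : ℝ, 0 < c ∧ 0 < C ∧
      ∀ N : ℕ, 0 < N → ∀ A : Finset ℕ, A ⊆ Finset.Icc 1 N →
        (∀ a ∈ A, ∀ b ∈ A, ¬ Nat.Prime (a - b + 1)) →
        (A.card : ℝ) ≤ C * N * Real.exp (-c * Real.log N ^ ((1 : ℝ) / 3)) :=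
  final
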